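/- Let β be an irrational real number, let λ1, λ2, λ3 ≥ 0 with at least one of them positive, and suppose 1 ≤ λ2 and λ1 + λ3 ≤ λ2 (region II of extended Harper's model). Let θ ∈ ℝ and let H be any bounded linear operator on ℓ²(ℤ, ℂ) satisfying (Hψ)_k = 2cos(2π(θ+βk))·ψ_k + c(θ+βk)·ψ_{k+1} + conj(c(θ+β(k−1)))·ψ_{k−1} for all ψ ∈ ℓ²(ℤ,ℂ) and k ∈ ℤ. Then for every real E in the spectrum of H, the Lyapunov exponent of the transfer-matrix cocycle satisfies L(β, A^E) = log((λ2 + √(λ2² − 4λ1λ3))/2); equivalently, the Lyapunov exponent of extended Harper's model on the spectrum is zero throughout region II. -/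

import Mathlib

open MeasureTheory Filter Complex
open scoped ENNReal Real NNReal

noncomputable section

attribute [local instance] Matrix.frobeniusNormedAddCommGroup

/-- The `n`-step cocycle iterate `D^{(n)}_β(x) = D(x+(n-1)β)⋯D(x)`. -/
def cocycleIter (D : ℝ → Matrix (Fin 2) (Fin 2) ℂ) (β : ℝ) : ℕ → ℝ → Matrix (Fin 2) (Fin 2) ℂ
  | 0, _ => 1
  | n + 1, x => cocycleIter D β n (x + β) * D x

/-- The extended-real-valued integral `∫₀¹ log (g x) dx`, with value `-∞` allowed
(the positive and negative parts are integrated separately; `log 0 = -∞`). -/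
def logIntegral (g : ℝ → ℝ) : EReal :=
  ((∫⁻ x in Set.Ioc (0 : ℝ) 1, ENNReal.ofReal (Real.log (g x))) : EReal) -
    ((∫⁻ x in Set.Ioc (0 : ℝ) 1,
        if g x = 0 then (⊤ : ℝ≥0∞) else ENNReal.ofReal (-Real.log (g x))) : EReal)

/-- The Lyapunov exponent `L(β, D) = inf_{n ≥ 1} (1/n) ∫₀¹ log ‖D^{(n)}_β(x)‖ dx ∈ ℝ ∪ {-∞}`. -/
def lyapunov (β : ℝ) (D : ℝ → Matrix (Fin 2) (Fin 2) ℂ) : EReal :=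
  ⨅ n : ℕ, ((((n : ℝ) + 1)⁻¹ : ℝ) : EReal) * logIntegral fun x => ‖cocycleIter D β (n + 1) x‖

/-- `c(z) = λ₃ e^{-2πi(z+β/2)} + λ₂ + λ₁ e^{2πi(z+β/2)}` of extended Harper's model. -/
def harperC (lam1 lam2 lam3 β : ℝ) (z : ℂ) : ℂ :=
  (lam3 : ℂ) * Complex.exp (-(2 * (π : ℂ) * Complex.I) * (z + (β : ℂ) / 2)) + (lam2 : ℂ) +
    (lam1 : ℂ) * Complex.exp ((2 * (π : ℂ) * Complex.I) * (z + (β : ℂ) / 2))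

/-- `c̃(z) = λ₃ e^{2πi(z+β/2)} + λ₂ + λ₁ e^{-2πi(z+β/2)}`, the entire extension of
`x ↦ conj (c x)` from `ℝ`. -/
def harperCt (lam1 lam2 lam3 β : ℝ) (z : ℂ) : ℂ :=
  (lam3 : ℂ) * Complex.exp ((2 * (π : ℂ) * Complex.I) * (z + (β : ℂ) / 2)) + (lam2 : ℂ) +
    (lam1 : ℂ) * Complex.exp (-(2 * (π : ℂ) * Complex.I) * (z + (β : ℂ) / 2))

/-- The transfer matrix `A^E(z) = [[E - 2cos(2πz), -c̃(z-β)], [c(z), 0]]`. -/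
def harperA (lam1 lam2 lam3 β : ℝ) (E : ℂ) (z : ℂ) : Matrix (Fin 2) (Fin 2) ℂ :=
  !![E - 2 * Complex.cos (2 * (π : ℂ) * z), -harperCt lam1 lam2 lam3 β (z - (β : ℂ));
     harperC lam1 lam2 lam3 β z, 0]

section

/-- The character `z ↦ e^{2πiz}`. -/
def ee (z : ℂ) : ℂ := Complex.exp (2 * (π : ℂ) * Complex.I * z)

lemma ee_ne_zero (z : ℂ) : ee z ≠ 0 := Complex.exp_ne_zero _

lemma ee_add (z w : ℂ) : ee (z + w) = ee z * ee w := by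
  simp [ee, mul_add, Complex.exp_add]

lemma norm_ee (z : ℂ) : ‖ee z‖ = Real.exp (-(2 * π * z.im)) := by
  simp [ee, Complex.norm_exp]

lemma norm_ee_line (x y : ℝ) : ‖ee (x + y * Complex.I)‖ = Real.exp (-(2 * π * y)) := by
  simp [norm_ee]

lemma ee_one : ee 1 = 1 := by simp [ee, Complex.exp_two_pi_mul_I]

lemma ee_add_one (z : ℂ) : ee (z + 1) = ee z := by simp [ee_add, ee_one]

lemma norm_ee_ofReal (x : ℝ) : ‖ee x‖ = 1 := by simp [norm_ee]

lemma differentiable_ee : Differentiable ℂ ee := by unfold ee; fun_prop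

lemma continuous_ee : Continuous ee := differentiable_ee.continuous

lemma ee_eq_circleMap (x y : ℝ) :
    ee (x + y * Complex.I) = circleMap 0 (Real.exp (-(2 * π * y))) (2 * π * x) := by
  simp only [ee, circleMap, zero_add, Complex.ofReal_exp, ← Complex.exp_add]
  congr 1
  push_cast
  ring_nf
  simp
  ring

lemma integral_line_eq_circleAverage (g : ℂ → ℝ) (y : ℝ) :
    ∫ x in (0 : ℝ)..1, g (ee (x + y * Complex.I)) =
      Real.circleAverage g 0 (Real.exp (-(2 * π * y))) := by
  simp only [ee_eq_circleMap, Real.circleAverage_def]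
  rw [intervalIntegral.integral_comp_mul_left
    (fun θ => g (circleMap 0 (Real.exp (-(2 * π * y))) θ)) (by positivity : (2 * π) ≠ 0)]
  simp

lemma circleIntegrable_log_norm_eval (p : Polynomial ℂ) (c : ℂ) (R : ℝ) :
    CircleIntegrable (fun z => Real.log ‖p.eval z‖) c R :=
  (analyticOnNhd_id.aeval_polynomial p).meromorphicOn.circleIntegrable_log_norm

lemma intervalIntegrable_line_of_circleIntegrable {g : ℂ → ℝ} {y : ℝ}
    (h : CircleIntegrable g 0 (Real.exp (-(2 * π * y)))) :
    IntervalIntegrable (fun x : ℝ => g (ee (x + y * Complex.I))) volume 0 1 := by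
  simp only [ee_eq_circleMap]
  rw [circleIntegrable_def] at h
  have := h.comp_mul_left (c := 2 * π)
  simpa [show (2 * π) / (2 * π) = 1 from div_self (by positivity)] using this

lemma circleAverage_log_norm_eval_mul {p q : Polynomial ℂ} (hp : p ≠ 0) (hq : q ≠ 0)
    {R : ℝ} (hR : R ≠ 0) :
    Real.circleAverage (fun z => Real.log ‖(p * q).eval z‖) 0 R =
      Real.circleAverage (fun z => Real.log ‖p.eval z‖) 0 R +
        Real.circleAverage (fun z => Real.log ‖q.eval z‖) 0 R := by
  rw [← Real.circleAverage_add (circleIntegrable_log_norm_eval p 0 R)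
    (circleIntegrable_log_norm_eval q 0 R)]
  apply Real.circleAverage_congr_codiscreteWithin _ hR
  apply codiscreteWithin_iff_locallyFiniteComplementWithin.2
  intro z _
  refine ⟨Set.univ, Filter.univ_mem, ?_⟩
  apply (p * q).roots.toFinset.finite_toSet.subset
  rintro w ⟨_, hw1, hw2⟩
  contrapose! hw2
  have : (p * q).eval w ≠ 0 := by
    intro h
    apply hw2
    simp [Polynomial.mem_roots', hp, hq] at h ⊢
    exact h
  simp only [Polynomial.eval_mul, mul_ne_zero_iff] at this
  simp only [Set.mem_ofPred_eq, Polynomial.eval_mul, norm_mul, Pi.add_apply]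
  exact Real.log_mul (norm_ne_zero_iff.2 this.1) (norm_ne_zero_iff.2 this.2)

lemma circleAverage_log_norm_sub {R : ℝ} (hR : 0 < R) (ζ : ℂ) :
    Real.circleAverage (fun z => Real.log ‖z - ζ‖) 0 R = Real.log (max R ‖ζ‖) := by
  rw [circleAverage_log_norm_sub_const_eq_log_radius_add_posLog hR.ne', zero_sub, norm_neg,
    Real.posLog_eq_log_max_one (by positivity), ← Real.log_mul hR.ne' (by positivity),
    mul_max_of_nonneg _ _ hR.le]
  simp [hR.ne']

/-- Jensen's formula for polynomials, in terms of roots. -/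
lemma circleAverage_log_norm_eval {p : Polynomial ℂ} (hp : p ≠ 0) {R : ℝ} (hR : 0 < R) :
    Real.circleAverage (fun z => Real.log ‖p.eval z‖) 0 R =
      Real.log ‖p.leadingCoeff‖ + (p.roots.map fun ζ => Real.log (max R ‖ζ‖)).sum := by
  have key : ∀ s : Multiset ℂ,
      Real.circleAverage
        (fun z => Real.log ‖((s.map fun ζ => Polynomial.X - Polynomial.C ζ).prod).eval z‖) 0 R =
        (s.map fun ζ => Real.log (max R ‖ζ‖)).sum := by
    intro s
    induction s using Multiset.induction_on with
    | empty => simp [Real.circleAverage_const]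
    | cons a s ih =>
      rw [Multiset.map_cons, Multiset.prod_cons, circleAverage_log_norm_eval_mul
        (Polynomial.X_sub_C_ne_zero a) ?_ hR.ne', ih, Multiset.map_cons, Multiset.sum_cons]
      · congr 1
        simpa using circleAverage_log_norm_sub hR a
      · exact (Polynomial.monic_multiset_prod_of_monic _ _
          fun ζ _ => Polynomial.monic_X_sub_C ζ).ne_zero
  have hfac := (IsAlgClosed.splits p).eq_prod_roots
  have hl : p.leadingCoeff ≠ 0 := Polynomial.leadingCoeff_ne_zero.2 hp
  conv_lhs => rw [hfac]
  rw [circleAverage_log_norm_eval_mul (by simpa using hl) ?_ hR.ne', key]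
  · simp [Real.circleAverage_const]
  · exact (Polynomial.monic_multiset_prod_of_monic _ _
          fun ζ _ => Polynomial.monic_X_sub_C ζ).ne_zero

/-- `p` represents the trigonometric function `f` of order at most `n`. -/
def IsTrig (n : ℕ) (f : ℂ → ℂ) (p : Polynomial ℂ) : Prop :=
  ∀ z, f z * ee z ^ n = p.eval (ee z)

/-- The mean of `log |f|` over the horizontal line at height `y`. -/
def lineMean (f : ℂ → ℂ) (y : ℝ) : ℝ :=
  ∫ x in (0 : ℝ)..1, Real.log ‖f (x + y * Complex.I)‖

variable {n : ℕ} {f : ℂ → ℂ} {p : Polynomial ℂ}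

lemma IsTrig.eval_eq_zero_iff (h : IsTrig n f p) (z : ℂ) : p.eval (ee z) = 0 ↔ f z = 0 := by
  rw [← h z]; simp [ee_ne_zero]

lemma IsTrig.eq_div (h : IsTrig n f p) (z : ℂ) : f z = p.eval (ee z) / ee z ^ n := by
  rw [← h z]; field_simp [ee_ne_zero]

lemma IsTrig.differentiable (h : IsTrig n f p) : Differentiable ℂ f := by
  have : f = fun z => p.eval (ee z) / ee z ^ n := funext h.eq_div
  rw [this]
  exact (p.differentiable.comp differentiable_ee).div (differentiable_ee.pow n)
    fun z => pow_ne_zero _ (ee_ne_zero z)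

lemma IsTrig.add_one (h : IsTrig n f p) (z : ℂ) : f (z + 1) = f z := by
  rw [h.eq_div, h.eq_div, ee_add_one]

lemma IsTrig.log_norm (h : IsTrig n f p) {z : ℂ} (hz : f z ≠ 0) :
    Real.log ‖f z‖ = 2 * π * n * z.im + Real.log ‖p.eval (ee z)‖ := by
  have h1 : p.eval (ee z) ≠ 0 := (h.eval_eq_zero_iff z).not.2 hz
  rw [h.eq_div, norm_div, Real.log_div (norm_ne_zero_iff.2 h1)
    (by simp [ee_ne_zero]), norm_pow, Real.log_pow, norm_ee, Real.log_exp]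
  ring

lemma IsTrig.finite_zeros (h : IsTrig n f p) (hp : p ≠ 0) (y : ℝ) :
    {x ∈ Set.Ioc (0 : ℝ) 1 | f (x + y * Complex.I) = 0}.Finite := by
  apply Set.Finite.of_finite_image (f := fun x : ℝ => ee (x + y * Complex.I))
  · apply p.roots.toFinset.finite_toSet.subset
    rintro _ ⟨x, ⟨_, hx⟩, rfl⟩
    simpa [hp] using (h.eval_eq_zero_iff _).2 hx
  · intro a ha b hb hab
    simp only [ee_eq_circleMap] at hab
    have hinj := injOn_circleMap_of_abs_sub_le (c := 0) (R := Real.exp (-(2 * π * y)))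
      (a := 0) (b := 2 * π) (Real.exp_pos _).ne' (by simp [abs_of_pos Real.pi_pos])
    have h1 : 0 < 2 * π := by positivity
    have := hinj (x₁ := 2 * π * a) (x₂ := 2 * π * b)
      (by rw [Set.uIoc_of_le h1.le]; constructor <;> nlinarith [ha.1.1, ha.1.2])
      (by rw [Set.uIoc_of_le h1.le]; constructor <;> nlinarith [hb.1.1, hb.1.2]) hab
    exact mul_left_cancel₀ h1.ne' this

lemma IsTrig.ae_ne_zero (h : IsTrig n f p) (hp : p ≠ 0) (y : ℝ) :
    ∀ᵐ x : ℝ ∂(volume.restrict (Set.Ioc (0 : ℝ) 1)), f (x + y * Complex.I) ≠ 0 := by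
  rw [ae_restrict_iff' measurableSet_Ioc, ae_iff]
  apply Set.Finite.measure_zero
  convert h.finite_zeros hp y using 1
  ext x
  simp [and_assoc]

lemma IsTrig.log_norm_ae (h : IsTrig n f p) (hp : p ≠ 0) (y : ℝ) :
    ∀ᵐ x : ℝ ∂(volume.restrict (Set.Ioc (0 : ℝ) 1)), Real.log ‖f (x + y * Complex.I)‖ =
      2 * π * n * y + Real.log ‖p.eval (ee (x + y * Complex.I))‖ := by
  filter_upwards [h.ae_ne_zero hp y] with x hx
  simpa using h.log_norm hx

lemma IsTrig.intervalIntegrable (h : IsTrig n f p) (hp : p ≠ 0) (y : ℝ) :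
    IntervalIntegrable (fun x : ℝ => Real.log ‖f (x + y * Complex.I)‖) volume 0 1 := by
  rw [intervalIntegrable_iff_integrableOn_Ioc_of_le zero_le_one]
  have h1 := intervalIntegrable_line_of_circleIntegrable (y := y)
    (circleIntegrable_log_norm_eval p 0 _)
  rw [intervalIntegrable_iff_integrableOn_Ioc_of_le zero_le_one] at h1
  have h2 : IntegrableOn (fun x : ℝ => 2 * π * n * y +
    Real.log ‖p.eval (ee (x + y * Complex.I))‖) (Set.Ioc 0 1) := by
      apply Integrable.add _ h1
      exact integrable_const _
  exact h2.congr (by filter_upwards [h.log_norm_ae hp y] with x hx using hx.symm)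

/-- The mean of `log |f|` over a line in terms of the roots. -/
lemma IsTrig.lineMean_eq (h : IsTrig n f p) (hp : p ≠ 0) (y : ℝ) :
    lineMean f y = 2 * π * n * y + Real.log ‖p.leadingCoeff‖ +
      (p.roots.map fun ζ => Real.log (max (Real.exp (-(2 * π * y))) ‖ζ‖)).sum := by
  have h1 := intervalIntegrable_line_of_circleIntegrable (y := y)
    (circleIntegrable_log_norm_eval p 0 _)
  rw [add_assoc, ← circleAverage_log_norm_eval hp (Real.exp_pos _),
    ← integral_line_eq_circleAverage]
  have : lineMean f y = ∫ x in (0 : ℝ)..1, (2 * π * n * y +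
      Real.log ‖p.eval (ee (x + y * Complex.I))‖) := by
    unfold lineMean
    rw [intervalIntegral.integral_of_le zero_le_one, intervalIntegral.integral_of_le zero_le_one]
    exact integral_congr_ae (h.log_norm_ae hp y)
  rw [this, intervalIntegral.integral_add (by simp) h1]
  simp

end

section

variable {n : ℕ} {f : ℂ → ℂ} {p : Polynomial ℂ}

lemma two_mul_log_max_le (r : ℝ) (y t : ℝ) (hr : 0 ≤ r) :
    2 * Real.log (max (Real.exp (-(2 * π * y))) r) ≤
      Real.log (max (Real.exp (-(2 * π * (y + t)))) r) +
        Real.log (max (Real.exp (-(2 * π * (y - t)))) r) := by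
  have h2 : ∀ s : ℝ, 2 * Real.log s = Real.log (s ^ 2) := fun s => by simp [Real.log_pow]
  rw [← Real.log_mul (by positivity) (by positivity), h2]
  apply Real.log_le_log (by positivity)
  have h1 : Real.exp (-(2 * π * (y + t))) * Real.exp (-(2 * π * (y - t))) =
      Real.exp (-(2 * π * y)) ^ 2 := by
    rw [← Real.exp_add, ← Real.exp_nat_mul]; congr 1; push_cast; ring
  rcases le_total (Real.exp (-(2 * π * y))) r with h | h
  · rw [max_eq_right h, sq]
    exact mul_le_mul (le_max_right _ _) (le_max_right _ _) hr (by positivity)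
  · rw [max_eq_left h, ← h1]
    exact mul_le_mul (le_max_left _ _) (le_max_left _ _) (by positivity) (by positivity)

lemma log_max_second_difference {r y η : ℝ} (hr : 0 < r)
    (h : |-Real.log r / (2 * π) - y| ≤ η / 2) :
    π * η + 2 * Real.log (max (Real.exp (-(2 * π * y))) r) ≤
      Real.log (max (Real.exp (-(2 * π * (y + η)))) r) +
        Real.log (max (Real.exp (-(2 * π * (y - η)))) r) := by
  have h0 : 0 < 2 * π := by positivity
  set L := Real.log r with hL
  have hrL : r = Real.exp L := (Real.exp_log hr).symm
  have hmax : ∀ s : ℝ, Real.log (max (Real.exp s) r) = max s L := by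
    intro s
    rw [hrL, ← Real.exp_monotone.map_max, Real.log_exp]
  simp only [hmax]
  set t := -L / (2 * π) with ht
  have hLt : L = -(2 * π * t) := by rw [ht]; field_simp
  rw [hLt]
  have h1 := abs_le.1 h
  have a1 : max (-(2 * π * y)) (-(2 * π * t)) ≤ -(2 * π * t) ∨
      max (-(2 * π * y)) (-(2 * π * t)) ≤ -(2 * π * y) := by
    rcases le_total (-(2 * π * y)) (-(2 * π * t)) with h | h <;> simp [h]
  have b1 := le_max_right (-(2 * π * (y + η))) (-(2 * π * t))
  have b2 := le_max_left (-(2 * π * (y - η))) (-(2 * π * t))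
  rcases a1 with a1 | a1 <;> nlinarith [Real.pi_pos]

lemma IsTrig.two_mul_lineMean_le (h : IsTrig n f p) (hp : p ≠ 0) (y t : ℝ) :
    2 * lineMean f y ≤ lineMean f (y + t) + lineMean f (y - t) := by
  simp only [h.lineMean_eq hp]
  have : (p.roots.map fun ζ => 2 * Real.log (max (Real.exp (-(2 * π * y))) ‖ζ‖)).sum ≤
      (p.roots.map fun ζ => Real.log (max (Real.exp (-(2 * π * (y + t)))) ‖ζ‖) +
        Real.log (max (Real.exp (-(2 * π * (y - t)))) ‖ζ‖)).sum :=
    Multiset.sum_map_le_sum_map _ _ fun ζ _ => two_mul_log_max_le _ _ _ (norm_nonneg _)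
  rw [Multiset.sum_map_add, Multiset.sum_map_mul_left] at this
  linarith

/-- The number of roots in a strip is bounded by the second difference of the line mean. -/
lemma IsTrig.card_roots_le (h : IsTrig n f p) (hp : p ≠ 0) {y η : ℝ}
    (s : Multiset ℂ) (hs : s ≤ p.roots)
    (hs' : ∀ ζ ∈ s, ζ ≠ 0 ∧ |-Real.log ‖ζ‖ / (2 * π) - y| ≤ η / 2) :
    π * η * s.card + 2 * lineMean f y ≤ lineMean f (y + η) + lineMean f (y - η) := by
  simp only [h.lineMean_eq hp]
  obtain ⟨u, hu⟩ := Multiset.le_iff_exists_add.1 hs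
  rw [hu]
  simp only [Multiset.map_add, Multiset.sum_add]
  have h1 : (u.map fun ζ => 2 * Real.log (max (Real.exp (-(2 * π * y))) ‖ζ‖)).sum ≤
      (u.map fun ζ => Real.log (max (Real.exp (-(2 * π * (y + η)))) ‖ζ‖) +
        Real.log (max (Real.exp (-(2 * π * (y - η)))) ‖ζ‖)).sum :=
    Multiset.sum_map_le_sum_map _ _ fun ζ _ => two_mul_log_max_le _ _ _ (norm_nonneg _)
  have h2 : (s.map fun ζ => π * η + 2 * Real.log (max (Real.exp (-(2 * π * y))) ‖ζ‖)).sum ≤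
      (s.map fun ζ => Real.log (max (Real.exp (-(2 * π * (y + η)))) ‖ζ‖) +
        Real.log (max (Real.exp (-(2 * π * (y - η)))) ‖ζ‖)).sum :=
    Multiset.sum_map_le_sum_map _ _ fun ζ hζ => log_max_second_difference
      (norm_pos_iff.2 (hs' ζ hζ).1) (hs' ζ hζ).2
  rw [Multiset.sum_map_add, Multiset.sum_map_mul_left] at h1
  rw [Multiset.sum_map_add, Multiset.sum_map_add, Multiset.sum_map_mul_left] at h2
  simp only [Multiset.map_const', Multiset.sum_replicate, nsmul_eq_mul,
    Multiset.sum_map_mul_left] at h2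
  linarith

/-- Number of roots (with multiplicity) in the open disc of radius `R` about the origin. -/
def rootCount (p : Polynomial ℂ) (R : ℝ) : ℕ := (p.roots.filter fun ζ => ‖ζ‖ < R).card

/-- The root count determines a subgradient of the line mean. -/
lemma IsTrig.lineMean_ge (h : IsTrig n f p) (hp : p ≠ 0) (y y' : ℝ) :
    lineMean f y' + 2 * π * ((n : ℝ) - rootCount p (Real.exp (-(2 * π * y')))) * (y - y') ≤
      lineMean f y := by
  simp only [h.lineMean_eq hp, rootCount]
  rw [← Multiset.filter_add_not (fun ζ => ‖ζ‖ < Real.exp (-(2 * π * y'))) p.roots]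
  simp only [Multiset.map_add, Multiset.sum_add, Multiset.filter_add, Multiset.filter_filter]
  set s := p.roots.filter (fun ζ => ‖ζ‖ < Real.exp (-(2 * π * y'))) with hs
  set u := p.roots.filter (fun ζ => ¬ ‖ζ‖ < Real.exp (-(2 * π * y'))) with hu
  have h1 : (u.map fun ζ => Real.log (max (Real.exp (-(2 * π * y'))) ‖ζ‖)).sum ≤
      (u.map fun ζ => Real.log (max (Real.exp (-(2 * π * y))) ‖ζ‖)).sum := by
    apply Multiset.sum_map_le_sum_map
    intro ζ hζ
    have : Real.exp (-(2 * π * y')) ≤ ‖ζ‖ := not_lt.1 (Multiset.mem_filter.1 hζ).2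
    rw [max_eq_right this]
    exact Real.log_le_log (lt_of_lt_of_le (Real.exp_pos _) this) (le_max_right _ _)
  have h2 : (s.map fun ζ => Real.log (max (Real.exp (-(2 * π * y'))) ‖ζ‖) -
        2 * π * (y - y')).sum ≤
      (s.map fun ζ => Real.log (max (Real.exp (-(2 * π * y))) ‖ζ‖)).sum := by
    apply Multiset.sum_map_le_sum_map
    intro ζ hζ
    have : ‖ζ‖ < Real.exp (-(2 * π * y')) := (Multiset.mem_filter.1 hζ).2
    rw [max_eq_left this.le, Real.log_exp]
    calc _ = Real.log (Real.exp (-(2 * π * y))) := by rw [Real.log_exp]; ring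
      _ ≤ _ := Real.log_le_log (Real.exp_pos _) (le_max_left _ _)
  rw [Multiset.sum_map_sub] at h2
  simp only [Multiset.map_const', Multiset.sum_replicate, nsmul_eq_mul] at h2
  have e1 : p.roots.filter (fun ζ => ‖ζ‖ < Real.exp (-(2 * π * y')) ∧
    ‖ζ‖ < Real.exp (-(2 * π * y'))) = s := by simp [hs]
  have e2 : p.roots.filter (fun ζ => ‖ζ‖ < Real.exp (-(2 * π * y')) ∧
    ¬ ‖ζ‖ < Real.exp (-(2 * π * y'))) = 0 := by
      rw [Multiset.filter_eq_nil]; tauto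
  simp only [e1, e2, add_zero]
  linarith

lemma circleIntegral_logDeriv {p : Polynomial ℂ} {R : ℝ} (hR : 0 < R)
    (h : ∀ z : ℂ, ‖z‖ = R → p.eval z ≠ 0) :
    ∮ z in C(0, R), p.derivative.eval z / p.eval z = 2 * π * Complex.I * rootCount p R := by
  have key : ∀ s : Multiset ℂ, (∀ ζ ∈ s, ‖ζ‖ ≠ R) →
      CircleIntegrable (fun z => (s.map fun ζ => (z - ζ)⁻¹).sum) 0 R ∧
      ∮ z in C(0, R), (s.map fun ζ => (z - ζ)⁻¹).sum =
        2 * π * Complex.I * (s.filter fun ζ => ‖ζ‖ < R).card := by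
    intro s
    induction s using Multiset.induction_on with
    | empty => intro _; simp [circleIntegral]
    | cons a s ih =>
      intro hs
      obtain ⟨i1, i2⟩ := ih fun ζ hζ => hs ζ (Multiset.mem_cons_of_mem hζ)
      have ha : ‖a‖ ≠ R := hs a (Multiset.mem_cons_self a s)
      have i3 : CircleIntegrable (fun z => (z - a)⁻¹) 0 R := by
        rw [circleIntegrable_sub_inv_iff]
        right; simpa [abs_of_pos hR] using ha
      simp only [Multiset.map_cons, Multiset.sum_cons]
      refine ⟨i3.add i1, ?_⟩
      rw [circleIntegral.integral_add i3 i1, i2]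
      rcases lt_or_gt_of_ne ha with h | h
      · rw [circleIntegral.integral_sub_inv_of_mem_ball (by simpa using h),
          Multiset.filter_cons_of_pos (p := fun ζ => ‖ζ‖ < R) _ h]
        push_cast [Multiset.card_cons]
        ring
      · rw [Multiset.filter_cons_of_neg (p := fun ζ => ‖ζ‖ < R) _ (not_lt.2 h.le)]
        have : ∮ z in C(0, R), (z - a)⁻¹ = 0 := by
          apply Complex.circleIntegral_eq_zero_of_differentiable_on_off_countable hR.le
            Set.countable_empty
          · intro z hz
            have : z ≠ a := by rintro rfl; simp at hz; linarith
            exact ((continuousAt_id.sub continuousAt_const).inv₀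
              (sub_ne_zero.2 this)).continuousWithinAt
          · intro z hz
            have : z ≠ a := by rintro rfl; simp at hz; linarith
            exact (differentiableAt_id.sub (differentiableAt_const _)).inv (sub_ne_zero.2 this)
        rw [this, zero_add]
  have h2 := (key p.roots fun ζ hζ hn => h ζ hn (Polynomial.isRoot_of_mem_roots hζ)).2
  rw [rootCount, ← h2]
  apply circleIntegral.integral_congr hR.le
  intro z hz
  have hz' : p.eval z ≠ 0 := h z (by simpa using hz)
  simp only
  rw [(IsAlgClosed.splits p).eval_derivative_div_eval_of_ne_zero hz']
  simp

/-- Rouché's theorem for polynomials. -/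
lemma rootCount_eq_of_norm_sub_lt {P Q : Polynomial ℂ} {R : ℝ} (hR : 0 < R)
    (h : ∀ z : ℂ, ‖z‖ = R → ‖P.eval z - Q.eval z‖ < ‖Q.eval z‖) :
    rootCount P R = rootCount Q R := by
  have hQ : ∀ z : ℂ, ‖z‖ = R → Q.eval z ≠ 0 := fun z hz h0 => by
    have := h z hz
    rw [h0, norm_zero] at this
    exact absurd this (not_lt.2 (norm_nonneg _))
  have hP : ∀ z : ℂ, ‖z‖ = R → P.eval z ≠ 0 := fun z hz h0 => by
    have := h z hz
    simp [h0] at this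
  have hc : ∀ T : Polynomial ℂ, (∀ z : ℂ, ‖z‖ = R → T.eval z ≠ 0) →
      CircleIntegrable (fun z => T.derivative.eval z / T.eval z) 0 R := fun T hT => by
    apply ContinuousOn.circleIntegrable hR.le
    exact T.derivative.continuous.continuousOn.div T.continuous.continuousOn
      fun z hz => hT z (by simpa using hz)
  have hz : ∮ z in C(0, R), (P.derivative.eval z / P.eval z - Q.derivative.eval z / Q.eval z) =
      0 := by
    apply circleIntegral.integral_eq_zero_of_hasDerivWithinAt hR.le
      (f := fun z => Complex.log (P.eval z / Q.eval z))
    intro z hz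
    have hz' : ‖z‖ = R := by simpa using hz
    have hs : P.eval z / Q.eval z ∈ Complex.slitPlane := by
      apply Complex.ball_one_subset_slitPlane
      rw [Metric.mem_ball, dist_eq_norm, div_sub_one (hQ z hz'), norm_div,
        div_lt_one (norm_pos_iff.2 (hQ z hz'))]
      exact h z hz'
    have hd := ((P.hasDerivAt z).div (Q.hasDerivAt z) (hQ z hz')).clog hs
    convert hd.hasDerivWithinAt using 1
    · rfl
    have := hQ z hz'
    have := hP z hz'
    rw [Pi.div_apply]
    field_simp
  rw [circleIntegral.integral_sub (hc P hP) (hc Q hQ), circleIntegral_logDeriv hR hP,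
    circleIntegral_logDeriv hR hQ, sub_eq_zero] at hz
  have hne : (2 * π * Complex.I : ℂ) ≠ 0 := Complex.two_pi_I_ne_zero
  exact_mod_cast mul_left_cancel₀ hne hz

lemma rootCount_mul {P Q : Polynomial ℂ} (h : P * Q ≠ 0) (R : ℝ) :
    rootCount (P * Q) R = rootCount P R + rootCount Q R := by
  simp [rootCount, Polynomial.roots_mul h]

lemma rootCount_comp_C_mul_X (P : Polynomial ℂ) {q : ℂ} (hq : ‖q‖ = 1) (R : ℝ) :
    rootCount (P.comp (Polynomial.C q * Polynomial.X)) R = rootCount P R := by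
  have hq0 : q ≠ 0 := by rintro rfl; simp at hq
  have h := P.map_roots_comp_C_mul_X_add_C q 0 (isUnit_iff_ne_zero.2 hq0)
  simp only [Polynomial.C_0, add_zero] at h
  rw [rootCount, rootCount, ← h, Multiset.filter_map, Multiset.card_map]
  congr 2
  ext ζ
  simp [hq]

section closure
variable {m : ℕ} {g : ℂ → ℂ} {r : Polynomial ℂ}

lemma IsTrig.add (hf : IsTrig n f p) (hg : IsTrig n g r) :
    IsTrig n (fun z => f z + g z) (p + r) := fun z => by
  simp [add_mul, hf z, hg z]

lemma IsTrig.mul (hf : IsTrig n f p) (hg : IsTrig m g r) :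
    IsTrig (n + m) (fun z => f z * g z) (p * r) := fun z => by
  rw [Polynomial.eval_mul, ← hf z, ← hg z, pow_add]; ring

lemma IsTrig.const_mul (hf : IsTrig n f p) (c : ℂ) :
    IsTrig n (fun z => c * f z) (Polynomial.C c * p) := fun z => by
  rw [Polynomial.eval_mul, ← hf z, Polynomial.eval_C]; ring

lemma IsTrig.comp_add (hf : IsTrig n f p) (w : ℂ) :
    IsTrig n (fun z => f (z + w))
      (Polynomial.C ((ee w ^ n)⁻¹) * p.comp (Polynomial.C (ee w) * Polynomial.X)) := fun z => by
  have := hf (z + w)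
  have h0 := ee_ne_zero w
  simp only [Polynomial.eval_mul, Polynomial.eval_C, Polynomial.eval_comp, Polynomial.eval_X]
  rw [mul_comm (ee w) (ee z), ← ee_add, ← this, ee_add, mul_pow]
  field_simp

end closure

end

/-- Uniform equidistribution of the orbit averages of `g`. -/
def UnifEquidist (β : ℝ) (g : C(AddCircle (1 : ℝ), ℂ)) : Prop :=
  ∀ ε > 0, ∃ n0 : ℕ, ∀ n ≥ n0, ∀ x : AddCircle (1 : ℝ),
    ‖∑ j ∈ Finset.range n, g (x + ((j * β : ℝ) : AddCircle (1 : ℝ))) -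
      n * ∫ t, g t ∂AddCircle.haarAddCircle‖ ≤ ε * n

lemma UnifEquidist.add {β : ℝ} {g h : C(AddCircle (1 : ℝ), ℂ)} (hg : UnifEquidist β g)
    (hh : UnifEquidist β h) : UnifEquidist β (g + h) := by
  intro ε hε
  obtain ⟨a, ha⟩ := hg (ε / 2) (by positivity)
  obtain ⟨b, hb⟩ := hh (ε / 2) (by positivity)
  refine ⟨max a b, fun n hn x => ?_⟩
  have h1 := ha n (le_trans (le_max_left _ _) hn) x
  have h2 := hb n (le_trans (le_max_right _ _) hn) x
  have e : ∫ t, (g + h) t ∂AddCircle.haarAddCircle = (∫ t, g t ∂AddCircle.haarAddCircle) +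
      ∫ t, h t ∂AddCircle.haarAddCircle := by
    simp only [ContinuousMap.add_apply]
    exact integral_add (g.continuous.integrable_of_hasCompactSupport
      (HasCompactSupport.of_compactSpace _)) (h.continuous.integrable_of_hasCompactSupport
      (HasCompactSupport.of_compactSpace _))
  rw [e]
  simp only [ContinuousMap.add_apply, Finset.sum_add_distrib]
  calc _ = ‖(∑ j ∈ Finset.range n, g (x + ((j * β : ℝ) : AddCircle (1 : ℝ))) -
      n * ∫ t, g t ∂AddCircle.haarAddCircle) +
      (∑ j ∈ Finset.range n, h (x + ((j * β : ℝ) : AddCircle (1 : ℝ))) -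
      n * ∫ t, h t ∂AddCircle.haarAddCircle)‖ := by congr 1; ring
    _ ≤ _ := norm_add_le _ _
    _ ≤ _ := by linarith

lemma UnifEquidist.smul {β : ℝ} {g : C(AddCircle (1 : ℝ), ℂ)} (hg : UnifEquidist β g)
    (c : ℂ) : UnifEquidist β (c • g) := by
  intro ε hε
  obtain ⟨a, ha⟩ := hg (ε / (‖c‖ + 1)) (by positivity)
  refine ⟨a, fun n hn x => ?_⟩
  have h1 := ha n hn x
  simp only [ContinuousMap.smul_apply, smul_eq_mul]
  rw [integral_const_mul, ← Finset.mul_sum]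
  calc _ = ‖c‖ * ‖∑ j ∈ Finset.range n, g (x + ((j * β : ℝ) : AddCircle (1 : ℝ))) -
      n * ∫ t, g t ∂AddCircle.haarAddCircle‖ := by rw [← norm_mul]; congr 1; ring
    _ ≤ (‖c‖ + 1) * (ε / (‖c‖ + 1) * n) := by gcongr; linarith
    _ = _ := by field_simp

lemma UnifEquidist.fourier {β : ℝ} (hβ : Irrational β) (k : ℤ) :
    UnifEquidist β (fourier k) := by
  intro ε hε
  rcases eq_or_ne k 0 with rfl | hk
  · refine ⟨0, fun n _ x => ?_⟩
    simp
    positivity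
  set q : ℂ := _root_.fourier k ((β : ℝ) : AddCircle (1 : ℝ)) with hq
  have hqe : q = Complex.exp (2 * π * Complex.I * k * β / (1 : ℝ)) := by
    rw [hq, fourier_coe_apply]
  have hq1 : q ≠ 1 := by
    intro h
    rw [hqe, Complex.exp_eq_one_iff] at h
    obtain ⟨m, hm⟩ := h
    have h2 : (k : ℂ) * β = m := by
      have := Complex.two_pi_I_ne_zero
      apply mul_left_cancel₀ this
      rw [ofReal_one, div_one] at hm
      linear_combination hm
    have h3 : (k : ℝ) * β = m := by exact_mod_cast h2
    exact hβ ⟨(m : ℚ) / k, by push_cast; rw [← h3]; field_simp⟩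
  have hqn : ‖q‖ = 1 := by
    rw [hqe]
    rw [show (2 * π * Complex.I * k * β / (1 : ℝ) : ℂ) = ((2 * π * k * β : ℝ) : ℂ) * Complex.I by
      push_cast; ring]
    exact Complex.norm_exp_ofReal_mul_I _
  have hinteg : ∫ t, _root_.fourier k t ∂(AddCircle.haarAddCircle (T := 1)) = 0 := by
    have h := fourierCoeff_toLp (T := 1) (_root_.fourier k) 0
    have h2 : fourierCoeff (T := 1) (_root_.fourier k) 0 =
        ∫ t, _root_.fourier k t ∂(AddCircle.haarAddCircle (T := 1)) := by
      simp [fourierCoeff]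
    rw [← h2]
    have h3 := (orthonormal_fourier (T := 1)).2 (i := 0) (j := k) hk.symm
    simp only [fourierLp] at h3
    rw [ContinuousMap.inner_toLp] at h3
    rw [h2]
    simpa using h3
  obtain ⟨n0, hn0⟩ := exists_nat_gt (2 / ‖q - 1‖ / ε)
  refine ⟨n0, fun n hn x => ?_⟩
  rw [hinteg, mul_zero, sub_zero]
  have e : ∀ j : ℕ, _root_.fourier k (x + ((j * β : ℝ) : AddCircle (1 : ℝ))) =
      _root_.fourier k x * q ^ j := by
    intro j
    have h0 : ((j * β : ℝ) : AddCircle (1 : ℝ)) = j • ((β : ℝ) : AddCircle (1 : ℝ)) := by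
      rw [← AddCircle.coe_nsmul, nsmul_eq_mul]
    rw [h0]
    clear h0
    induction j with
    | zero => simp
    | succ j ih =>
      rw [succ_nsmul, ← add_assoc, fourier_apply, smul_add, AddCircle.toCircle_add,
        Circle.coe_mul, ← fourier_apply, ← fourier_apply, ih, pow_succ, mul_assoc]
  simp_rw [e]
  rw [← Finset.mul_sum, geom_sum_eq hq1, norm_mul, norm_div]
  have hx : ‖_root_.fourier k x‖ = 1 := by rw [fourier_apply]; exact Circle.norm_coe _
  have h1 : ‖q ^ n - 1‖ ≤ 2 := by
    refine (norm_sub_le _ _).trans ?_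
    rw [norm_pow, hqn]; norm_num
  have h2 : 0 < ‖q - 1‖ := norm_pos_iff.2 (sub_ne_zero.2 hq1)
  rw [hx, one_mul]
  calc _ ≤ 2 / ‖q - 1‖ := by gcongr
    _ ≤ ε * n := by
      rw [div_lt_iff₀ hε] at hn0
      have : (n0 : ℝ) ≤ n := by exact_mod_cast hn
      nlinarith

lemma unifEquidist {β : ℝ} (hβ : Irrational β) (g : C(AddCircle (1 : ℝ), ℂ)) :
    UnifEquidist β g := by
  have hspan : ∀ h ∈ Submodule.span ℂ (Set.range (fourier (T := 1))), UnifEquidist β h := by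
    intro h hh
    induction hh using Submodule.span_induction with
    | mem x hx => obtain ⟨k, rfl⟩ := hx; exact UnifEquidist.fourier hβ k
    | zero =>
      rw [← zero_smul ℂ (fourier (T := 1) 0)]
      exact (UnifEquidist.fourier hβ 0).smul 0
    | add x y _ _ hx hy => exact hx.add hy
    | smul a x _ hx => exact hx.smul a
  intro ε hε
  have hg : g ∈ (Submodule.span ℂ (Set.range (fourier (T := 1)))).topologicalClosure := by
    rw [span_fourier_closure_eq_top]; trivial
  obtain ⟨h, hh, hd⟩ := Metric.mem_closure_iff.1 hg (ε / 3) (by positivity)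
  obtain ⟨n0, hn0⟩ := hspan h hh (ε / 3) (by positivity)
  refine ⟨n0, fun n hn x => ?_⟩
  have h1 := hn0 n hn x
  have hp : ∀ t, ‖g t - h t‖ ≤ ε / 3 := fun t => by
    rw [← dist_eq_norm]; exact (ContinuousMap.dist_apply_le_dist t).trans hd.le
  have h2 : ‖∑ j ∈ Finset.range n, (g (x + ((j * β : ℝ) : AddCircle (1 : ℝ))) -
      h (x + ((j * β : ℝ) : AddCircle (1 : ℝ))))‖ ≤ n * (ε / 3) := by
    refine (norm_sum_le _ _).trans ?_
    refine (Finset.sum_le_sum fun j _ => hp _).trans ?_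
    simp
  have ig : Integrable g (AddCircle.haarAddCircle (T := 1)) :=
    g.continuous.integrable_of_hasCompactSupport (HasCompactSupport.of_compactSpace _)
  have ih : Integrable h (AddCircle.haarAddCircle (T := 1)) :=
    h.continuous.integrable_of_hasCompactSupport (HasCompactSupport.of_compactSpace _)
  have h3 : ‖(∫ t, g t ∂AddCircle.haarAddCircle) - ∫ t, h t ∂AddCircle.haarAddCircle‖ ≤ ε / 3 := by
    rw [← integral_sub ig ih]
    refine (norm_integral_le_of_norm_le_const (Eventually.of_forall hp)).trans ?_
    simp
  rw [Finset.sum_sub_distrib] at h2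
  calc _ = ‖(∑ j ∈ Finset.range n, g (x + ((j * β : ℝ) : AddCircle (1 : ℝ))) -
        ∑ j ∈ Finset.range n, h (x + ((j * β : ℝ) : AddCircle (1 : ℝ)))) +
      (∑ j ∈ Finset.range n, h (x + ((j * β : ℝ) : AddCircle (1 : ℝ))) -
      n * ∫ t, h t ∂AddCircle.haarAddCircle) -
      n * ((∫ t, g t ∂AddCircle.haarAddCircle) - ∫ t, h t ∂AddCircle.haarAddCircle)‖ := by
        congr 1; ring
    _ ≤ n * (ε / 3) + ε / 3 * n + n * (ε / 3) := by
      refine (norm_sub_le _ _).trans (add_le_add ((norm_add_le _ _).trans (add_le_add h2 h1)) ?_)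
      rw [norm_mul, Complex.norm_natCast]
      gcongr
    _ = _ := by ring

/-- Uniform equidistribution for real continuous periodic functions. -/
lemma sum_orbit_le {β : ℝ} (hβ : Irrational β) {g : ℝ → ℝ} (hg : Continuous g)
    (hp : Function.Periodic g 1) {K : ℝ} (hK : ∫ x in (0 : ℝ)..1, g x < K) :
    ∃ n0 : ℕ, ∀ n ≥ n0, ∀ x : ℝ, ∑ j ∈ Finset.range n, g (x + j * β) ≤ n * K := by
  have hc : Continuous (hp.lift : AddCircle (1 : ℝ) → ℝ) := by
    apply continuous_coinduced_dom.2
    exact hg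
  let G : C(AddCircle (1 : ℝ), ℂ) := ⟨fun t => ((hp.lift t : ℝ) : ℂ), by fun_prop⟩
  have hI : ∫ t, G t ∂AddCircle.haarAddCircle = ((∫ x in (0 : ℝ)..1, g x : ℝ) : ℂ) := by
    have h1 := AddCircle.intervalIntegral_preimage (1 : ℝ) 0 (fun t => G t)
    rw [zero_add] at h1
    have : (volume : Measure (AddCircle (1 : ℝ))) = AddCircle.haarAddCircle := by
      rw [AddCircle.volume_eq_smul_haarAddCircle]; simp
    rw [← this, ← h1, ← intervalIntegral.integral_ofReal]
    rfl
  obtain ⟨n0, hn0⟩ := unifEquidist hβ G (K - ∫ x in (0 : ℝ)..1, g x) (by linarith)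
  refine ⟨n0, fun n hn x => ?_⟩
  have h := hn0 n hn x
  rw [hI] at h
  have e : ∑ j ∈ Finset.range n, G ((x : AddCircle (1 : ℝ)) + ((j * β : ℝ) : AddCircle (1 : ℝ))) =
      ((∑ j ∈ Finset.range n, g (x + j * β) : ℝ) : ℂ) := by
    push_cast
    apply Finset.sum_congr rfl
    intro j _
    rw [← AddCircle.coe_add]
    rfl
  rw [e] at h
  have h2 : ‖((∑ j ∈ Finset.range n, g (x + j * β) - n * ∫ x in (0 : ℝ)..1, g x : ℝ) : ℂ)‖ ≤
      (K - ∫ x in (0 : ℝ)..1, g x) * n := by push_cast; push_cast at h; exact h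
  rw [Complex.norm_real, Real.norm_eq_abs] at h2
  have := (abs_le.1 h2).2
  nlinarith

/-- One-sided uniform equidistribution for `log F` where `F` may have zeros. -/
lemma prod_orbit_le {β : ℝ} (hβ : Irrational β) {F : ℝ → ℝ} (hF : Continuous F)
    (h0 : ∀ x, 0 ≤ F x) (hp : Function.Periodic F 1)
    (hne : ∀ᵐ x : ℝ ∂(volume.restrict (Set.Ioc (0 : ℝ) 1)), F x ≠ 0)
    (hi : IntervalIntegrable (fun x => Real.log (F x)) volume 0 1)
    {K : ℝ} (hK : ∫ x in (0 : ℝ)..1, Real.log (F x) < K) :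
    ∃ n0 : ℕ, ∀ n ≥ n0, ∀ x : ℝ, ∏ j ∈ Finset.range n, F (x + j * β) ≤ Real.exp (n * K) := by
  let G : ℕ → ℝ → ℝ := fun m x => Real.log (max (F x) (Real.exp (-(m : ℝ))))
  have hGc : ∀ m, Continuous (G m) := fun m =>
    (hF.max continuous_const).log fun x => by positivity
  have hlim : Tendsto (fun m => ∫ x in (0 : ℝ)..1, G m x) atTop
      (nhds (∫ x in (0 : ℝ)..1, Real.log (F x))) := by
    apply intervalIntegral.tendsto_integral_filter_of_dominated_convergence
      (fun x => |Real.log (F x)|)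
    · exact Eventually.of_forall fun m => (hGc m).aestronglyMeasurable
    · rw [Set.uIoc_of_le zero_le_one]
      refine Eventually.of_forall fun m => ?_
      rw [← ae_restrict_iff' measurableSet_Ioc]
      filter_upwards [hne] with x hx
      have hx' : 0 < F x := lt_of_le_of_ne (h0 x) (Ne.symm hx)
      simp only [G, Real.norm_eq_abs]
      rcases le_total (Real.exp (-(m : ℝ))) (F x) with h | h
      · rw [max_eq_left h]
      · rw [max_eq_right h, Real.log_exp]
        have h2 := Real.log_le_log hx' h
        rw [Real.log_exp] at h2
        have hm : (0 : ℝ) ≤ m := Nat.cast_nonneg m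
        rw [abs_neg, abs_of_nonneg hm, abs_of_nonpos (by linarith)]
        linarith
    · exact hi.abs
    · rw [Set.uIoc_of_le zero_le_one]
      rw [← ae_restrict_iff' measurableSet_Ioc]
      filter_upwards [hne] with x hx
      have hx' : 0 < F x := lt_of_le_of_ne (h0 x) (Ne.symm hx)
      apply tendsto_const_nhds.congr'
      filter_upwards [eventually_ge_atTop ⌈-Real.log (F x)⌉₊] with m hm
      simp only [G]
      rw [max_eq_left]
      rw [← Real.le_log_iff_exp_le hx']
      have := (Nat.le_ceil (-Real.log (F x))).trans (Nat.cast_le.2 hm)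
      linarith
  obtain ⟨m, hm⟩ := (hlim.eventually (gt_mem_nhds hK)).exists
  obtain ⟨n0, hn0⟩ := sum_orbit_le hβ (hGc m) (fun x => by simp only [G]; rw [hp x]) hm
  refine ⟨n0, fun n hn x => ?_⟩
  have h := hn0 n hn x
  calc ∏ j ∈ Finset.range n, F (x + j * β) ≤
      ∏ j ∈ Finset.range n, max (F (x + j * β)) (Real.exp (-(m : ℝ))) :=
        Finset.prod_le_prod (fun j _ => h0 _) fun j _ => le_max_left _ _
    _ = Real.exp (∑ j ∈ Finset.range n, G m (x + j * β)) := by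
        rw [Real.exp_sum]
        exact Finset.prod_congr rfl fun j _ => (Real.exp_log (by positivity)).symm
    _ ≤ _ := Real.exp_le_exp.2 h

abbrev Mat := Matrix (Fin 2) (Fin 2) ℂ

lemma norm_sq_mat (M : Mat) :
    ‖M‖ ^ 2 = ‖M 0 0‖ ^ 2 + ‖M 0 1‖ ^ 2 + ‖M 1 0‖ ^ 2 + ‖M 1 1‖ ^ 2 := by
  rw [Matrix.frobenius_norm_def, ← Real.sqrt_eq_rpow, Real.sq_sqrt (by positivity)]
  simp [Fin.sum_univ_two, add_assoc]

lemma norm_entry_le (M : Mat) (i j : Fin 2) : ‖M i j‖ ≤ ‖M‖ := by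
  apply le_of_sq_le_sq _ (norm_nonneg M)
  rw [norm_sq_mat]
  fin_cases i <;> fin_cases j <;>
  · simp
    nlinarith [sq_nonneg ‖M 0 0‖, sq_nonneg ‖M 0 1‖, sq_nonneg ‖M 1 0‖, sq_nonneg ‖M 1 1‖]

lemma norm_mat_le {M : Mat} {B : ℝ} (h : ∀ i j, ‖M i j‖ ≤ B) : ‖M‖ ≤ 2 * B := by
  have hB : 0 ≤ B := (norm_nonneg _).trans (h 0 0)
  apply le_of_sq_le_sq _ (by positivity)
  rw [norm_sq_mat]
  have := fun i j => pow_le_pow_left₀ (norm_nonneg _) (h i j) 2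
  nlinarith [this 0 0, this 0 1, this 1 0, this 1 1]

lemma norm_det_le (M : Mat) : ‖M.det‖ ≤ ‖M‖ ^ 2 := by
  rw [norm_sq_mat, Matrix.det_fin_two]
  refine (norm_sub_le _ _).trans ?_
  rw [norm_mul, norm_mul]
  nlinarith [sq_nonneg (‖M 0 0‖ - ‖M 1 1‖), sq_nonneg (‖M 0 1‖ - ‖M 1 0‖),
    sq_nonneg ‖M 0 0‖, sq_nonneg ‖M 0 1‖, sq_nonneg ‖M 1 0‖, sq_nonneg ‖M 1 1‖]

lemma continuous_norm_mat {X : Type*} [TopologicalSpace X] {F : X → Mat}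
    (h : ∀ i j, Continuous fun x => F x i j) : Continuous fun x => ‖F x‖ := by
  have : (fun x => ‖F x‖) = fun x =>
      √(‖F x 0 0‖ ^ 2 + ‖F x 0 1‖ ^ 2 + ‖F x 1 0‖ ^ 2 + ‖F x 1 1‖ ^ 2) := by
    ext x; rw [← norm_sq_mat, Real.sqrt_sq (norm_nonneg _)]
  rw [this]
  have h00 := h 0 0
  have h01 := h 0 1
  have h10 := h 1 0
  have h11 := h 1 1
  fun_prop

/-- The complexified cocycle iterate. -/
def iterC (A : ℂ → Mat) (β : ℝ) : ℕ → ℂ → Mat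
  | 0, _ => 1
  | n + 1, z => iterC A β n (z + β) * A z

lemma iterC_add (A : ℂ → Mat) (β : ℝ) (m n : ℕ) (z : ℂ) :
    iterC A β (m + n) z = iterC A β m (z + n * β) * iterC A β n z := by
  induction n generalizing z with
  | zero => simp [iterC]
  | succ n ih =>
    rw [← add_assoc, iterC, ih, iterC, Matrix.mul_assoc]
    congr 2
    push_cast; ring

lemma iterC_one (A : ℂ → Mat) (β : ℝ) (z : ℂ) : iterC A β 1 z = A z := by
  simp [iterC]

lemma det_iterC (A : ℂ → Mat) (β : ℝ) (n : ℕ) (z : ℂ) :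
    (iterC A β n z).det = ∏ j ∈ Finset.range n, (A (z + j * β)).det := by
  induction n with
  | zero => simp [iterC]
  | succ n ih =>
    rw [add_comm, iterC_add, Matrix.det_mul, ih, iterC_one, add_comm 1 n, Finset.prod_range_succ_comm]

section lineMean
variable {n m : ℕ} {f g : ℂ → ℂ} {p q : Polynomial ℂ}

lemma IsTrig.lineMean_mul (hf : IsTrig n f p) (hg : IsTrig m g q) (hp : p ≠ 0) (hq : q ≠ 0)
    (y : ℝ) : lineMean (fun z => f z * g z) y = lineMean f y + lineMean g y := by
  rw [lineMean, lineMean, lineMean, ← intervalIntegral.integral_add (hf.intervalIntegrable hp y)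
    (hg.intervalIntegrable hq y)]
  apply intervalIntegral.integral_congr_ae
  rw [Set.uIoc_of_le zero_le_one, ← ae_restrict_iff' measurableSet_Ioc]
  filter_upwards [hf.ae_ne_zero hp y, hg.ae_ne_zero hq y] with x h1 h2
  rw [norm_mul, Real.log_mul (norm_ne_zero_iff.2 h1) (norm_ne_zero_iff.2 h2)]

lemma lineMean_comp_add (h : ∀ z, f (z + 1) = f z) (β y : ℝ) :
    lineMean (fun z => f (z + β)) y = lineMean f y := by
  have hp : Function.Periodic (fun x : ℝ => Real.log ‖f (x + y * Complex.I)‖) 1 := fun x => by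
    simp only
    rw [← h (x + y * Complex.I)]; push_cast; congr 3; ring
  have h1 := hp.intervalIntegral_add_eq β 0
  rw [zero_add] at h1
  rw [lineMean, lineMean, ← h1]
  have h2 := intervalIntegral.integral_comp_add_right (a := 0) (b := 1)
    (fun x : ℝ => Real.log ‖f (x + y * Complex.I)‖) β
  rw [zero_add, add_comm 1 β] at h2
  rw [← h2]
  apply intervalIntegral.integral_congr
  intro x _
  simp only
  push_cast
  congr 3
  ring

lemma IsTrig.comp_add_ne_zero (hp : p ≠ 0) (w : ℂ) (n : ℕ) :
    Polynomial.C ((ee w ^ n)⁻¹) * p.comp (Polynomial.C (ee w) * Polynomial.X) ≠ 0 := by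
  have h0 := ee_ne_zero w
  apply mul_ne_zero
  · simpa using fun h => absurd h h0
  · intro h
    apply hp
    have h1 : (p.comp (Polynomial.C (ee w) * Polynomial.X)).comp
        (Polynomial.C (ee w)⁻¹ * Polynomial.X) = p := by
      rw [Polynomial.comp_assoc]
      simp only [Polynomial.mul_comp, Polynomial.C_comp, Polynomial.X_comp]
      rw [← mul_assoc, ← Polynomial.C_mul, mul_inv_cancel₀ h0, Polynomial.C_1, one_mul,
        Polynomial.comp_X]
    rw [← h1, h, Polynomial.zero_comp]

end lineMean

/-- An analytic cocycle with trigonometric polynomial entries and controlled determinant. -/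
structure TrigCocycle (A : ℂ → Mat) (β la : ℝ) : Prop where
  irr : Irrational β
  trig : ∀ i j, ∃ p, IsTrig 1 (fun z => A z i j) p
  det_trig : ∃ p, p ≠ 0 ∧ IsTrig 2 (fun z => (A z).det) p
  det_ge : ∀ y, 2 * la ≤ lineMean (fun z => (A z).det) y
  det_le : ∀ y, lineMean (fun z => (A z).det) y ≤ 2 * la + 4 * π * |y|

/-- The supremum of the norm over a horizontal line. -/
def supLine (F : ℂ → Mat) (y : ℝ) : ℝ := ⨆ x : ℝ, ‖F (x + y * Complex.I)‖

/-- The uniform exponential growth rate on the line at height `y`. -/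
def rate (A : ℂ → Mat) (β y : ℝ) : ℝ :=
  sInf ((fun n : ℕ => Real.log (supLine (iterC A β n) y) / n) '' Set.Ici 1)

lemma bddAbove_of_periodic {g : ℝ → ℝ} (hg : Continuous g) (hp : Function.Periodic g 1) :
    BddAbove (Set.range g) :=
  (hp.compact_of_continuous one_ne_zero hg).bddAbove

namespace TrigCocycle
variable {A : ℂ → Mat} {β la : ℝ} (hA : TrigCocycle A β la)
include hA

lemma iter_trig (n : ℕ) (i j : Fin 2) : ∃ p, IsTrig n (fun z => iterC A β n z i j) p := by
  induction n generalizing i j with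
  | zero => exact ⟨Polynomial.C ((1 : Mat) i j), fun z => by simp [iterC]⟩
  | succ n ih =>
    obtain ⟨p0, h0⟩ := ih i 0
    obtain ⟨p1, h1⟩ := ih i 1
    obtain ⟨q0, g0⟩ := hA.trig 0 j
    obtain ⟨q1, g1⟩ := hA.trig 1 j
    have := ((h0.comp_add β).mul g0).add ((h1.comp_add β).mul g1)
    simp only [iterC, Matrix.mul_apply, Fin.sum_univ_two]
    exact ⟨_, this⟩

lemma iter_add_one (n : ℕ) (z : ℂ) : iterC A β n (z + 1) = iterC A β n z := by
  ext i j
  obtain ⟨p, h⟩ := hA.iter_trig n i j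
  exact h.add_one z

lemma differentiable_iter (n : ℕ) (i j : Fin 2) :
    Differentiable ℂ fun z => iterC A β n z i j := by
  obtain ⟨p, h⟩ := hA.iter_trig n i j
  exact h.differentiable

lemma continuous_norm_iter (n : ℕ) : Continuous fun z => ‖iterC A β n z‖ :=
  continuous_norm_mat fun i j => (hA.differentiable_iter n i j).continuous

lemma continuous_line (n : ℕ) (y : ℝ) :
    Continuous fun x : ℝ => ‖iterC A β n (x + y * Complex.I)‖ :=
  (hA.continuous_norm_iter n).comp (by fun_prop)

lemma periodic_line (n : ℕ) (y : ℝ) :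
    Function.Periodic (fun x : ℝ => ‖iterC A β n (x + y * Complex.I)‖) 1 := fun x => by
  simp only
  rw [← hA.iter_add_one n (x + y * Complex.I)]; push_cast; congr 2; ring

lemma norm_le_supLine (n : ℕ) (x y : ℝ) :
    ‖iterC A β n (x + y * Complex.I)‖ ≤ supLine (iterC A β n) y :=
  le_ciSup (bddAbove_of_periodic (hA.continuous_line n y) (hA.periodic_line n y)) x

lemma det_iter_trig (n : ℕ) :
    ∃ p, p ≠ 0 ∧ IsTrig (2 * n) (fun z => (iterC A β n z).det) p ∧
      ∀ y, lineMean (fun z => (iterC A β n z).det) y =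
        n * lineMean (fun z => (A z).det) y := by
  induction n with
  | zero => exact ⟨1, one_ne_zero, fun z => by simp [iterC], fun y => by simp [iterC, lineMean]⟩
  | succ n ih =>
    obtain ⟨p, hp, h, hl⟩ := ih
    obtain ⟨q, hq, g⟩ := hA.det_trig
    have h0 := IsTrig.comp_add_ne_zero hp β (2 * n)
    have e : (fun z => (iterC A β (n + 1) z).det) =
        fun z => (iterC A β n (z + β)).det * (A z).det := by
      ext z; rw [iterC, Matrix.det_mul]
    refine ⟨_, mul_ne_zero h0 hq, ?_, fun y => ?_⟩
    · rw [e]; exact (h.comp_add β).mul g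
    · rw [e, (h.comp_add β).lineMean_mul g h0 hq, lineMean_comp_add (f := fun z => (iterC A β n z).det) h.add_one, hl]
      push_cast; ring

lemma exists_det_ge (n : ℕ) (y : ℝ) :
    ∃ x : ℝ, Real.exp (2 * n * la) ≤ ‖(iterC A β n (x + y * Complex.I)).det‖ := by
  obtain ⟨p, hp, h, hl⟩ := hA.det_iter_trig n
  by_contra! hcon
  have hlt : ∀ᵐ x : ℝ ∂(volume.restrict (Set.Ioc (0 : ℝ) 1)),
      Real.log ‖(iterC A β n (x + y * Complex.I)).det‖ < 2 * n * la := by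
    filter_upwards [h.ae_ne_zero hp y] with x hx
    rw [Real.log_lt_iff_lt_exp (norm_pos_iff.2 hx)]
    exact hcon x
  have h1 : lineMean (fun z => (iterC A β n z).det) y < 2 * n * la := by
    have h2 : 2 * n * la = ∫ x in (0 : ℝ)..1, 2 * n * la := by simp
    rw [lineMean, h2]
    apply intervalIntegral.integral_lt_integral_of_ae_le_of_measure_setOfPred_lt_ne_zero zero_le_one
      (h.intervalIntegrable hp y) (by simp)
    · exact hlt.mono fun x hx => hx.le
    · intro h0
      have : ∀ᵐ x : ℝ ∂(volume.restrict (Set.Ioc (0 : ℝ) 1)), False := by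
        rw [← compl_mem_ae_iff] at h0
        filter_upwards [h0, hlt] with x hx hx'
        exact hx hx'
      rw [eventually_false_iff_eq_bot, ae_eq_bot, Measure.restrict_eq_zero] at this
      simp at this
  rw [hl] at h1
  have := mul_le_mul_of_nonneg_left (hA.det_ge y) (Nat.cast_nonneg (α := ℝ) n)
  linarith

lemma exp_le_supLine (n : ℕ) (y : ℝ) : Real.exp (n * la) ≤ supLine (iterC A β n) y := by
  obtain ⟨x, hx⟩ := hA.exists_det_ge n y
  have h1 := hx.trans (norm_det_le _)
  rw [show 2 * (n : ℝ) * la = n * la + n * la by ring, Real.exp_add, ← sq] at h1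
  exact (abs_le_of_sq_le_sq' h1 (norm_nonneg _)).2.trans (hA.norm_le_supLine n x y)

lemma supLine_pos (n : ℕ) (y : ℝ) : 0 < supLine (iterC A β n) y :=
  (Real.exp_pos _).trans_le (hA.exp_le_supLine n y)

lemma subadditive (y : ℝ) :
    Subadditive fun n : ℕ => Real.log (supLine (iterC A β n) y) := by
  intro m n
  rw [← Real.log_mul (hA.supLine_pos m y).ne' (hA.supLine_pos n y).ne']
  apply Real.log_le_log (hA.supLine_pos _ y)
  apply ciSup_le
  intro x
  rw [iterC_add]
  refine (Matrix.frobenius_norm_mul _ _).trans ?_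
  have e : (x : ℂ) + y * Complex.I + n * β = ((x + n * β : ℝ) : ℂ) + y * Complex.I := by
    push_cast; ring
  rw [e]
  exact mul_le_mul (hA.norm_le_supLine m _ y) (hA.norm_le_supLine n x y) (norm_nonneg _)
    (hA.supLine_pos m y).le

lemma la_le_div {n : ℕ} (hn : n ≠ 0) (y : ℝ) :
    la ≤ Real.log (supLine (iterC A β n) y) / n := by
  have hn' : (0 : ℝ) < n := by exact_mod_cast Nat.pos_of_ne_zero hn
  rw [le_div_iff₀ hn', Real.le_log_iff_exp_le (hA.supLine_pos n y), mul_comm]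
  exact hA.exp_le_supLine n y

lemma bddBelow (y : ℝ) :
    BddBelow (Set.range fun n : ℕ => Real.log (supLine (iterC A β n) y) / n) := by
  refine ⟨min la 0, ?_⟩
  rintro _ ⟨n, rfl⟩
  rcases eq_or_ne n 0 with rfl | hn
  · simp
  · exact (min_le_left _ _).trans (hA.la_le_div hn y)

lemma la_le_rate (y : ℝ) : la ≤ rate A β y := by
  unfold rate
  apply le_csInf ((Set.nonempty_Ici (a := 1)).image _)
  rintro _ ⟨n, hn, rfl⟩
  exact hA.la_le_div (by simp at hn; omega) y

lemma lim_eq_rate (y : ℝ) : (hA.subadditive y).lim = rate A β y := by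
  rw [Subadditive.lim, rate]

lemma rate_le_div {n : ℕ} (hn : n ≠ 0) (y : ℝ) :
    rate A β y ≤ Real.log (supLine (iterC A β n) y) / n :=
  hA.lim_eq_rate y ▸ (hA.subadditive y).lim_le_div (hA.bddBelow y) hn

lemma exp_rate_le_supLine (n : ℕ) (y : ℝ) :
    Real.exp (n * rate A β y) ≤ supLine (iterC A β n) y := by
  rcases eq_or_ne n 0 with rfl | hn
  · simpa using hA.exp_le_supLine 0 y
  have hn' : (0 : ℝ) < n := by exact_mod_cast Nat.pos_of_ne_zero hn
  have := hA.rate_le_div hn y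
  rwa [le_div_iff₀ hn', Real.le_log_iff_exp_le (hA.supLine_pos n y), mul_comm] at this

lemma tendsto_rate (y : ℝ) :
    Tendsto (fun n : ℕ => Real.log (supLine (iterC A β n) y) / n) atTop (nhds (rate A β y)) :=
  hA.lim_eq_rate y ▸ (hA.subadditive y).tendsto_lim (hA.bddBelow y)

lemma eventually_supLine_le (y : ℝ) {K : ℝ} (hK : rate A β y < K) :
    ∀ᶠ n : ℕ in atTop, supLine (iterC A β n) y ≤ Real.exp (n * K) := by
  filter_upwards [(hA.tendsto_rate y).eventually (gt_mem_nhds hK), eventually_gt_atTop 0]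
    with n h1 h2
  have hn' : (0 : ℝ) < n := by exact_mod_cast h2
  rw [← Real.log_le_iff_le_exp (hA.supLine_pos n y)]
  rw [div_lt_iff₀ hn'] at h1
  linarith

lemma exists_supLine_le (y : ℝ) {K : ℝ} (hK : rate A β y < K) :
    ∃ C : ℝ, 1 ≤ C ∧ ∀ n : ℕ, supLine (iterC A β n) y ≤ C * Real.exp (n * K) := by
  obtain ⟨n0, h⟩ := eventually_atTop.1 (hA.eventually_supLine_le y hK)
  refine ⟨1 + ∑ i ∈ Finset.range n0, supLine (iterC A β i) y * Real.exp (-(i * K)), ?_, ?_⟩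
  · have : 0 ≤ ∑ i ∈ Finset.range n0, supLine (iterC A β i) y * Real.exp (-(i * K)) :=
      Finset.sum_nonneg fun i _ => mul_nonneg (hA.supLine_pos i y).le (Real.exp_pos _).le
    linarith
  · intro n
    have h0 : ∀ i ∈ Finset.range n0, 0 ≤ supLine (iterC A β i) y * Real.exp (-(i * K)) :=
      fun i _ => mul_nonneg (hA.supLine_pos i y).le (Real.exp_pos _).le
    rcases le_or_gt n0 n with hn | hn
    · refine (h n hn).trans (le_mul_of_one_le_left (Real.exp_pos _).le ?_)
      linarith [Finset.sum_nonneg h0]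
    · have := Finset.single_le_sum h0 (Finset.mem_range.2 hn)
      calc _ = supLine (iterC A β n) y * Real.exp (-(n * K)) * Real.exp (n * K) := by
            rw [mul_assoc, ← Real.exp_add]; simp
        _ ≤ _ := by gcongr; linarith

end TrigCocycle

lemma prod_shift_irrational {β : ℝ} (h : Irrational β) {m : ℕ} (hm : m ≠ 0) :
    Irrational (m * β) := h.natCast_mul hm

lemma IsTrig.bddAbove_strip {n : ℕ} {f : ℂ → ℂ} {p : Polynomial ℂ} (h : IsTrig n f p)
    (y1 y2 : ℝ) : ∃ B : ℝ, ∀ z : ℂ, y1 ≤ z.im → z.im ≤ y2 → ‖f z‖ ≤ B := by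
  set K : Set ℂ := {W | Real.exp (-(2 * π * y2)) ≤ ‖W‖ ∧ ‖W‖ ≤ Real.exp (-(2 * π * y1))} with hK
  have hKc : IsCompact K := by
    apply Metric.isCompact_of_isClosed_isBounded
    · exact (isClosed_le continuous_const continuous_norm).inter
        (isClosed_le continuous_norm continuous_const)
    · exact (Metric.isBounded_closedBall (x := (0 : ℂ)) (r := Real.exp (-(2 * π * y1)))).subset
        fun W hW => by simpa using hW.2
  have hc : ContinuousOn (fun W => p.eval W / W ^ n) K := by
    apply p.continuous.continuousOn.div (by fun_prop)
    intro W hW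
    apply pow_ne_zero
    rintro rfl
    have := hW.1
    simp at this
    exact absurd this (not_le.2 (Real.exp_pos _))
  obtain ⟨B, hB⟩ := hKc.exists_bound_of_continuousOn hc
  refine ⟨B, fun z h1 h2 => ?_⟩
  rw [h.eq_div]
  apply hB (ee z)
  simp only [hK, Set.mem_ofPred_eq, norm_ee, Real.exp_le_exp]
  constructor <;> nlinarith [Real.pi_pos]

/-- The three lines theorem for trigonometric polynomials. -/
lemma IsTrig.three_lines {n : ℕ} {f : ℂ → ℂ} {p : Polynomial ℂ} (h : IsTrig n f p)
    {y1 y2 a b : ℝ} (hy : y1 < y2) (ha : ∀ x : ℝ, ‖f (x + y1 * Complex.I)‖ ≤ a)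
    (hb : ∀ x : ℝ, ‖f (x + y2 * Complex.I)‖ ≤ b) {x y : ℝ} (h1 : y1 ≤ y) (h2 : y ≤ y2) :
    ‖f (x + y * Complex.I)‖ ≤
      a ^ (1 - (y - y1) / (y2 - y1)) * b ^ ((y - y1) / (y2 - y1)) := by
  have hI : ∀ z : ℂ, z * Complex.I = ((-z.im : ℝ) : ℂ) + (z.re : ℝ) * Complex.I := fun z => by
    apply Complex.ext <;> simp
  have := Complex.HadamardThreeLines.norm_le_interp_of_mem_verticalClosedStrip'
    (f := fun z => f (z * Complex.I)) (z := y - x * Complex.I) (a := a) (b := b) hy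
    (by simp [Complex.HadamardThreeLines.verticalClosedStrip, h1, h2])
    (h.differentiable.comp (differentiable_id.mul_const _)).diffContOnCl
    (by
      obtain ⟨B, hB⟩ := h.bddAbove_strip y1 y2
      refine ⟨B, ?_⟩
      rintro _ ⟨z, hz, rfl⟩
      apply hB
      · simpa using hz.1
      · simpa using hz.2)
    (by
      intro z hz
      have : z.re = y1 := hz
      rw [hI z, this]; exact ha _)
    (by
      intro z hz
      have : z.re = y2 := hz
      rw [hI z, this]; exact hb _)
  rw [hI] at this
  simpa using this

namespace TrigCocycle
variable {A : ℂ → Mat} {β la : ℝ} (hA : TrigCocycle A β la)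
include hA

lemma intervalIntegrable_log_norm (m : ℕ) (y : ℝ) :
    IntervalIntegrable (fun x : ℝ => Real.log ‖iterC A β m (x + y * Complex.I)‖) volume 0 1 := by
  obtain ⟨p, hp, h, -⟩ := hA.det_iter_trig m
  have h1 := (h.intervalIntegrable hp y).abs
  have hm : AEStronglyMeasurable
      (fun x : ℝ => Real.log ‖iterC A β m (x + y * Complex.I)‖) :=
    (Real.measurable_log.comp (hA.continuous_line m y).measurable).aestronglyMeasurable
  have h2 : IntervalIntegrable (fun x : ℝ =>
      |Real.log ‖(iterC A β m (x + y * Complex.I)).det‖| +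
        |Real.log (supLine (iterC A β m) y)|) volume 0 1 := h1.add (by simp)
  refine h2.mono_fun hm.restrict ?_
  rw [Set.uIoc_of_le zero_le_one]
  filter_upwards [h.ae_ne_zero hp y] with x hx
  have hd := norm_det_le (iterC A β m (x + y * Complex.I))
  have hd0 : 0 < ‖(iterC A β m (x + y * Complex.I)).det‖ := norm_pos_iff.2 hx
  have hM : 0 < ‖iterC A β m (x + y * Complex.I)‖ := by
    by_contra hc
    have : ‖iterC A β m (x + y * Complex.I)‖ = 0 := le_antisymm (not_lt.1 hc) (norm_nonneg _)
    rw [this] at hd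
    norm_num at hd
    exact hx hd
  have hs := Real.log_le_log hM (hA.norm_le_supLine m x y)
  have hl := Real.log_le_log hd0 hd
  rw [Real.log_pow] at hl
  rw [Real.norm_eq_abs, Real.norm_eq_abs, abs_of_nonneg (by positivity : (0 : ℝ) ≤ |_| + |_|)]
  set L := Real.log ‖iterC A β m (x + y * Complex.I)‖
  have a1 := neg_abs_le (Real.log ‖(iterC A β m (x + y * Complex.I)).det‖)
  have a2 := le_abs_self (Real.log (supLine (iterC A β m) y))
  have a3 := abs_nonneg (Real.log ‖(iterC A β m (x + y * Complex.I)).det‖)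
  have a4 := abs_nonneg (Real.log (supLine (iterC A β m) y))
  push_cast at hl
  rw [abs_le]
  constructor <;> linarith

lemma ae_norm_ne_zero (m : ℕ) (y : ℝ) :
    ∀ᵐ x : ℝ ∂(volume.restrict (Set.Ioc (0 : ℝ) 1)),
      ‖iterC A β m (x + y * Complex.I)‖ ≠ 0 := by
  obtain ⟨p, hp, h, -⟩ := hA.det_iter_trig m
  filter_upwards [h.ae_ne_zero hp y] with x hx h0
  have := norm_det_le (iterC A β m (x + y * Complex.I))
  rw [h0] at this
  norm_num at this
  exact hx this

lemma rate_le_integral (m : ℕ) (y : ℝ) :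
    m * rate A β y ≤ ∫ x in (0 : ℝ)..1, Real.log ‖iterC A β m (x + y * Complex.I)‖ := by
  rcases eq_or_ne m 0 with rfl | hm
  · have : 1 ≤ ‖(1 : Mat)‖ := by simpa using norm_entry_le (1 : Mat) 0 0
    simpa [iterC] using Real.log_nonneg this
  by_contra! hlt
  obtain ⟨K, hK1, hK2⟩ := exists_between hlt
  obtain ⟨n0, hn0⟩ := prod_orbit_le (prod_shift_irrational hA.irr hm) (hA.continuous_line m y)
    (fun x => norm_nonneg _) (hA.periodic_line m y) (hA.ae_norm_ne_zero m y)
    (hA.intervalIntegrable_log_norm m y) hK1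
  have hprod : ∀ n : ℕ, 1 ≤ n → ∀ x : ℝ, ‖iterC A β (n * m) (x + y * Complex.I)‖ ≤
      ∏ j ∈ Finset.range n, ‖iterC A β m (((x + j * (m * β) : ℝ) : ℂ) + y * Complex.I)‖ := by
    intro n hn
    induction n, hn using Nat.le_induction with
    | base => intro x; simp
    | succ n hn ih =>
      intro x
      rw [Finset.prod_range_succ_comm, Nat.succ_mul, add_comm, iterC_add]
      refine (Matrix.frobenius_norm_mul _ _).trans ?_
      refine mul_le_mul ?_ (ih x) (norm_nonneg _) (norm_nonneg _)
      apply le_of_eq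
      congr 2
      push_cast
      ring
  have hn1 : 1 ≤ n0 + 1 := by omega
  have h1 : supLine (iterC A β ((n0 + 1) * m)) y ≤ Real.exp ((n0 + 1 : ℕ) * K) :=
    ciSup_le fun x => (hprod _ hn1 x).trans (hn0 _ (by omega) x)
  have h2 := (hA.exp_rate_le_supLine _ y).trans h1
  rw [Real.exp_le_exp] at h2
  push_cast at h2
  have : (0 : ℝ) < n0 + 1 := by positivity
  nlinarith

lemma exists_det_le (y : ℝ) {κ : ℝ} (hκ : 0 < κ) :
    ∃ C : ℝ, 1 ≤ C ∧ ∀ (n : ℕ) (x : ℝ), ‖(iterC A β n (x + y * Complex.I)).det‖ ≤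
      C * Real.exp (n * (2 * la + 4 * π * |y| + κ)) := by
  obtain ⟨p, hp, h⟩ := hA.det_trig
  set F : ℝ → ℝ := fun x => ‖(A (x + y * Complex.I)).det‖ with hF
  have hFc : Continuous F := (h.differentiable.continuous.comp (by fun_prop : Continuous
    fun x : ℝ => (x : ℂ) + y * Complex.I)).norm
  have hFp : Function.Periodic F 1 := fun x => by
    simp only [hF]
    rw [← h.add_one (x + y * Complex.I)]; push_cast; congr 3; ring
  set K := 2 * la + 4 * π * |y| + κ with hK
  obtain ⟨n0, hn0⟩ := prod_orbit_le hA.irr hFc (fun x => norm_nonneg _) hFp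
    (by filter_upwards [h.ae_ne_zero hp y] with x hx; simpa [hF] using hx)
    (h.intervalIntegrable hp y) (K := K) (by have := hA.det_le y; rw [lineMean] at this; linarith)
  obtain ⟨B, hB⟩ := bddAbove_of_periodic hFc hFp
  have hB' : ∀ x, F x ≤ B := fun x => hB ⟨x, rfl⟩
  have hB0 : 0 ≤ B := (norm_nonneg _).trans (hB' 0)
  have hdet : ∀ (n : ℕ) (x : ℝ), ‖(iterC A β n (x + y * Complex.I)).det‖ =
      ∏ j ∈ Finset.range n, F (x + j * β) := by
    intro n x
    rw [det_iterC, norm_prod]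
    apply Finset.prod_congr rfl
    intro j _
    simp only [hF]
    push_cast; congr 3; ring
  have h0 : ∀ i ∈ Finset.range n0, 0 ≤ B ^ i * Real.exp (-(i * K)) :=
      fun i _ => by positivity
  refine ⟨1 + ∑ i ∈ Finset.range n0, B ^ i * Real.exp (-(i * K)), ?_, fun n x => ?_⟩
  · linarith [Finset.sum_nonneg h0]
  rw [hdet]
  rcases le_or_gt n0 n with hn | hn
  · refine (hn0 n hn x).trans (le_mul_of_one_le_left (Real.exp_pos _).le ?_)
    linarith [Finset.sum_nonneg h0]
  · have h3 := Finset.single_le_sum h0 (Finset.mem_range.2 hn)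
    have h4 : ∏ j ∈ Finset.range n, F (x + j * β) ≤ B ^ n := by
      calc _ ≤ ∏ j ∈ Finset.range n, B :=
            Finset.prod_le_prod (fun j _ => norm_nonneg _) fun j _ => hB' _
        _ = _ := by simp
    calc _ ≤ B ^ n := h4
      _ = B ^ n * Real.exp (-(n * K)) * Real.exp (n * K) := by
          rw [mul_assoc, ← Real.exp_add]; simp
      _ ≤ _ := by gcongr; linarith

lemma norm_iter_three_lines (n : ℕ) {y1 y2 : ℝ} (hy : y1 < y2) {x y : ℝ} (h1 : y1 ≤ y)
    (h2 : y ≤ y2) : ‖iterC A β n (x + y * Complex.I)‖ ≤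
      2 * (supLine (iterC A β n) y1 ^ (1 - (y - y1) / (y2 - y1)) *
        supLine (iterC A β n) y2 ^ ((y - y1) / (y2 - y1))) := by
  apply norm_mat_le
  intro i j
  obtain ⟨p, hp⟩ := hA.iter_trig n i j
  exact hp.three_lines hy (fun x => (norm_entry_le _ i j).trans (hA.norm_le_supLine n x y1))
    (fun x => (norm_entry_le _ i j).trans (hA.norm_le_supLine n x y2)) h1 h2

lemma convexOn_rate : ConvexOn ℝ Set.univ (rate A β) := by
  apply LinearOrder.convexOn_of_lt convex_univ
  intro y1 _ y2 _ hy a b ha hb hab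
  simp only [smul_eq_mul]
  have ht : (a * y1 + b * y2 - y1) / (y2 - y1) = b := by
    have : y2 - y1 ≠ 0 := by linarith
    field_simp
    have : a = 1 - b := by linarith
    rw [this]; ring
  have key : ∀ᶠ n : ℕ in atTop, Real.log (supLine (iterC A β n) (a * y1 + b * y2)) / n ≤
      Real.log 2 / n + (a * (Real.log (supLine (iterC A β n) y1) / n) +
        b * (Real.log (supLine (iterC A β n) y2) / n)) := by
    filter_upwards [eventually_gt_atTop 0] with n hn
    have hn' : (0 : ℝ) < n := by exact_mod_cast hn
    have h1 : supLine (iterC A β n) (a * y1 + b * y2) ≤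
        2 * (supLine (iterC A β n) y1 ^ a * supLine (iterC A β n) y2 ^ b) := by
      apply ciSup_le
      intro x
      have := hA.norm_iter_three_lines n hy (x := x) (y := a * y1 + b * y2)
        (by rw [show a = 1 - b by linarith]; nlinarith)
        (by rw [show b = 1 - a by linarith]; nlinarith)
      rwa [ht, show 1 - b = a by linarith] at this
    have p1 := hA.supLine_pos n y1
    have p2 := hA.supLine_pos n y2
    have h2 := Real.log_le_log (hA.supLine_pos n _) h1
    rw [Real.log_mul (by norm_num) (by positivity), Real.log_mul (by positivity) (by positivity),
      Real.log_rpow p1, Real.log_rpow p2] at h2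
    calc _ ≤ (Real.log 2 + (a * Real.log (supLine (iterC A β n) y1) +
          b * Real.log (supLine (iterC A β n) y2))) / n := by gcongr
      _ = _ := by ring
  have hl : Tendsto (fun n : ℕ => Real.log 2 / n + (a * (Real.log (supLine (iterC A β n) y1) / n) +
        b * (Real.log (supLine (iterC A β n) y2) / n))) atTop
      (nhds (0 + (a * rate A β y1 + b * rate A β y2))) :=
    (tendsto_const_div_atTop_nhds_zero_nat _).add (((hA.tendsto_rate y1).const_mul a).add
      ((hA.tendsto_rate y2).const_mul b))
  rw [zero_add] at hl
  exact le_of_tendsto_of_tendsto (hA.tendsto_rate _) hl key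

end TrigCocycle

/-- The bilinear form `wᵀ M v` with `v = (1, ω)` and `w = (1, ω²)`. -/
def bil (ω : ℂ) (M : Mat) : ℂ := M 0 0 + ω * M 0 1 + ω ^ 2 * M 1 0 + ω ^ 3 * M 1 1

/-- `bil` as a polynomial in `ω`. -/
def bilPoly (M : Mat) : Polynomial ℂ :=
  Polynomial.C (M 0 0) + Polynomial.C (M 0 1) * Polynomial.X +
    Polynomial.C (M 1 0) * Polynomial.X ^ 2 + Polynomial.C (M 1 1) * Polynomial.X ^ 3

lemma eval_bilPoly (ω : ℂ) (M : Mat) : (bilPoly M).eval ω = bil ω M := by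
  simp [bilPoly, bil]; ring

lemma norm_bil_le {ω : ℂ} (hω : ‖ω‖ = 1) (M : Mat) : ‖bil ω M‖ ≤ 4 * ‖M‖ := by
  unfold bil
  refine (norm_add_le _ _).trans ?_
  have h1 := norm_add_le (M 0 0 + ω * M 0 1) (ω ^ 2 * M 1 0)
  have h2 := norm_add_le (M 0 0) (ω * M 0 1)
  simp only [norm_mul, norm_pow, hω, one_pow, one_mul] at *
  linarith [norm_entry_le M 0 0, norm_entry_le M 0 1, norm_entry_le M 1 0, norm_entry_le M 1 1]

lemma bilPoly_coeff (M : Mat) : (bilPoly M).coeff 0 = M 0 0 ∧ (bilPoly M).coeff 1 = M 0 1 ∧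
    (bilPoly M).coeff 2 = M 1 0 ∧ (bilPoly M).coeff 3 = M 1 1 := by
  simp [bilPoly, Polynomial.coeff_X, Polynomial.coeff_X_pow, Polynomial.coeff_C]

lemma natDegree_bilPoly (M : Mat) : (bilPoly M).natDegree ≤ 3 := by
  unfold bilPoly; compute_degree

lemma norm_le_mahler (M : Mat) : ‖M‖ ≤ 6 * (bilPoly M).mahlerMeasure := by
  obtain ⟨h0, h1, h2, h3⟩ := bilPoly_coeff M
  have key : ∀ k, k ≤ 3 → ‖(bilPoly M).coeff k‖ ≤ 3 * (bilPoly M).mahlerMeasure := by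
    intro k hk
    refine ((bilPoly M).norm_coeff_le_choose_mul_mahlerMeasure k).trans ?_
    gcongr
    · exact (bilPoly M).mahlerMeasure_nonneg
    have hd := natDegree_bilPoly M
    have : (bilPoly M).natDegree.choose k ≤ 3 := by
      generalize (bilPoly M).natDegree = d at hd
      interval_cases d <;> interval_cases k <;> decide
    exact_mod_cast this
  have : ‖M‖ ≤ 2 * (3 * (bilPoly M).mahlerMeasure) := by
    apply norm_mat_le
    intro i j
    fin_cases i <;> fin_cases j
    · simpa [h0] using key 0 (by norm_num)
    · simpa [h1] using key 1 (by norm_num)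
    · simpa [h2] using key 2 (by norm_num)
    · simpa [h3] using key 3 (by norm_num)
  linarith

lemma isTrig_bil {n : ℕ} {F : ℂ → Mat} (h : ∀ i j, ∃ p, IsTrig n (fun z => F z i j) p) (ω : ℂ) :
    ∃ p, IsTrig n (fun z => bil ω (F z)) p := by
  obtain ⟨p00, h00⟩ := h 0 0
  obtain ⟨p01, h01⟩ := h 0 1
  obtain ⟨p10, h10⟩ := h 1 0
  obtain ⟨p11, h11⟩ := h 1 1
  exact ⟨_, ((h00.add (h01.const_mul ω)).add (h10.const_mul (ω ^ 2))).add
    (h11.const_mul (ω ^ 3))⟩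

namespace TrigCocycle
variable {A : ℂ → Mat} {β la : ℝ} (hA : TrigCocycle A β la)
include hA

lemma bil_trig (n : ℕ) (ω : ℂ) : ∃ p, IsTrig n (fun z => bil ω (iterC A β n z)) p :=
  isTrig_bil (hA.iter_trig n) ω

/-- For some unimodular `ω`, the scalar function `bil ω (A_N)` captures the growth on a line. -/
lemma exists_bil_lineMean_ge (N : ℕ) (y : ℝ) :
    ∃ (ω : ℂ) (p : Polynomial ℂ), ‖ω‖ = 1 ∧ p ≠ 0 ∧
      IsTrig N (fun z => bil ω (iterC A β N z)) p ∧
      N * rate A β y - Real.log 6 ≤ lineMean (fun z => bil ω (iterC A β N z)) y := by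
  set M : ℝ → Mat := fun x => iterC A β N (x + y * Complex.I) with hM
  set μ := volume.restrict (Set.Ioc (0 : ℝ) 1) with hμ
  have : IsProbabilityMeasure μ := ⟨by simp [hμ]⟩
  set S := supLine (iterC A β N) y with hS
  have hSpos : 0 < S := hA.supLine_pos N y
  set B : ℝ := |Real.log (4 * S)| with hB
  have hle : ∀ x t : ℝ, Real.log ‖bil (ee t) (M x)‖ ≤ B := by
    intro x t
    rcases eq_or_ne (bil (ee t) (M x)) 0 with h | h
    · rw [h]; simp [hB]
    · refine le_trans (Real.log_le_log (norm_pos_iff.2 h) ?_) (le_abs_self _)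
      refine (norm_bil_le (norm_ee_ofReal t) _).trans ?_
      gcongr
      exact hA.norm_le_supLine N x y
  have hcont : Continuous fun q : ℝ × ℝ => bil (ee q.2) (M q.1) := by
    have hc : ∀ i j, Continuous fun q : ℝ × ℝ => M q.1 i j := fun i j =>
      (hA.differentiable_iter N i j).continuous.comp (by fun_prop : Continuous
        fun q : ℝ × ℝ => (q.1 : ℂ) + y * Complex.I)
    have he : Continuous fun q : ℝ × ℝ => ee q.2 := continuous_ee.comp (by fun_prop)
    have h00 := hc 0 0
    have h01 := hc 0 1
    have h10 := hc 1 0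
    have h11 := hc 1 1
    exact ((h00.add (he.mul h01)).add ((he.pow 2).mul h10)).add ((he.pow 3).mul h11)
  have hreal : (volume.restrict (Set.Ioc (0 : ℝ) 1)).real Set.univ = 1 := by simp
  set D : ℝ → ℝ → ℝ≥0∞ := fun x t => ENNReal.ofReal (B - Real.log ‖bil (ee t) (M x)‖) with hD
  have hDm : Measurable (Function.uncurry D) := by
    apply ENNReal.measurable_ofReal.comp
    exact (measurable_const.sub (Real.measurable_log.comp hcont.norm.measurable))
  -- the inner integral
  have hinner : ∀ x, M x ≠ 0 → ∫⁻ t, D x t ∂μ ≤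
      ENNReal.ofReal (B + Real.log 6 - Real.log ‖M x‖) := by
    intro x hx
    have hP : bilPoly (M x) ≠ 0 := by
      intro h0
      have := norm_le_mahler (M x)
      rw [h0] at this
      simp at this
      exact hx this
    have hii := intervalIntegrable_line_of_circleIntegrable (y := 0)
      (circleIntegrable_log_norm_eval (bilPoly (M x)) 0 _)
    have hinteg := integral_line_eq_circleAverage
      (fun z => Real.log ‖(bilPoly (M x)).eval z‖) 0
    simp only [eval_bilPoly, ofReal_zero, zero_mul, add_zero] at hii hinteg
    simp only [mul_zero, neg_zero, Real.exp_zero] at hinteg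
    have hmah : Real.circleAverage (fun z => Real.log ‖bil z (M x)‖) 0 1 =
        Real.log (bilPoly (M x)).mahlerMeasure := by
      rw [← Polynomial.logMahlerMeasure_eq_log_MahlerMeasure, Polynomial.logMahlerMeasure_def]
      simp only [eval_bilPoly]
    have hlog : Real.log ‖M x‖ ≤ Real.log 6 + Real.log (bilPoly (M x)).mahlerMeasure := by
      rw [← Real.log_mul (by norm_num) (Polynomial.mahlerMeasure_pos_of_ne_zero hP).ne']
      exact Real.log_le_log (norm_pos_iff.2 hx) (norm_le_mahler _)
    rw [intervalIntegrable_iff_integrableOn_Ioc_of_le zero_le_one] at hii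
    rw [hD, ← ofReal_integral_eq_lintegral_ofReal]
    · apply ENNReal.ofReal_le_ofReal
      rw [integral_sub (integrable_const _) hii, integral_const]
      rw [intervalIntegral.integral_of_le zero_le_one, hmah] at hinteg
      simp only [hreal, smul_eq_mul, one_mul]
      rw [hinteg]
      linarith
    · exact (integrable_const _).sub hii
    · exact Eventually.of_forall fun t => sub_nonneg.2 (hle x t)
  have hMi := hA.intervalIntegrable_log_norm N y
  have hMr := hA.rate_le_integral N y
  rw [intervalIntegrable_iff_integrableOn_Ioc_of_le zero_le_one] at hMi
  rw [intervalIntegral.integral_of_le zero_le_one] at hMr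
  have hae := hA.ae_norm_ne_zero N y
  have houter : ∫⁻ x, ∫⁻ t, D x t ∂μ ∂μ ≤ ENNReal.ofReal (B + Real.log 6 - N * rate A β y) := by
    calc ∫⁻ x, ∫⁻ t, D x t ∂μ ∂μ ≤
        ∫⁻ x, ENNReal.ofReal (B + Real.log 6 - Real.log ‖M x‖) ∂μ := by
          apply lintegral_mono_ae
          filter_upwards [hae] with x hx
          exact hinner x (norm_ne_zero_iff.1 hx)
      _ = ENNReal.ofReal (∫ x, (B + Real.log 6 - Real.log ‖M x‖) ∂μ) := by
          rw [ofReal_integral_eq_lintegral_ofReal]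
          · exact (integrable_const _).sub hMi
          · filter_upwards [hae] with x hx
            have h1 := Real.log_le_log (lt_of_le_of_ne (norm_nonneg _) hx.symm)
              (hA.norm_le_supLine N x y)
            have h2 : Real.log (4 * S) ≤ B := le_abs_self _
            rw [Real.log_mul (by norm_num) hSpos.ne'] at h2
            have h3 : 0 ≤ Real.log 4 := Real.log_nonneg (by norm_num)
            have h4 : 0 ≤ Real.log 6 := Real.log_nonneg (by norm_num)
            simp only [Pi.zero_apply, hM]
            linarith
      _ ≤ _ := by
          apply ENNReal.ofReal_le_ofReal
          rw [integral_sub (integrable_const _) hMi, integral_const]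
          simp only [hreal, smul_eq_mul, one_mul]
          linarith
  rw [lintegral_lintegral_swap hDm.aemeasurable] at houter
  obtain ⟨x0, hx0⟩ : ∃ x0, M x0 ≠ 0 := by
    obtain ⟨x, hx⟩ := hae.exists
    exact ⟨x, norm_ne_zero_iff.1 hx⟩
  have hP0 : bilPoly (M x0) ≠ 0 := by
    intro h0
    have := norm_le_mahler (M x0)
    rw [h0] at this
    simp at this
    exact hx0 this
  have hnull : μ {t | bil (ee t) (M x0) = 0} = 0 := by
    have hT : IsTrig 0 (fun z => bil (ee z) (M x0)) (bilPoly (M x0)) := fun z => by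
      simp [eval_bilPoly]
    have := hT.ae_ne_zero hP0 0
    simp only [ofReal_zero, zero_mul, add_zero] at this
    rw [ae_iff] at this
    simpa only [not_not] using this
  obtain ⟨t, ht, htle⟩ := exists_notMem_null_le_lintegral
    ((hDm.lintegral_prod_left' (μ := μ)).aemeasurable (μ := μ)) hnull
  obtain ⟨p, hp⟩ := hA.bil_trig N (ee t)
  have hp0 : p ≠ 0 := by
    rintro rfl
    apply ht
    have := (hp.eval_eq_zero_iff (x0 + y * Complex.I)).1 (by simp)
    exact this
  refine ⟨ee t, p, norm_ee_ofReal t, hp0, hp, ?_⟩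
  have hfi := hp.intervalIntegrable hp0 y
  rw [intervalIntegrable_iff_integrableOn_Ioc_of_le zero_le_one] at hfi
  have h1 := htle.trans houter
  have h2 : ∫⁻ x, D x t ∂μ =
      ENNReal.ofReal (∫ x, (B - Real.log ‖bil (ee t) (M x)‖) ∂μ) := by
    rw [hD, ofReal_integral_eq_lintegral_ofReal]
    · exact (integrable_const _).sub hfi
    · exact Eventually.of_forall fun x => sub_nonneg.2 (hle x t)
  have h3 : ∫⁻ x, Function.uncurry D (x, t) ∂μ = ∫⁻ x, D x t ∂μ := rfl
  rw [h3, h2] at h1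
  have hnn : 0 ≤ B + Real.log 6 - N * rate A β y := by
    have h5 : N * rate A β y ≤ Real.log S := by
      rw [Real.le_log_iff_exp_le hSpos]; exact hA.exp_rate_le_supLine N y
    have h2 : Real.log (4 * S) ≤ B := le_abs_self _
    rw [Real.log_mul (by norm_num) hSpos.ne'] at h2
    have h3 : 0 ≤ Real.log 4 := Real.log_nonneg (by norm_num)
    have h4 : 0 ≤ Real.log 6 := Real.log_nonneg (by norm_num)
    linarith
  rw [ENNReal.ofReal_le_ofReal_iff hnn, integral_sub (integrable_const _) hfi,
    integral_const] at h1
  simp only [hreal, smul_eq_mul, one_mul] at h1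
  rw [lineMean, intervalIntegral.integral_of_le zero_le_one]
  linarith

end TrigCocycle

/-- The height of the zeros of `ee · - ζ`. -/
def height (ζ : ℂ) : ℝ := -Real.log ‖ζ‖ / (2 * π)

lemma height_ee (z : ℂ) : height (ee z) = z.im := by
  rw [height, norm_ee, Real.log_exp]; field_simp

lemma hasDerivAt_ee (z : ℂ) : HasDerivAt ee (2 * π * Complex.I * ee z) z := by
  have h := ((hasDerivAt_id z).const_mul (2 * (π : ℂ) * Complex.I)).cexp
  have e : cexp (2 * π * Complex.I * id z) * (2 * π * Complex.I * 1) =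
      2 * π * Complex.I * ee z := by
    rw [ee, id, mul_one, mul_comm]
  rw [e] at h
  exact h

lemma ee_injOn {z w : ℂ} (h : ee z = ee w) (hzw : ‖z - w‖ < 1) : z = w := by
  simp only [ee] at h
  obtain ⟨k, hk⟩ := Complex.exp_eq_exp_iff_exists_int.1 h
  have h0 : (2 * (π : ℂ) * Complex.I) ≠ 0 := Complex.two_pi_I_ne_zero
  have h1 : z - w = k := by
    apply mul_left_cancel₀ h0
    linear_combination hk
  rw [h1, Complex.norm_intCast] at hzw
  have : k = 0 := by
    have : |k| < 1 := by exact_mod_cast hzw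
    exact Int.abs_lt_one_iff.1 this
  rw [this] at h1
  simpa [sub_eq_zero] using h1

lemma circleAverage_log_norm_ee_sub_le {ζ z₀ : ℂ} {s r : ℝ} (hs : 0 < s) (hsr : s ≤ r)
    (hr : r ≤ 1 / 4) (hζ : ζ ≠ 0 → z₀.im ≠ height ζ) :
    Real.circleAverage (fun z => Real.log ‖ee z - ζ‖) z₀ s ≤
      Real.log ‖ee z₀ - ζ‖ +
        if ζ = 0 then 0 else Real.posLog (r / |z₀.im - height ζ|) := by
  have han : AnalyticOnNhd ℂ (fun z => ee z - ζ) (Metric.closedBall z₀ |s|) := fun z _ =>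
    (differentiable_ee.sub_const ζ).analyticAt z
  by_cases hz : ∀ u ∈ Metric.closedBall z₀ |s|, ee u - ζ ≠ 0
  · rw [han.circleAverage_log_norm_of_ne_zero hz]
    have : 0 ≤ if ζ = 0 then 0 else Real.posLog (r / |z₀.im - height ζ|) := by
      split_ifs
      exacts [le_rfl, Real.posLog_nonneg]
    linarith
  push Not at hz
  obtain ⟨z₁, hz₁, h1⟩ := hz
  have h1' : ζ = ee z₁ := (sub_eq_zero.1 h1).symm
  have hζ0 : ζ ≠ 0 := h1' ▸ ee_ne_zero z₁
  have him := hζ hζ0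
  have hc : ee z₀ - ζ ≠ 0 := fun h0 => by
    apply him
    rw [← sub_eq_zero.1 h0, height_ee]
  rw [abs_of_pos hs, Metric.mem_closedBall, dist_comm, dist_eq_norm] at hz₁
  rw [han.circleAverage_log_norm hs.ne' hc, if_neg hζ0]
  have hsingle : ∑ᶠ u, MeromorphicOn.divisor (fun z => ee z - ζ) (Metric.closedBall z₀ |s|) u *
      Real.log (s * ‖z₀ - u‖⁻¹) = Real.log (s * ‖z₀ - z₁‖⁻¹) := by
    rw [finsum_eq_single _ z₁]
    · rw [MeromorphicOn.AnalyticOnNhd.divisor_apply han (by simpa [abs_of_pos hs, dist_comm, dist_eq_norm] using hz₁)]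
      have : analyticOrderAt (fun z => ee z - ζ) z₁ = 1 := by
        rw [h1']
        apply AnalyticAt.analyticOrderAt_sub_eq_one_of_deriv_ne_zero
          (differentiable_ee.analyticAt z₁)
        rw [(hasDerivAt_ee z₁).deriv]
        exact mul_ne_zero Complex.two_pi_I_ne_zero (ee_ne_zero _)
      simp [this]
    · intro u hu
      by_cases hub : u ∈ Metric.closedBall z₀ |s|
      · rw [MeromorphicOn.AnalyticOnNhd.divisor_apply han hub]
        have : analyticOrderAt (fun z => ee z - ζ) u = 0 := by
          rw [(han u hub).analyticOrderAt_eq_zero]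
          intro h0
          apply hu
          apply ee_injOn
          · rw [sub_eq_zero.1 h0, h1']
          · rw [abs_of_pos hs, Metric.mem_closedBall, dist_eq_norm] at hub
            calc ‖u - z₁‖ = ‖(u - z₀) + (z₀ - z₁)‖ := by congr 1; ring
              _ ≤ _ := norm_add_le _ _
              _ < 1 := by linarith
        simp [this]
      · simp [hub]
  rw [hsingle, add_comm]
  gcongr
  have hpos : 0 < |z₀.im - height ζ| := abs_pos.2 (sub_ne_zero.2 him)
  have hle : |z₀.im - height ζ| ≤ ‖z₀ - z₁‖ := by
    rw [h1', height_ee]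
    exact Complex.abs_im_le_norm (z₀ - z₁)
  refine le_trans ?_ (le_max_right 0 _ : _ ≤ Real.posLog _)
  apply Real.log_le_log
  · have := hpos.trans_le hle
    positivity
  · rw [← div_eq_mul_inv]
    have := hs.le.trans hsr
    gcongr

lemma circleIntegrable_log_norm_ee_sub (ζ z₀ : ℂ) (s : ℝ) :
    CircleIntegrable (fun z => Real.log ‖ee z - ζ‖) z₀ s :=
  MeromorphicOn.circleIntegrable_log_norm fun z _ =>
    ((differentiable_ee.sub_const ζ).analyticAt z).meromorphicAt

/-- A Jensen-type inequality for finite products of factors `ee · - ζ`. -/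
lemma circleAverage_sum_log_le {z₀ : ℂ} {s r : ℝ} (hs : 0 < s) (hsr : s ≤ r)
    (hr : r ≤ 1 / 4) (S : Multiset ℂ) (hζ : ∀ ζ ∈ S, ζ ≠ 0 → z₀.im ≠ height ζ) :
    CircleIntegrable (fun z => (S.map fun ζ => Real.log ‖ee z - ζ‖).sum) z₀ s ∧
    Real.circleAverage (fun z => (S.map fun ζ => Real.log ‖ee z - ζ‖).sum) z₀ s ≤
      (S.map fun ζ => Real.log ‖ee z₀ - ζ‖).sum +
        (S.map fun ζ => if ζ = 0 then 0 else Real.posLog (r / |z₀.im - height ζ|)).sum := by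
  induction S using Multiset.induction_on with
  | empty => simp [Real.circleAverage_const]
  | cons ζ S ih =>
    obtain ⟨h1, h2⟩ := ih fun ζ h => hζ ζ (Multiset.mem_cons_of_mem h)
    have h3 := circleAverage_log_norm_ee_sub_le hs hsr hr (hζ ζ (Multiset.mem_cons_self _ _))
    have h4 := circleIntegrable_log_norm_ee_sub ζ z₀ s
    simp only [Multiset.map_cons, Multiset.sum_cons]
    refine ⟨h4.add h1, ?_⟩
    rw [Real.circleAverage_fun_add h4 h1]
    linarith

lemma measurable_posLog_div (r h : ℝ) : Measurable fun y : ℝ => Real.posLog (r / |y - h|) := by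
  have := Real.continuous_posLog.measurable
  fun_prop

lemma lintegral_posLog_div_le {r : ℝ} (hr : 0 < r) (h : ℝ) :
    ∫⁻ y, ENNReal.ofReal (Real.posLog (r / |y - h|)) ≤ ENNReal.ofReal (2 * r) := by
  rw [lintegral_sub_right_eq_self (fun t => ENNReal.ofReal (Real.posLog (r / |t|))) h]
  have hinteg : IntervalIntegrable (fun t => Real.log r - Real.log t) volume (-r) r :=
    intervalIntegrable_const.sub intervalIntegral.intervalIntegrable_log'
  have hval : ∫ t in (-r)..r, (Real.log r - Real.log t) = 2 * r := by
    rw [intervalIntegral.integral_sub intervalIntegrable_const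
      intervalIntegral.intervalIntegrable_log', integral_log]
    simp
    ring
  rw [intervalIntegral.integral_of_le (by linarith)] at hval
  rw [intervalIntegrable_iff_integrableOn_Ioc_of_le (by linarith)] at hinteg
  have hnn : 0 ≤ᵐ[volume.restrict (Set.Ioc (-r) r)] fun t => Real.log r - Real.log t := by
    rw [EventuallyLE, ae_restrict_iff' measurableSet_Ioc]
    have : ∀ᵐ t : ℝ, t ≠ 0 := by simp [ae_iff]
    filter_upwards [this] with t ht hmem
    rw [Pi.zero_apply, sub_nonneg, ← Real.log_abs t]
    exact Real.log_le_log (abs_pos.2 ht) (abs_le.2 ⟨hmem.1.le, hmem.2⟩)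
  rw [← hval, ofReal_integral_eq_lintegral_ofReal hinteg hnn, ← lintegral_indicator measurableSet_Ioc]
  have : ∀ᵐ t : ℝ, t ≠ 0 := by simp [ae_iff]
  apply lintegral_mono_ae
  filter_upwards [this] with t ht
  have hta := abs_pos.2 ht
  by_cases hmem : t ∈ Set.Ioc (-r) r
  · rw [Set.indicator_of_mem hmem]
    apply ENNReal.ofReal_le_ofReal
    have h1 : |t| ≤ r := abs_le.2 ⟨hmem.1.le, hmem.2⟩
    rw [Real.posLog_eq_log, Real.log_div hr.ne' hta.ne', Real.log_abs]
    rw [abs_of_pos (by positivity), le_div_iff₀ hta]; linarith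
  · rw [Set.indicator_of_notMem hmem, nonpos_iff_eq_zero, ENNReal.ofReal_eq_zero]
    apply le_of_eq
    rw [Real.posLog_eq_zero_iff, abs_of_pos (by positivity), div_le_one hta]
    by_contra hlt
    push Not at hlt
    exact hmem ⟨(abs_lt.1 hlt).1, (abs_lt.1 hlt).2.le⟩

lemma lintegral_sum_posLog_le {r : ℝ} (hr : 0 < r) (S : Multiset ℂ) :
    Measurable (fun y : ℝ => (S.map fun ζ => Real.posLog (r / |y - height ζ|)).sum) ∧
    ∫⁻ y, ENNReal.ofReal (S.map fun ζ => Real.posLog (r / |y - height ζ|)).sum ≤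
      ENNReal.ofReal (2 * r * S.card) := by
  induction S using Multiset.induction_on with
  | empty => simp
  | cons ζ S ih =>
    simp only [Multiset.map_cons, Multiset.sum_cons, Multiset.card_cons]
    have hm := measurable_posLog_div r (height ζ)
    refine ⟨hm.add ih.1, ?_⟩
    have hnn : ∀ y : ℝ, 0 ≤ (S.map fun ζ => Real.posLog (r / |y - height ζ|)).sum := fun y =>
      Multiset.sum_nonneg fun a ha => by
        obtain ⟨b, _, rfl⟩ := Multiset.mem_map.1 ha
        exact Real.posLog_nonneg
    simp_rw [ENNReal.ofReal_add Real.posLog_nonneg (hnn _)]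
    rw [lintegral_add_left hm.ennreal_ofReal]
    refine (add_le_add (lintegral_posLog_div_le hr _) ih.2).trans ?_
    rw [← ENNReal.ofReal_add (by positivity) (by positivity)]
    apply ENNReal.ofReal_le_ofReal
    push_cast
    linarith

/-- Most horizontal lines stay away from a finite set of heights. -/
lemma exists_height_sum_posLog_le {r : ℝ} (hr : 0 < r) (S T : Multiset ℂ) (y₁ : ℝ) :
    ∃ y ∈ Set.Icc y₁ (y₁ + r / 2), (∀ ζ ∈ T, y ≠ height ζ) ∧
      (S.map fun ζ => Real.posLog (r / |y - height ζ|)).sum ≤ 4 * S.card := by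
  obtain ⟨hm, hinteg⟩ := lintegral_sum_posLog_le hr S
  set I := Set.Icc y₁ (y₁ + r / 2)
  set g : ℝ → ℝ≥0∞ := fun y =>
    ENNReal.ofReal (S.map fun ζ => Real.posLog (r / |y - height ζ|)).sum with hg
  have hvol : volume I = ENNReal.ofReal (r / 2) := by simp [I, Real.volume_Icc]
  have hne : volume.restrict I ≠ 0 := by
    rw [ne_eq, Measure.restrict_eq_zero, hvol, ENNReal.ofReal_eq_zero]; linarith
  set N : Set ℝ := {y | ∃ ζ ∈ T, y = height ζ} ∪ Iᶜ
  have hN : volume.restrict I N = 0 := by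
    rw [measure_union_null_iff]
    constructor
    · apply Set.Finite.measure_zero
      apply ((T.map height).toFinset.finite_toSet).subset
      rintro y ⟨ζ, hζ, rfl⟩
      simpa using ⟨ζ, hζ, rfl⟩
    · rw [Measure.restrict_apply measurableSet_Icc.compl, Set.compl_inter_self, measure_empty]
  obtain ⟨y, hyN, hy⟩ := exists_notMem_null_le_laverage hne
    (hm.ennreal_ofReal.aemeasurable) hN
  simp only [N, Set.mem_union, not_or, Set.mem_compl_iff, not_not] at hyN
  refine ⟨y, hyN.2, fun ζ hζ h => hyN.1 ⟨ζ, hζ, h⟩, ?_⟩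
  have h2 : g y ≤ ENNReal.ofReal (4 * S.card) := by
    refine hy.trans ?_
    rw [laverage_eq, Measure.restrict_apply_univ, hvol]
    refine (ENNReal.div_le_div_right ((setLIntegral_le_lintegral _ _).trans hinteg) _).trans ?_
    rw [← ENNReal.ofReal_div_of_pos (by positivity)]
    apply ENNReal.ofReal_le_ofReal
    apply le_of_eq
    field_simp
    ring
  rwa [hg, ENNReal.ofReal_le_ofReal_iff (by positivity)] at h2

/-- A circle on which the average of a nonnegative function is controlled by line integrals. -/
lemma exists_circle_lintegral_le {D : ℂ → ℝ≥0∞} (hD : Measurable D) {y₀ r Q : ℝ}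
    (hr : 0 < r) (hr' : r ≤ 1 / 4) (hQ : 0 < Q)
    (h : ∀ y, |y - y₀| ≤ r → ∫⁻ x in Set.Ioc (0 : ℝ) 1, D (x + y * Complex.I) ≤ ENNReal.ofReal Q) :
    ∃ s, 0 < s ∧ s ≤ r ∧
      ∫⁻ θ in Set.Ioo (-π) π, D (circleMap (1 / 2 + y₀ * Complex.I) s θ) ≤
        ENNReal.ofReal (5 * Q / r) := by
  set z₀ : ℂ := 1 / 2 + y₀ * Complex.I with hz₀
  set G : ℂ → ℝ≥0∞ := (Metric.ball z₀ r).indicator D with hG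
  have hGm : Measurable G := hD.indicator Metric.isOpen_ball.measurableSet
  have hup : ∫⁻ w, G w ≤ ENNReal.ofReal (2 * r * Q) := by
    rw [← (Complex.volume_preserving_equiv_real_prod.symm).lintegral_comp hGm,
      Measure.volume_eq_prod,
      lintegral_prod_symm (fun a => G (Complex.measurableEquivRealProd.symm a))
        (hGm.comp (MeasurableEquiv.measurable _)).aemeasurable]
    have : ∀ y : ℝ, ∫⁻ x : ℝ, G (Complex.measurableEquivRealProd.symm (x, y)) ≤
        (Set.Icc (y₀ - r) (y₀ + r)).indicator (fun _ => ENNReal.ofReal Q) y := by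
      intro y
      have hxy : ∀ x : ℝ, Complex.measurableEquivRealProd.symm (x, y) = x + y * Complex.I := by
        intro x; apply Complex.ext <;> simp [Complex.measurableEquivRealProd]
      simp_rw [hxy]
      have hball : ∀ x : ℝ, (x : ℂ) + y * Complex.I ∈ Metric.ball z₀ r →
          |y - y₀| ≤ r ∧ x ∈ Set.Ioc (0 : ℝ) 1 := by
        intro x hx
        rw [Metric.mem_ball, dist_eq_norm] at hx
        have h1 := (Complex.abs_im_le_norm _).trans_lt hx
        have h2 := (Complex.abs_re_le_norm _).trans_lt hx
        simp [hz₀] at h1 h2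
        rw [abs_lt] at h2
        exact ⟨h1.le, by constructor <;> linarith⟩
      by_cases hy : |y - y₀| ≤ r
      · rw [Set.indicator_of_mem (by rw [abs_le] at hy; constructor <;> linarith)]
        refine le_trans ?_ (h y hy)
        rw [← lintegral_indicator measurableSet_Ioc]
        apply lintegral_mono
        intro x
        simp only [hG]
        by_cases hx : (x : ℂ) + y * Complex.I ∈ Metric.ball z₀ r
        · rw [Set.indicator_of_mem hx, Set.indicator_of_mem (hball x hx).2]
        · rw [Set.indicator_of_notMem hx]; exact zero_le
      · have : ∀ x : ℝ, G (x + y * Complex.I) = 0 := fun x =>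
          Set.indicator_of_notMem (fun hx => hy (hball x hx).1) _
        simp [this]
    refine (lintegral_mono this).trans ?_
    rw [lintegral_indicator measurableSet_Icc, setLIntegral_const, Real.volume_Icc,
      ← ENNReal.ofReal_mul hQ.le]
    apply ENNReal.ofReal_le_ofReal
    linarith
  by_contra hcon
  push Not at hcon
  rw [← lintegral_add_right_eq_self G z₀,
    ← Complex.lintegral_comp_polarCoord_symm] at hup
  have hcm : Measurable fun q : ℝ × ℝ => G (Complex.polarCoord.symm q + z₀) := by
    apply hGm.comp
    apply Measurable.add_const
    have e : (Complex.polarCoord.symm : ℝ × ℝ → ℂ) =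
        fun q : ℝ × ℝ => (q.1 : ℂ) * (Real.cos q.2 + Real.sin q.2 * Complex.I) :=
      funext fun q => Complex.polarCoord_symm_apply q
    rw [e]
    fun_prop
  have htar : polarCoord.target = Set.Ioi (0 : ℝ) ×ˢ Set.Ioo (-π) π := rfl
  rw [htar, Measure.volume_eq_prod, ← Measure.prod_restrict, lintegral_prod _
    (by
      apply Measurable.aemeasurable
      exact (ENNReal.measurable_ofReal.comp measurable_fst).mul hcm)] at hup
  have hlow : ∫⁻ s in Set.Ioo 0 r, ENNReal.ofReal s * ENNReal.ofReal (5 * Q / r) ≤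
      ENNReal.ofReal (2 * r * Q) := by
    refine le_trans ?_ hup
    refine le_trans ?_ (lintegral_mono_set (s := Set.Ioo 0 r) fun s hs => hs.1)
    apply setLIntegral_mono' measurableSet_Ioo
    intro s hs
    simp only [smul_eq_mul]
    rw [lintegral_const_mul (ENNReal.ofReal s)
      (f := fun y => G (Complex.polarCoord.symm (s, y) + z₀)) (hcm.comp measurable_prodMk_left)]
    gcongr
    refine (hcon s hs.1 hs.2.le).le.trans (le_of_eq ?_)
    apply lintegral_congr
    intro θ
    have e : circleMap z₀ s θ = Complex.polarCoord.symm (s, θ) + z₀ := by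
      rw [Complex.polarCoord_symm_apply, circleMap, add_comm, Complex.exp_mul_I]
      simp
    rw [e, hG, Set.indicator_of_mem]
    rw [← e, Metric.mem_ball, dist_eq_norm]
    simp [circleMap, abs_of_pos hs.1, hs.2]
  have hcalc : ∫⁻ s in Set.Ioo 0 r, ENNReal.ofReal s * ENNReal.ofReal (5 * Q / r) =
      ENNReal.ofReal (5 / 2 * r * Q) := by
    have : ∀ s : ℝ, ENNReal.ofReal s * ENNReal.ofReal (5 * Q / r) =
        ENNReal.ofReal (5 * Q / r * s) := fun s => by
      rw [mul_comm, ← ENNReal.ofReal_mul (by positivity)]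
    simp_rw [this]
    rw [Measure.restrict_congr_set Ioo_ae_eq_Ioc, ← ofReal_integral_eq_lintegral_ofReal]
    · rw [← intervalIntegral.integral_of_le hr.le, intervalIntegral.integral_const_mul, integral_id]
      congr 1
      field_simp
      ring
    · rw [← IntegrableOn, ← intervalIntegrable_iff_integrableOn_Ioc_of_le hr.le]
      exact (continuous_const.mul continuous_id).intervalIntegrable _ _
    · rw [EventuallyLE, ae_restrict_iff' measurableSet_Ioc]
      refine Eventually.of_forall fun s hs => ?_
      have := hs.1
      simp only [Pi.zero_apply]
      positivity
  rw [hcalc, ENNReal.ofReal_le_ofReal_iff (by positivity)] at hlow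
  have := mul_pos hr hQ
  nlinarith

section

variable {n : ℕ} {f : ℂ → ℂ} {p : Polynomial ℂ}

lemma log_norm_eval_eq {w : ℂ} (hw : p.eval w ≠ 0) :
    Real.log ‖p.eval w‖ = Real.log ‖p.leadingCoeff‖ +
      (p.roots.map fun ζ => Real.log ‖w - ζ‖).sum := by
  have key : ∀ s : Multiset ℂ, (s.map fun ζ => w - ζ).prod ≠ 0 →
      Real.log ‖(s.map fun ζ => w - ζ).prod‖ = (s.map fun ζ => Real.log ‖w - ζ‖).sum := by
    intro s
    induction s using Multiset.induction_on with
    | empty => simp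
    | cons ζ s ih =>
      intro hs
      simp only [Multiset.map_cons, Multiset.prod_cons, Multiset.sum_cons] at hs ⊢
      rw [norm_mul, Real.log_mul (norm_ne_zero_iff.2 (left_ne_zero_of_mul hs))
        (norm_ne_zero_iff.2 (right_ne_zero_of_mul hs)), ih (right_ne_zero_of_mul hs)]
  have hprod : p.eval w = p.leadingCoeff * (p.roots.map fun ζ => w - ζ).prod :=
    (IsAlgClosed.splits p).eval_eq_prod_roots w
  rw [hprod] at hw ⊢
  rw [norm_mul, Real.log_mul (norm_ne_zero_iff.2 (left_ne_zero_of_mul hw))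
        (norm_ne_zero_iff.2 (right_ne_zero_of_mul hw)), key _ (right_ne_zero_of_mul hw)]

lemma IsTrig.lineMean_le (h : IsTrig n f p) (hp : p ≠ 0) {y B : ℝ}
    (hB : ∀ x : ℝ, ‖f (x + y * Complex.I)‖ ≤ Real.exp B) : lineMean f y ≤ B := by
  have h1 := h.intervalIntegrable hp y
  rw [intervalIntegrable_iff_integrableOn_Ioc_of_le zero_le_one] at h1
  rw [lineMean, intervalIntegral.integral_of_le zero_le_one]
  calc _ ≤ ∫ _x in Set.Ioc (0 : ℝ) 1, B := by
        apply integral_mono_ae h1 (integrable_const _)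
        filter_upwards [h.ae_ne_zero hp y] with x hx
        rw [Real.log_le_iff_le_exp (norm_pos_iff.2 hx)]
        exact hB x
    _ = B := by simp

lemma circleAverage_affine_im (a b : ℝ) (z₀ : ℂ) (s : ℝ) :
    Real.circleAverage (fun z => a + b * z.im) z₀ s = a + b * z₀.im := by
  have e : ∀ z : ℂ, Real.log ‖Complex.exp (a - b * Complex.I * z)‖ = a + b * z.im := fun z => by
    rw [Complex.norm_exp, Real.log_exp]; simp
  have han : AnalyticOnNhd ℂ (fun z : ℂ => Complex.exp (a - b * Complex.I * z))
      (Metric.closedBall z₀ |s|) := fun z _ => by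
    have : Differentiable ℂ fun z : ℂ => Complex.exp (a - b * Complex.I * z) := by fun_prop
    exact this.analyticAt z
  have := han.circleAverage_log_norm_of_ne_zero fun u _ => Complex.exp_ne_zero _
  simpa only [e] using this

lemma circleAverage_le_of_lintegral_le {φ : ℂ → ℝ} {z₀ : ℂ} {s B : ℝ} (hB : 0 ≤ B)
    (hφ : CircleIntegrable φ z₀ s)
    (h : ∫⁻ θ in Set.Ioo (-π) π, ENNReal.ofReal (φ (circleMap z₀ s θ)) ≤ ENNReal.ofReal B) :
    Real.circleAverage φ z₀ s ≤ (2 * π)⁻¹ * B := by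
  have hper : Function.Periodic (fun θ => φ (circleMap z₀ s θ)) (2 * π) := fun θ => by
    simp only [periodic_circleMap z₀ s θ]
  have e : ∫ θ in (0 : ℝ)..2 * π, φ (circleMap z₀ s θ) =
      ∫ θ in (-π)..π, φ (circleMap z₀ s θ) := by
    have := hper.intervalIntegral_add_eq 0 (-π)
    rw [zero_add] at this
    rw [this]; congr 1; ring
  have hinteg : IntegrableOn (fun θ => φ (circleMap z₀ s θ)) (Set.Ioo (-π) π) := by
    rw [circleIntegrable_def] at hφ
    have h0 := hper.intervalIntegrable₀ Real.two_pi_pos.ne' hφ (-π) π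
    rw [intervalIntegrable_iff_integrableOn_Ioc_of_le (by linarith [Real.pi_pos])] at h0
    exact h0.mono_set Set.Ioo_subset_Ioc_self
  rw [Real.circleAverage_def, e, smul_eq_mul, intervalIntegral.integral_of_le
    (by linarith [Real.pi_pos]), integral_Ioc_eq_integral_Ioo]
  gcongr
  rw [integral_eq_lintegral_pos_part_sub_lintegral_neg_part hinteg]
  have h1 : (∫⁻ θ in Set.Ioo (-π) π, ENNReal.ofReal (φ (circleMap z₀ s θ))).toReal ≤ B :=
    ENNReal.toReal_le_of_le_ofReal hB h
  have h2 : 0 ≤ (∫⁻ θ in Set.Ioo (-π) π, ENNReal.ofReal (-φ (circleMap z₀ s θ))).toReal :=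
    ENNReal.toReal_nonneg
  linarith

/-- A trigonometric polynomial whose mean on a line is close to an affine upper bound for
`log |f|` on a strip is uniformly large on some nearby line. -/
lemma IsTrig.exists_line_ge (h : IsTrig n f p) (hp : p ≠ 0) {y₀ η b σ M y₁ : ℝ}
    (hη : 0 < η) (hη1 : η ≤ 1) (hM : 0 < M)
    (hU : ∀ x y : ℝ, |y - y₀| ≤ η → ‖f (x + y * Complex.I)‖ ≤ Real.exp (b + σ * (y - y₀)))
    (hm : b - M ≤ lineMean f y₀) (hy₁ : y₀ - η / 4 ≤ y₁) (hy₁' : y₁ + η / 8 ≤ y₀ + η / 4) :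
    ∃ y ∈ Set.Icc y₁ (y₁ + η / 8), ∀ x : ℝ,
      Real.exp (b + σ * (y - y₀) - 12 * M / η) ≤ ‖f (x + y * Complex.I)‖ := by
  classical
  set near := p.roots.filter fun ζ => ζ ≠ 0 ∧ |height ζ - y₀| ≤ η / 2 with hnear
  have hmle : ∀ y, |y - y₀| ≤ η → lineMean f y ≤ b + σ * (y - y₀) := fun y hy =>
    h.lineMean_le hp fun x => hU x y hy
  have hmge : ∀ y, |y - y₀| ≤ η → b + σ * (y - y₀) - 2 * M ≤ lineMean f y := fun y hy => by
    have h1 := h.two_mul_lineMean_le hp y₀ (y - y₀)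
    have h2 := hmle (y₀ - (y - y₀)) (by
      rw [show y₀ - (y - y₀) - y₀ = -(y - y₀) by ring, abs_neg]; exact hy)
    rw [add_sub_cancel] at h1
    linarith
  have hcard : π * η * near.card ≤ 2 * M := by
    have h1 := h.card_roots_le hp (y := y₀) (η := η) near (Multiset.filter_le _ _)
      fun ζ hζ => (Multiset.mem_filter.1 hζ).2
    have h2 := hmle (y₀ + η) (by rw [add_sub_cancel_left, abs_of_pos hη])
    have h3 := hmle (y₀ - η) (by rw [sub_sub_cancel_left, abs_neg, abs_of_pos hη])
    linarith
  have hr : 0 < η / 4 := by linarith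
  obtain ⟨y', hy'I, hy'ne, hy'sum⟩ := exists_height_sum_posLog_le hr near p.roots y₁
  have hy'I' : y' ∈ Set.Icc y₁ (y₁ + η / 8) := ⟨hy'I.1, by linarith [hy'I.2]⟩
  have hy'0 : |y' - y₀| ≤ η / 4 := abs_le.2 ⟨by linarith [hy'I'.1], by linarith [hy'I'.2]⟩
  refine ⟨y', hy'I', fun x => ?_⟩
  set z₀ : ℂ := x + y' * Complex.I with hz₀
  have hz₀im : z₀.im = y' := by simp [hz₀]
  have hL : (p.roots.map fun ζ => if ζ = 0 then 0 else
      Real.posLog (η / 4 / |z₀.im - height ζ|)).sum ≤ 4 * near.card := by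
    refine le_trans (le_of_eq ?_) hy'sum
    rw [hnear, hz₀im]
    generalize p.roots = R
    induction R using Multiset.induction_on with
    | empty => simp
    | cons ζ R ih =>
      rw [Multiset.map_cons, Multiset.sum_cons, ih, Multiset.filter_cons]
      by_cases hc : ζ ≠ 0 ∧ |height ζ - y₀| ≤ η / 2
      · rw [if_pos hc, if_neg hc.1]; simp
      · rw [if_neg hc, zero_add]
        by_cases h0 : ζ = 0
        · simp [h0]
        · have hfar : η / 2 < |height ζ - y₀| := by
            by_contra hcon; exact hc ⟨h0, not_lt.1 hcon⟩
          have : η / 4 ≤ |y' - height ζ| := by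
            have := abs_sub_le (height ζ) y' y₀
            rw [abs_sub_comm (height ζ) y'] at this
            linarith
          rw [if_neg h0, (Real.posLog_eq_zero_iff _).2, zero_add]
          rw [abs_of_nonneg (by positivity)]
          exact div_le_one_of_le₀ this (abs_nonneg _)
  set φ : ℂ → ℝ := fun z => (b - σ * y₀ - Real.log ‖p.leadingCoeff‖ + (σ - 2 * π * n) * z.im) -
    (p.roots.map fun ζ => Real.log ‖ee z - ζ‖).sum with hφ
  have hφf : ∀ z, f z ≠ 0 → φ z = b + σ * (z.im - y₀) - Real.log ‖f z‖ := fun z hz => by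
    rw [h.log_norm hz, log_norm_eval_eq ((h.eval_eq_zero_iff z).not.2 hz)]
    simp only [hφ]; ring
  have hφm : Measurable φ := by
    have : ∀ S : Multiset ℂ, Measurable fun z => (S.map fun ζ => Real.log ‖ee z - ζ‖).sum := by
      intro S
      induction S using Multiset.induction_on with
      | empty => simp
      | cons ζ S ih =>
        simp only [Multiset.map_cons, Multiset.sum_cons]
        exact (Real.measurable_log.comp (continuous_ee.sub continuous_const).norm.measurable).add ih
    exact (by fun_prop : Measurable fun z : ℂ => b - σ * y₀ - Real.log ‖p.leadingCoeff‖ +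
      (σ - 2 * π * n) * z.im).sub (this _)
  set t : ℝ := x - 1 / 2 with ht
  obtain ⟨s, hs, hsr, hsint⟩ := exists_circle_lintegral_le (D := fun z => ENNReal.ofReal (φ (z + t)))
    (by fun_prop) (y₀ := y') (r := η / 4) (Q := 2 * M) hr (by linarith) (by linarith) (by
    intro y hy
    have hyy : |y - y₀| ≤ η := by
      have := abs_sub_le y y' y₀
      linarith
    have ht' := h.comp_add t
    have hp' := IsTrig.comp_add_ne_zero hp t n
    have hi := ht'.intervalIntegrable hp' y
    rw [intervalIntegrable_iff_integrableOn_Ioc_of_le zero_le_one] at hi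
    have hlm : lineMean (fun z => f (z + t)) y = lineMean f y := lineMean_comp_add h.add_one t y
    calc ∫⁻ x in Set.Ioc (0 : ℝ) 1, ENNReal.ofReal (φ (x + y * Complex.I + t)) =
        ∫⁻ x in Set.Ioc (0 : ℝ) 1, ENNReal.ofReal
          (b + σ * (y - y₀) - Real.log ‖f (x + y * Complex.I + t)‖) := by
          apply lintegral_congr_ae
          filter_upwards [ht'.ae_ne_zero hp' y] with u hu
          rw [hφf _ hu]; simp
      _ = ENNReal.ofReal (∫ x in Set.Ioc (0 : ℝ) 1,
          (b + σ * (y - y₀) - Real.log ‖f (x + y * Complex.I + t)‖)) := by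
          rw [ofReal_integral_eq_lintegral_ofReal]
          · exact (integrable_const _).sub hi
          · filter_upwards [ht'.ae_ne_zero hp' y] with u hu
            rw [Pi.zero_apply, sub_nonneg, Real.log_le_iff_le_exp (norm_pos_iff.2 hu)]
            have := hU (u + t) y hyy
            rwa [show ((u + t : ℝ) : ℂ) + y * Complex.I = u + y * Complex.I + t by
              push_cast; ring] at this
      _ ≤ ENNReal.ofReal (2 * M) := by
          apply ENNReal.ofReal_le_ofReal
          rw [integral_sub (integrable_const _) hi, ← intervalIntegral.integral_of_le zero_le_one,
            ← intervalIntegral.integral_of_le zero_le_one]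
          have h1 : ∫ x in (0 : ℝ)..1, Real.log ‖f (x + y * Complex.I + t)‖ = lineMean f y := hlm
          rw [h1]
          have := hmge y hyy
          simp
          linarith)
  have hsint' : ∫⁻ θ in Set.Ioo (-π) π, ENNReal.ofReal (φ (circleMap z₀ s θ)) ≤
      ENNReal.ofReal (5 * (2 * M) / (η / 4)) := by
    refine le_trans (le_of_eq ?_) hsint
    apply lintegral_congr
    intro θ
    congr 2
    simp only [circleMap, hz₀, ht]
    push_cast
    ring
  obtain ⟨hci, hca⟩ := circleAverage_sum_log_le (z₀ := z₀) hs hsr (by linarith) p.roots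
    fun ζ hζ _ => by rw [hz₀im]; exact hy'ne ζ hζ
  have hcont : CircleIntegrable (fun z : ℂ => b - σ * y₀ - Real.log ‖p.leadingCoeff‖ +
      (σ - 2 * π * n) * z.im) z₀ s := by
    apply ContinuousOn.circleIntegrable'
    fun_prop
  have hav := circleAverage_le_of_lintegral_le (by positivity) (hcont.sub hci) hsint'
  rw [Real.circleAverage_sub hcont hci, circleAverage_affine_im] at hav
  have hfz : f z₀ ≠ 0 := by
    intro h0
    have h1 := (h.eval_eq_zero_iff z₀).2 h0
    have h2 : ee z₀ ∈ p.roots := by simpa [hp] using h1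
    exact hy'ne _ h2 (by rw [height_ee, hz₀im])
  have hfin := hφf z₀ hfz
  rw [← Real.le_log_iff_exp_le (norm_pos_iff.2 hfz)]
  simp only [hφ] at hfin
  rw [hz₀im] at hfin
  rw [hz₀im] at hL hca hav
  have hK : 4 * (near.card : ℝ) ≤ 4 * M / η := by
    rw [le_div_iff₀ hη]
    have h3 := Real.pi_gt_three
    have h4 : 0 ≤ η * near.card := by positivity
    nlinarith
  have hA : (2 * π)⁻¹ * (5 * (2 * M) / (η / 4)) ≤ 8 * M / η := by
    have h3 := Real.pi_gt_three
    rw [show (2 * π)⁻¹ * (5 * (2 * M) / (η / 4)) = 20 * M / η / π by field_simp; ring,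
      div_le_iff₀ Real.pi_pos]
    have h5 : 0 < M / η := by positivity
    have e1 : 20 * M / η = 20 * (M / η) := by ring
    have e2 : 8 * M / η = 8 * (M / η) := by ring
    rw [e1, e2]
    nlinarith
  have e3 : 12 * M / η = 8 * M / η + 4 * M / η := by ring
  linarith

end

lemma norm_mulVec_le (M : Mat) (x : Fin 2 → ℂ) : ‖M.mulVec x‖ ≤ 2 * ‖M‖ * ‖x‖ := by
  rw [pi_norm_le_iff_of_nonneg (by positivity)]
  intro i
  rw [Matrix.mulVec, dotProduct, Fin.sum_univ_two]
  refine (norm_add_le _ _).trans ?_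
  rw [norm_mul, norm_mul]
  have h0 := mul_le_mul (norm_entry_le M i 0) (norm_le_pi_norm x 0) (norm_nonneg _) (norm_nonneg _)
  have h1 := mul_le_mul (norm_entry_le M i 1) (norm_le_pi_norm x 1) (norm_nonneg _) (norm_nonneg _)
  linarith

/-- The functional `y ↦ wᵀ y` with `w = (1, ω²)`. -/
def pairW (ω : ℂ) (y : Fin 2 → ℂ) : ℂ := y 0 + ω ^ 2 * y 1

/-- The vector `v = (1, ω)`. -/
def vecV (ω : ℂ) : Fin 2 → ℂ := ![1, ω]

lemma bil_eq_pairW (ω : ℂ) (M : Mat) : bil ω M = pairW ω (M.mulVec (vecV ω)) := by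
  simp [bil, pairW, vecV, Matrix.mulVec, dotProduct, Fin.sum_univ_two]; ring

lemma norm_pairW_le {ω : ℂ} (hω : ‖ω‖ = 1) (y : Fin 2 → ℂ) : ‖pairW ω y‖ ≤ 2 * ‖y‖ := by
  refine (norm_add_le _ _).trans ?_
  rw [norm_mul, norm_pow, hω]
  linarith [norm_le_pi_norm y 0, norm_le_pi_norm y 1]

lemma norm_vecV {ω : ℂ} (hω : ‖ω‖ = 1) : ‖vecV ω‖ ≤ 1 := by
  rw [pi_norm_le_iff_of_nonneg zero_le_one]
  intro i
  fin_cases i <;> simp [vecV, hω]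

/-- Two vectors whose wedge is small are nearly proportional. -/
lemma exists_sub_smul_le (p q : Fin 2 → ℂ) (hp : p ≠ 0) :
    ∃ α : ℂ, ‖α‖ * ‖p‖ ≤ ‖q‖ ∧ ‖q - α • p‖ * ‖p‖ ≤ ‖p 0 * q 1 - p 1 * q 0‖ := by
  have hp0 : 0 < ‖p‖ := norm_pos_iff.2 hp
  have key : ‖p‖ = ‖p 0‖ ∨ ‖p‖ = ‖p 1‖ := by
    rcases le_total ‖p 0‖ ‖p 1‖ with h | h
    · right
      refine le_antisymm ((pi_norm_le_iff_of_nonneg (norm_nonneg _)).2 fun i => ?_)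
        (norm_le_pi_norm p 1)
      fin_cases i <;> simp [h]
    · left
      refine le_antisymm ((pi_norm_le_iff_of_nonneg (norm_nonneg _)).2 fun i => ?_)
        (norm_le_pi_norm p 0)
      fin_cases i <;> simp [h]
  rcases key with h | h
  · have h0 : p 0 ≠ 0 := norm_pos_iff.1 (h ▸ hp0)
    refine ⟨q 0 / p 0, ?_, ?_⟩
    · rw [h, norm_div, div_mul_cancel₀ _ (norm_ne_zero_iff.2 h0)]
      exact norm_le_pi_norm q 0
    · rw [← le_div_iff₀ hp0, pi_norm_le_iff_of_nonneg (by positivity)]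
      intro i
      fin_cases i
      · simp [h0]
        positivity
      · rw [h, ← norm_div]
        apply le_of_eq
        congr 1
        simp
        field_simp
  · have h0 : p 1 ≠ 0 := norm_pos_iff.1 (h ▸ hp0)
    refine ⟨q 1 / p 1, ?_, ?_⟩
    · rw [h, norm_div, div_mul_cancel₀ _ (norm_ne_zero_iff.2 h0)]
      exact norm_le_pi_norm q 1
    · rw [← le_div_iff₀ hp0, pi_norm_le_iff_of_nonneg (by positivity)]
      intro i
      fin_cases i
      · rw [h, ← norm_div, ← norm_neg]
        apply le_of_eq
        congr 1
        simp
        field_simp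
      · simp [h0]
        positivity

lemma avalanche_step {ω : ℂ} (hω : ‖ω‖ = 1) {B₁ B₂ : Mat} {x : Fin 2 → ℂ} {ρ K d : ℝ}
    (hρ : 0 < ρ) (hK : 0 < K) (h1 : ‖B₁‖ ≤ K) (h2 : ‖B₂‖ ≤ K) (hd : ‖B₁.det‖ ≤ d)
    (hdρ : 2 * d ≤ ρ ^ 2) (hf : 8 * ρ * K ≤ ‖bil ω (B₂ * B₁)‖) (hx : x ≠ 0)
    (hgrow : ρ * ‖x‖ ≤ ‖B₁.mulVec x‖) :
    2 * ρ * ‖B₁.mulVec x‖ ≤ ‖pairW ω (B₂.mulVec (B₁.mulVec x))‖ := by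
  set p := B₁.mulVec x with hp
  set q := B₁.mulVec (vecV ω) with hq
  have hx0 : 0 < ‖x‖ := norm_pos_iff.2 hx
  have hp0 : 0 < ‖p‖ := lt_of_lt_of_le (by positivity) hgrow
  obtain ⟨α, hα, hr⟩ := exists_sub_smul_le p q (norm_pos_iff.1 hp0)
  have hwedge : p 0 * q 1 - p 1 * q 0 = B₁.det * (x 0 * ω - x 1) := by
    simp [hp, hq, vecV, Matrix.det_fin_two]; ring
  have hxw : ‖x 0 * ω - x 1‖ ≤ 2 * ‖x‖ := by
    refine (norm_sub_le _ _).trans ?_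
    rw [norm_mul, hω]
    linarith [norm_le_pi_norm x 0, norm_le_pi_norm x 1]
  have hd0 : 0 ≤ d := (norm_nonneg _).trans hd
  rw [hwedge, norm_mul] at hr
  have hr1 : ‖q - α • p‖ ≤ ρ := by
    have e1 : ‖q - α • p‖ * (ρ * ‖x‖) ≤ ‖q - α • p‖ * ‖p‖ := by gcongr
    have e2 : ‖B₁.det‖ * ‖x 0 * ω - x 1‖ ≤ d * (2 * ‖x‖) := by gcongr
    have e3 : ‖q - α • p‖ * ρ * ‖x‖ ≤ ρ * ρ * ‖x‖ := by nlinarith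
    exact le_of_mul_le_mul_right (le_of_mul_le_mul_right e3 hx0) hρ
  have hq1 : ‖q‖ ≤ 2 * K := by
    refine (norm_mulVec_le _ _).trans ?_
    nlinarith [norm_vecV hω, norm_nonneg (vecV ω), norm_nonneg B₁]
  have hbil : bil ω (B₂ * B₁) =
      α * pairW ω (B₂.mulVec p) + pairW ω (B₂.mulVec (q - α • p)) := by
    rw [bil_eq_pairW, ← Matrix.mulVec_mulVec, ← hq, Matrix.mulVec_sub, Matrix.mulVec_smul]
    simp [pairW]; ring
  have h3 : ‖pairW ω (B₂.mulVec (q - α • p))‖ ≤ 4 * K * ρ := by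
    refine (norm_pairW_le hω _).trans ?_
    have := norm_mulVec_le B₂ (q - α • p)
    have : ‖B₂‖ * ‖q - α • p‖ ≤ K * ρ := by gcongr
    nlinarith
  rw [hbil] at hf
  have h4 := hf.trans (norm_add_le _ _)
  rw [norm_mul] at h4
  have h5 : 4 * ρ * K ≤ ‖α‖ * ‖pairW ω (B₂.mulVec p)‖ := by linarith
  have h6 : ‖α‖ * ‖p‖ ≤ 2 * K := hα.trans hq1
  have h7 : 4 * ρ * K * ‖p‖ ≤ 2 * K * ‖pairW ω (B₂.mulVec p)‖ := by
    calc 4 * ρ * K * ‖p‖ ≤ (‖α‖ * ‖pairW ω (B₂.mulVec p)‖) * ‖p‖ := by gcongr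
      _ = (‖α‖ * ‖p‖) * ‖pairW ω (B₂.mulVec p)‖ := by ring
      _ ≤ _ := by gcongr
  nlinarith

lemma avalanche {A : ℂ → Mat} {β : ℝ} {ω : ℂ} (hω : ‖ω‖ = 1) {Z : Set ℂ}
    (hZ : ∀ z ∈ Z, z + β ∈ Z) {h : ℕ} (hh : 1 ≤ h) {ρ K K' d : ℝ} (hρ : 0 < ρ) (hK : 0 < K)
    (hK' : 0 < K')
    (hprod : ∀ z ∈ Z, ∀ z' ∈ Z, ∀ r ≤ h, ‖iterC A β r z‖ * ‖iterC A β (h - r) z'‖ ≤ K)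
    (hnorm : ∀ z ∈ Z, ∀ r ≤ h, ‖iterC A β r z‖ ≤ K')
    (hone : ∀ z ∈ Z, ‖iterC A β h z‖ ≤ K)
    (hbil : ∀ z ∈ Z, 8 * ρ * K ≤ ‖bil ω (iterC A β (2 * h) z)‖)
    (hdet : ∀ z ∈ Z, ‖(iterC A β h z).det‖ ≤ d) (hdρ : 2 * d ≤ ρ ^ 2)
    {n : ℕ} (hn : 2 * h ≤ n) {z : ℂ} (hz : z ∈ Z) :
    4 * K / K' * ρ ^ (n / h) ≤ ‖bil ω (iterC A β n z)‖ := by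
  have hZn : ∀ m : ℕ, z + m * β ∈ Z := by
    intro m
    induction m with
    | zero => simpa using hz
    | succ m ih =>
      have := hZ _ ih
      convert this using 1
      push_cast; ring
  set r := n % h with hr
  have hrh : r < h := Nat.mod_lt _ hh
  set x : ℕ → Fin 2 → ℂ := fun j => (iterC A β (r + j * h) z).mulVec (vecV ω) with hx
  set B : ℕ → Mat := fun j => iterC A β h (z + ((r + j * h : ℕ) : ℂ) * β) with hB
  have hxs : ∀ j, x (j + 1) = (B j).mulVec (x j) := by
    intro j
    simp only [hx, hB]
    rw [Matrix.mulVec_mulVec, ← iterC_add]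
    congr 2
    ring
  have hBB : ∀ j, 8 * ρ * K ≤ ‖bil ω (B (j + 1) * B j)‖ := by
    intro j
    have := hbil _ (hZn (r + j * h))
    rw [two_mul, iterC_add] at this
    convert this using 4
    simp only [hB]
    congr 1
    push_cast; ring
  have hB1 : ∀ j, ‖B j‖ ≤ K := fun j => hone _ (hZn _)
  have hBd : ∀ j, ‖(B j).det‖ ≤ d := fun j => hdet _ (hZn _)
  have hv := norm_vecV hω
  have hstart : ρ * ‖x 0‖ ≤ ‖x 1‖ ∧ 2 * K / K' * ρ ^ 1 ≤ ‖x 1‖ ∧ x 0 ≠ 0 := by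
    have e1 := hbil _ hz
    set D := iterC A β (h - r) (z + ((h + r : ℕ) : ℂ) * β) with hD
    have e2 : iterC A β (2 * h) z = D * iterC A β (h + r) z := by
      rw [hD, ← iterC_add]; congr 1; omega
    have ex1 : x 1 = (iterC A β (h + r) z).mulVec (vecV ω) := by
      simp only [hx]; congr 2; omega
    rw [e2, bil_eq_pairW, ← Matrix.mulVec_mulVec, ← ex1] at e1
    have e3 := e1.trans (norm_pairW_le hω _)
    have e4 := norm_mulVec_le D (x 1)
    have e5 : 2 * ρ * K ≤ ‖D‖ * ‖x 1‖ := by linarith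
    have ex0 : ‖x 0‖ ≤ 2 * ‖iterC A β r z‖ := by
      have := norm_mulVec_le (iterC A β r z) (vecV ω)
      have e6 : x 0 = (iterC A β r z).mulVec (vecV ω) := by simp [hx]
      rw [e6]
      nlinarith [norm_nonneg (iterC A β r z)]
    have e7 : ‖iterC A β r z‖ * ‖D‖ ≤ K := hprod _ hz _ (hZn _) r hrh.le
    have hDpos : 0 < ‖D‖ := by
      by_contra hcon
      have : ‖D‖ = 0 := le_antisymm (not_lt.1 hcon) (norm_nonneg _)
      rw [this] at e5
      nlinarith [mul_pos hρ hK]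
    have hDK : ‖D‖ ≤ K' := hnorm _ (hZn _) _ (by omega)
    refine ⟨?_, ?_, ?_⟩
    · have : ρ * ‖x 0‖ * ‖D‖ ≤ ‖x 1‖ * ‖D‖ := by
        calc ρ * ‖x 0‖ * ‖D‖ ≤ ρ * (2 * ‖iterC A β r z‖) * ‖D‖ := by gcongr
          _ = 2 * ρ * (‖iterC A β r z‖ * ‖D‖) := by ring
          _ ≤ 2 * ρ * K := by gcongr
          _ ≤ _ := by linarith
      exact le_of_mul_le_mul_right this hDpos
    · rw [pow_one, div_mul_eq_mul_div, div_le_iff₀ hK']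
      nlinarith [norm_nonneg (x 1)]
    · intro h0
      have h1' : x 1 = 0 := by rw [hxs 0, h0, Matrix.mulVec_zero]
      rw [h1', norm_zero, mul_zero] at e5
      nlinarith [mul_pos hρ hK]
  have hind : ∀ j, ρ * ‖x j‖ ≤ ‖x (j + 1)‖ ∧ 2 * K / K' * ρ ^ (j + 1) ≤ ‖x (j + 1)‖ ∧ x j ≠ 0 := by
    intro j
    induction j with
    | zero => simpa using hstart
    | succ j ih =>
      obtain ⟨i1, i2, i3⟩ := ih
      have hne : x (j + 1) ≠ 0 := by
        rw [← norm_pos_iff]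
        exact lt_of_lt_of_le (by positivity) i2
      have s := avalanche_step hω hρ hK (hB1 j) (hB1 (j + 1)) (hBd j) hdρ (hBB j) i3
        (by rw [← hxs]; exact i1)
      rw [← hxs, ← hxs] at s
      have s2 := s.trans (norm_pairW_le hω _)
      refine ⟨by linarith, ?_, hne⟩
      have : 2 * K / K' * ρ ^ (j + 1 + 1) = ρ * (2 * K / K' * ρ ^ (j + 1)) := by ring
      rw [this]
      nlinarith [mul_le_mul_of_nonneg_left i2 hρ.le]
  obtain ⟨m, hm⟩ : ∃ m, n / h = m + 2 := by
    have : 2 ≤ n / h := (Nat.le_div_iff_mul_le hh).2 hn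
    exact ⟨n / h - 2, by omega⟩
  obtain ⟨i1, i2, i3⟩ := hind m
  have s := avalanche_step hω hρ hK (hB1 m) (hB1 (m + 1)) (hBd m) hdρ (hBB m) i3
    (by rw [← hxs]; exact i1)
  rw [← hxs, ← hxs] at s
  have hxn : bil ω (iterC A β n z) = pairW ω (x (m + 1 + 1)) := by
    rw [bil_eq_pairW]
    simp only [hx]
    congr 4
    have := Nat.mod_add_div n h
    rw [hm] at this
    rw [← this]; ring
  rw [hxn, hm]
  refine le_trans ?_ s
  have : 4 * K / K' * ρ ^ (m + 2) = 2 * ρ * (2 * K / K' * ρ ^ (m + 1)) := by ring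
  rw [this]
  gcongr

lemma rpow_interp_le {a b C u v t : ℝ} (ha : 0 ≤ a) (hb : 0 ≤ b) (hC : 1 ≤ C)
    (hau : a ≤ C * Real.exp u) (hbv : b ≤ C * Real.exp v) (ht0 : 0 ≤ t) (ht1 : t ≤ 1) :
    a ^ (1 - t) * b ^ t ≤ C * Real.exp ((1 - t) * u + t * v) := by
  have hC0 : 0 < C := by linarith
  calc a ^ (1 - t) * b ^ t ≤ (C * Real.exp u) ^ (1 - t) * (C * Real.exp v) ^ t := by
        gcongr
    _ = C * Real.exp ((1 - t) * u + t * v) := by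
        rw [Real.mul_rpow hC0.le (Real.exp_pos _).le, Real.mul_rpow hC0.le (Real.exp_pos _).le,
          ← Real.exp_mul, ← Real.exp_mul, Real.exp_add]
        have : C ^ (1 - t) * C ^ t = C := by
          rw [← Real.rpow_add hC0]; simp
        calc _ = (C ^ (1 - t) * C ^ t) * (Real.exp (u * (1 - t)) * Real.exp (v * t)) := by ring
          _ = _ := by rw [this]; ring_nf

namespace TrigCocycle
variable {A : ℂ → Mat} {β la : ℝ} (hA : TrigCocycle A β la)
include hA

lemma exists_strip_le {y₀ η a s : ℝ} (hη : 0 < η) (h1 : rate A β (y₀ - η) < a - s * η)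
    (h2 : rate A β (y₀ + η) < a + s * η) :
    ∃ C : ℝ, 1 ≤ C ∧ ∀ (n : ℕ) (x y : ℝ), |y - y₀| ≤ η →
      ‖iterC A β n (x + y * Complex.I)‖ ≤ C * Real.exp (n * (a + s * (y - y₀))) := by
  obtain ⟨C1, hC1, b1⟩ := hA.exists_supLine_le _ h1
  obtain ⟨C2, hC2, b2⟩ := hA.exists_supLine_le _ h2
  refine ⟨2 * max C1 C2, by linarith [le_max_left C1 C2], fun n x y hy => ?_⟩
  rw [abs_le] at hy
  have hlt : y₀ - η < y₀ + η := by linarith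
  have ht := hA.norm_iter_three_lines n hlt (x := x) (y := y) (by linarith) (by linarith)
  refine ht.trans ?_
  rw [mul_assoc]
  refine mul_le_mul_of_nonneg_left ?_ zero_le_two
  have e : y₀ + η - (y₀ - η) = 2 * η := by ring
  rw [e]
  have ht0 : 0 ≤ (y - (y₀ - η)) / (2 * η) := div_nonneg (by linarith) (by linarith)
  have ht1 : (y - (y₀ - η)) / (2 * η) ≤ 1 := by rw [div_le_one (by linarith)]; linarith
  have := rpow_interp_le (hA.supLine_pos n _).le (hA.supLine_pos n _).le
    (hC1.trans (le_max_left C1 C2))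
    ((b1 n).trans (mul_le_mul_of_nonneg_right (le_max_left _ _) (Real.exp_pos _).le))
    ((b2 n).trans (mul_le_mul_of_nonneg_right (le_max_right _ _) (Real.exp_pos _).le)) ht0 ht1
  refine this.trans (le_of_eq ?_)
  congr 2
  field_simp
  ring

lemma exists_det_strip_le (y₀ : ℝ) {η κ : ℝ} (hη : 0 < η) (hκ : 0 < κ) :
    ∃ C : ℝ, 1 ≤ C ∧ ∀ (n : ℕ) (x y : ℝ), |y - y₀| ≤ η →
      ‖(iterC A β n (x + y * Complex.I)).det‖ ≤
        C * Real.exp (n * (2 * la + 4 * π * (|y₀| + η) + κ)) := by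
  obtain ⟨C1, hC1, b1⟩ := hA.exists_det_le (y₀ - η) hκ
  obtain ⟨C2, hC2, b2⟩ := hA.exists_det_le (y₀ + η) hκ
  refine ⟨max C1 C2, hC1.trans (le_max_left C1 C2), fun n x y hy => ?_⟩
  obtain ⟨p, hp, hdet, -⟩ := hA.det_iter_trig n
  rw [abs_le] at hy
  have hlt : y₀ - η < y₀ + η := by linarith
  have a1 : |y₀ - η| ≤ |y₀| + η := (abs_sub _ _).trans (by rw [abs_of_pos hη])
  have a2 : |y₀ + η| ≤ |y₀| + η := (abs_add_le _ _).trans (by rw [abs_of_pos hη])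
  have c1 : ∀ x : ℝ, ‖(iterC A β n (x + (y₀ - η : ℝ) * Complex.I)).det‖ ≤
      max C1 C2 * Real.exp (n * (2 * la + 4 * π * (|y₀| + η) + κ)) := fun x => by
    refine (b1 n x).trans ?_
    gcongr
    exact le_max_left _ _
  have c2 : ∀ x : ℝ, ‖(iterC A β n (x + (y₀ + η : ℝ) * Complex.I)).det‖ ≤
      max C1 C2 * Real.exp (n * (2 * la + 4 * π * (|y₀| + η) + κ)) := fun x => by
    refine (b2 n x).trans ?_
    gcongr
    exact le_max_right _ _
  have ht := hdet.three_lines hlt c1 c2 (x := x) (y := y) (by linarith) (by linarith)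
  refine ht.trans (le_of_eq ?_)
  rw [← Real.rpow_add (by positivity)]
  simp

lemma good_lines {y₀ s η κ g : ℝ} (hη : 0 < η) (hη1 : η ≤ 1) (hκ : 0 < κ) (hg : 0 < g)
    (hgap : la + 2 * π * |y₀| + g ≤ rate A β y₀) (hs : |s| * η ≤ g / 8)
    (hπη : 2 * π * η ≤ g / 8) (hκg : 51 * κ ≤ g / 8)
    (hp : rate A β (y₀ + η) ≤ rate A β y₀ + s * η + κ * η)
    (hm : rate A β (y₀ - η) ≤ rate A β y₀ - s * η + κ * η) :
    ∃ ω : ℂ, ‖ω‖ = 1 ∧ ∀ y₁ : ℝ, y₀ - η / 4 ≤ y₁ → y₁ + η / 8 ≤ y₀ + η / 4 →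
      ∃ y ∈ Set.Icc y₁ (y₁ + η / 8), ∃ c > 0, ∃ n₁ : ℕ, ∀ n ≥ n₁, ∀ x : ℝ,
        c * Real.exp (n * (rate A β y₀ + s * (y - y₀) - 51 * κ)) ≤
          ‖bil ω (iterC A β n (x + y * Complex.I))‖ := by
  have hκη : 0 < κ * η := mul_pos hκ hη
  set L := rate A β y₀ with hL
  obtain ⟨C1, hC1, hB⟩ := hA.exists_strip_le (a := L + 2 * (κ * η)) (s := s) hη
    (by linarith) (by linarith)
  obtain ⟨C2, hC2, hD⟩ := hA.exists_det_strip_le y₀ hη hκ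
  have hC1' : 0 < C1 := by linarith
  have hC2' : 0 < C2 := by linarith
  set C4 := 12 * Real.log (24 * C1) / η with hC4
  obtain ⟨h, hh1, hh2, hh3⟩ : ∃ h : ℕ, 1 ≤ h ∧ Real.log (8 * C1 ^ 2) + C4 ≤ h * κ ∧
      Real.log (2 * C2) ≤ h * g := by
    obtain ⟨a, ha⟩ := exists_nat_ge ((Real.log (8 * C1 ^ 2) + C4) / κ)
    obtain ⟨b, hb⟩ := exists_nat_ge (Real.log (2 * C2) / g)
    rw [div_le_iff₀ hκ] at ha
    rw [div_le_iff₀ hg] at hb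
    refine ⟨a + b + 1, by omega, ?_, ?_⟩
    · refine ha.trans ?_
      gcongr; linarith [(Nat.cast_nonneg b : (0 : ℝ) ≤ b)]
    · refine hb.trans ?_
      gcongr; linarith [(Nat.cast_nonneg a : (0 : ℝ) ≤ a)]
  have hh0 : (1 : ℝ) ≤ h := by exact_mod_cast hh1
  obtain ⟨ω, p, hω, hp0, hpt, hmean⟩ := hA.exists_bil_lineMean_ge (2 * h) y₀
  refine ⟨ω, hω, fun y₁ hy1 hy2 => ?_⟩
  have hlog24 : Real.log (24 * C1) = Real.log (4 * C1) + Real.log 6 := by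
    rw [← Real.log_mul (by positivity) (by positivity)]; congr 1; ring
  have hlog4 : 0 ≤ Real.log (4 * C1) := Real.log_nonneg (by linarith)
  have hlog6 : 0 < Real.log 6 := Real.log_pos (by norm_num)
  obtain ⟨y, hyI, hline⟩ := hpt.exists_line_ge hp0 (y₀ := y₀) (η := η)
    (b := Real.log (4 * C1) + (2 * h) * (L + 2 * (κ * η))) (σ := 2 * h * s)
    (M := Real.log (24 * C1) + 2 * (2 * h) * (κ * η)) (y₁ := y₁) hη hη1 (by
      have : 0 ≤ 2 * (2 * (h : ℝ)) * (κ * η) := by positivity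
      linarith) (by
      intro x y hy
      refine (norm_bil_le hω _).trans ?_
      have := hB (2 * h) x y hy
      rw [show Real.log (4 * C1) + (2 * h) * (L + 2 * (κ * η)) + 2 * h * s * (y - y₀) =
        Real.log (4 * C1) + ((2 * h : ℕ) : ℝ) * (L + 2 * (κ * η) + s * (y - y₀)) by
          push_cast; ring, Real.exp_add, Real.exp_log (by positivity)]
      linarith) (by
      push_cast at hmean
      linarith) hy1 hy2
  have hyη : |y - y₀| ≤ η := by
    rw [abs_le]; constructor <;> linarith [hyI.1, hyI.2]
  set l := L + s * (y - y₀) with hl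
  have hsy : |s * (y - y₀)| ≤ g / 8 := by
    rw [abs_mul]
    exact (mul_le_mul_of_nonneg_left hyη (abs_nonneg s)).trans hs
  have hl' : L - g / 8 ≤ l := by linarith [(abs_le.1 hsy).1]
  set Γ := l - 51 * κ with hΓ
  have hBl : ∀ (n : ℕ) (x : ℝ), ‖iterC A β n (x + y * Complex.I)‖ ≤
      C1 * Real.exp (n * (l + 2 * (κ * η))) := fun n x => by
    have := hB n x y hyη
    rwa [show L + 2 * (κ * η) + s * (y - y₀) = l + 2 * (κ * η) by rw [hl]; ring] at this
  have hZ : ∀ z : ℂ, z.im = y → ∃ x : ℝ, z = x + y * Complex.I := fun z hz =>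
    ⟨z.re, by rw [← hz]; exact (Complex.re_add_im z).symm⟩
  set K := C1 ^ 2 * Real.exp (h * (l + 2 * (κ * η))) with hK
  set K' := C1 * Real.exp (h * |l + 2 * (κ * η)|) with hK'
  have key := fun (n : ℕ) (hn : 2 * h ≤ n) (x : ℝ) => avalanche (A := A) (β := β) hω
    (Z := {z | z.im = y}) (h := h) (ρ := Real.exp (h * Γ)) (K := K) (K' := K')
    (d := C2 * Real.exp (h * (2 * la + 4 * π * (|y₀| + η) + κ)))
    (by intro z hz; simpa using hz) hh1 (Real.exp_pos _) (by positivity) (by positivity)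
    (by
      intro z hz z' hz' r hr
      obtain ⟨x, rfl⟩ := hZ z hz
      obtain ⟨x', rfl⟩ := hZ z' hz'
      calc _ ≤ (C1 * Real.exp (r * (l + 2 * (κ * η)))) *
            (C1 * Real.exp ((h - r : ℕ) * (l + 2 * (κ * η)))) := by
              gcongr
              · exact hBl _ _
              · exact hBl _ _
        _ = K := by
          rw [hK, Nat.cast_sub hr, mul_mul_mul_comm, ← Real.exp_add]
          ring_nf)
    (by
      intro z hz r hr
      obtain ⟨x, rfl⟩ := hZ z hz
      refine (hBl r x).trans ?_
      rw [hK']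
      have : (r : ℝ) ≤ h := by exact_mod_cast hr
      have e8 : (r : ℝ) * (l + 2 * (κ * η)) ≤ h * |l + 2 * (κ * η)| :=
        (mul_le_mul_of_nonneg_left (le_abs_self _) (Nat.cast_nonneg r)).trans
          (mul_le_mul_of_nonneg_right this (abs_nonneg _))
      gcongr)
    (by
      intro z hz
      obtain ⟨x, rfl⟩ := hZ z hz
      refine (hBl h x).trans ?_
      rw [hK]
      gcongr
      nlinarith)
    (by
      intro z hz
      obtain ⟨x, rfl⟩ := hZ z hz
      refine le_trans ?_ (hline x)
      have e1 : 8 * Real.exp (h * Γ) * K =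
          Real.exp (Real.log (8 * C1 ^ 2) + h * Γ + h * (l + 2 * (κ * η))) := by
        rw [Real.exp_add, Real.exp_add, Real.exp_log (by positivity), hK]; ring
      rw [e1, Real.exp_le_exp]
      have e2 : 12 * (Real.log (24 * C1) + 2 * (2 * h) * (κ * η)) / η = C4 + 48 * (h * κ) := by
        rw [hC4]; field_simp; ring
      rw [e2, hΓ, hl]
      have : 0 ≤ (h : ℝ) * (κ * η) := by positivity
      have e3 : (h : ℝ) * (κ * η) ≤ h * κ := by
        gcongr; nlinarith
      have e4 : 0 ≤ (h : ℝ) * κ := by positivity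
      linarith)
    (by
      intro z hz
      obtain ⟨x, rfl⟩ := hZ z hz
      exact hD h x y hyη)
    (by
      have e1 : 2 * (C2 * Real.exp (h * (2 * la + 4 * π * (|y₀| + η) + κ))) =
          Real.exp (Real.log (2 * C2) + h * (2 * la + 4 * π * (|y₀| + η) + κ)) := by
        rw [Real.exp_add, Real.exp_log (by positivity)]; ring
      rw [e1, ← Real.exp_nat_mul, Real.exp_le_exp]
      have e2 : (g + (2 * la + 4 * π * (|y₀| + η) + κ)) ≤ 2 * Γ := by
        rw [hΓ]; linarith
      have e3 : (h : ℝ) * (g + (2 * la + 4 * π * (|y₀| + η) + κ)) ≤ h * (2 * Γ) := by gcongr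
      push_cast
      linarith) hn (z := x + y * Complex.I) (by simp)
  refine ⟨y, hyI, 4 * K / K' * Real.exp (-(h * |Γ|)), by positivity, 2 * h, fun n hn x => ?_⟩
  refine le_trans ?_ (key n hn x)
  rw [mul_assoc, ← Real.exp_add, ← Real.exp_nat_mul]
  gcongr
  have e5 : (n : ℝ) = (n % h : ℕ) + h * (n / h : ℕ) := by exact_mod_cast (Nat.mod_add_div n h).symm
  have e6 : ((n % h : ℕ) : ℝ) ≤ h := by exact_mod_cast (Nat.mod_lt n hh1).le
  have e7 : ((n % h : ℕ) : ℝ) * Γ ≤ h * |Γ| := by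
    calc ((n % h : ℕ) : ℝ) * Γ ≤ ((n % h : ℕ) : ℝ) * |Γ| := by gcongr; exact le_abs_self _
      _ ≤ _ := by gcongr
  calc -(h * |Γ|) + n * Γ = -(h * |Γ|) + (n % h : ℕ) * Γ + (n / h : ℕ) * (h * Γ) := by
        conv_lhs => rw [e5]
        ring
    _ ≤ _ := by linarith

end TrigCocycle

lemma exists_ee_eq {w : ℂ} {y : ℝ} (hw : ‖w‖ = Real.exp (-(2 * π * y))) :
    ∃ x : ℝ, ee (x + y * Complex.I) = w := by
  have hw0 : w ≠ 0 := by rintro rfl; simp at hw; exact absurd hw.symm (Real.exp_pos _).ne'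
  set u := Complex.log w / (2 * π * Complex.I) with hu
  have hpi : (2 * π * Complex.I : ℂ) ≠ 0 := by simp [Real.pi_ne_zero]
  have h1 : ee u = w := by
    rw [ee, hu, mul_div_cancel₀ _ hpi, Complex.exp_log hw0]
  have h2 : u.im = y := by
    have := norm_ee u
    rw [h1, hw, Real.exp_eq_exp] at this
    have hp := Real.pi_pos
    nlinarith
  exact ⟨u.re, by rw [← h2, Complex.re_add_im, h1]⟩

lemma rootCount_eq_of_isTrig {n : ℕ} {F G : ℂ → ℂ} {P Q : Polynomial ℂ} {y : ℝ}
    (hF : IsTrig n F P) (hG : IsTrig n G Q)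
    (h : ∀ x : ℝ, ‖F (x + y * Complex.I) - G (x + y * Complex.I)‖ < ‖G (x + y * Complex.I)‖) :
    rootCount P (Real.exp (-(2 * π * y))) = rootCount Q (Real.exp (-(2 * π * y))) := by
  apply rootCount_eq_of_norm_sub_lt (Real.exp_pos _)
  intro w hw
  obtain ⟨x, rfl⟩ := exists_ee_eq hw
  rw [← hF, ← hG, ← sub_mul, norm_mul, norm_mul]
  have : 0 < ‖ee (x + y * Complex.I) ^ n‖ := norm_pos_iff.2 (pow_ne_zero _ (ee_ne_zero _))
  exact mul_lt_mul_of_pos_right (h x) this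

lemma rootCount_shift {p : Polynomial ℂ} (hp : p ≠ 0) (β : ℝ) (n : ℕ) (R : ℝ) :
    rootCount (Polynomial.C ((ee β ^ n)⁻¹) * p.comp (Polynomial.C (ee β) * Polynomial.X)) R =
      rootCount p R := by
  rw [rootCount_mul (IsTrig.comp_add_ne_zero hp _ n), rootCount_comp_C_mul_X p (norm_ee_ofReal β)]
  simp [rootCount]

/-- The Dodgson-type identity for the entries of a cocycle. -/
lemma bil_dodgson (ω : ℂ) (P M Q : Mat) :
    bil ω (P * M * Q) * bil ω M - bil ω (M * Q) * bil ω (P * M) =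
      M.det * ((P 0 0 + ω ^ 2 * P 1 0) * ω ^ 2 - (P 0 1 + ω ^ 2 * P 1 1)) *
        ((Q 0 0 + ω * Q 0 1) * ω - (Q 1 0 + ω * Q 1 1)) := by
  simp only [bil, Matrix.det_fin_two, Matrix.mul_apply, Fin.sum_univ_two]
  ring

lemma norm_bil_dodgson_le {ω : ℂ} (hω : ‖ω‖ = 1) (P M Q : Mat) :
    ‖bil ω (P * M * Q) * bil ω M - bil ω (M * Q) * bil ω (P * M)‖ ≤
      16 * ‖P‖ * ‖Q‖ * ‖M.det‖ := by
  rw [bil_dodgson, norm_mul, norm_mul]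
  have h1 : ‖(P 0 0 + ω ^ 2 * P 1 0) * ω ^ 2 - (P 0 1 + ω ^ 2 * P 1 1)‖ ≤ 4 * ‖P‖ := by
    refine (norm_sub_le _ _).trans ?_
    have h1 := norm_add_le (P 0 0) (ω ^ 2 * P 1 0)
    have h2 := norm_add_le (P 0 1) (ω ^ 2 * P 1 1)
    simp only [norm_mul, norm_pow, hω, one_pow, one_mul, mul_one] at *
    linarith [norm_entry_le P 0 0, norm_entry_le P 0 1, norm_entry_le P 1 0, norm_entry_le P 1 1]
  have h2 : ‖(Q 0 0 + ω * Q 0 1) * ω - (Q 1 0 + ω * Q 1 1)‖ ≤ 4 * ‖Q‖ := by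
    refine (norm_sub_le _ _).trans ?_
    have h1 := norm_add_le (Q 0 0) (ω * Q 0 1)
    have h2 := norm_add_le (Q 1 0) (ω * Q 1 1)
    simp only [norm_mul, hω, one_mul, mul_one] at *
    linarith [norm_entry_le Q 0 0, norm_entry_le Q 0 1, norm_entry_le Q 1 0, norm_entry_le Q 1 1]
  calc _ ≤ ‖M.det‖ * (4 * ‖P‖) * (4 * ‖Q‖) := by gcongr
    _ = _ := by ring

lemma affine_of_second_difference {w : ℕ → ℤ} {N : ℕ}
    (h : ∀ n ≥ N, w (n + 2) + w n = 2 * w (n + 1)) : ∃ w0 k : ℤ, ∀ n ≥ N, w n = w0 + k * n := by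
  refine ⟨w N - (w (N + 1) - w N) * N, w (N + 1) - w N, ?_⟩
  have key : ∀ m : ℕ, w (N + m) = w N + (w (N + 1) - w N) * m ∧
      w (N + m + 1) = w N + (w (N + 1) - w N) * (m + 1) := by
    intro m
    induction m with
    | zero => simp
    | succ m ih =>
      refine ⟨by push_cast; exact ih.2, ?_⟩
      have := h (N + m) (by omega)
      have e : w (N + (m + 1) + 1) = w (N + m + 2) := by congr 1
      rw [e]
      push_cast
      linarith [ih.1, ih.2]
  intro n hn
  obtain ⟨m, rfl⟩ := Nat.exists_eq_add_of_le hn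
  rw [(key m).1]
  push_cast; ring

/-- The growth rate is asymptotically at most `la + 2π|y|`. -/
def AsympRate (A : ℂ → Mat) (β la : ℝ) : Prop :=
  ∀ ε > 0, ∀ R : ℝ, ∃ Y ≥ R, rate A β Y < la + ε + 2 * π * Y ∧ rate A β (-Y) < la + ε + 2 * π * Y

namespace TrigCocycle
variable {A : ℂ → Mat} {β la : ℝ} (hA : TrigCocycle A β la)
include hA

lemma rootCount_affine {ω : ℂ} (hω : ‖ω‖ = 1) {y Γ c : ℝ} {n₁ : ℕ} (hΓ : la + 2 * π * |y| < Γ)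
    (hc : 0 < c) (hf : ∀ n ≥ n₁, ∀ x : ℝ, c * Real.exp (n * Γ) ≤
      ‖bil ω (iterC A β n (x + y * Complex.I))‖)
    {p : ℕ → Polynomial ℂ} (hp : ∀ n, IsTrig n (fun z => bil ω (iterC A β n z)) (p n)) :
    ∃ n₂ ≥ n₁, ∃ w0 k : ℤ, ∀ n ≥ n₂, p n ≠ 0 ∧
      (rootCount (p n) (Real.exp (-(2 * π * y))) : ℤ) = w0 + k * n := by
  have hp0 : ∀ n ≥ n₁, p n ≠ 0 := by
    intro n hn h0
    have h1 := hp n ((0 : ℝ) + y * Complex.I)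
    rw [h0, Polynomial.eval_zero] at h1
    have h2 : bil ω (iterC A β n ((0 : ℝ) + y * Complex.I)) = 0 :=
      (mul_eq_zero.1 h1).resolve_right (pow_ne_zero _ (ee_ne_zero _))
    have h3 := hf n hn 0
    rw [h2, norm_zero] at h3
    exact absurd h3 (not_le.2 (by positivity))
  set δ := Γ - (la + 2 * π * |y|) with hδ
  have hδ0 : 0 < δ := by linarith
  obtain ⟨C, hC, hD⟩ := hA.exists_det_le y hδ0
  set S := supLine (iterC A β 1) y with hS
  have hSpos : 0 < S := hA.supLine_pos 1 y
  have hSle : ∀ z : ℂ, z.im = y → ‖A z‖ ≤ S := by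
    intro z hz
    have := hA.norm_le_supLine 1 z.re y
    rwa [← hz, Complex.re_add_im, iterC_one, hz] at this
  obtain ⟨N, hN⟩ := exists_nat_ge
    ((Real.log (16 * S * S * C / c ^ 2) + |2 * Γ| + 1) / δ)
  rw [div_le_iff₀ hδ0] at hN
  have hrec : ∀ n ≥ max n₁ N,
      (rootCount (p (n + 2)) (Real.exp (-(2 * π * y))) : ℤ) +
        rootCount (p n) (Real.exp (-(2 * π * y))) =
      2 * rootCount (p (n + 1)) (Real.exp (-(2 * π * y))) := by
    intro n hn
    have hn1 : n₁ ≤ n := (le_max_left _ _).trans hn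
    have hn2 : N ≤ n := (le_max_right _ _).trans hn
    have t1 := (hp (n + 2)).mul ((hp n).comp_add (β : ℂ))
    have t2 := (hp (n + 1)).mul ((hp (n + 1)).comp_add (β : ℂ))
    rw [show n + 1 + (n + 1) = n + 2 + n by ring] at t2
    have hr := rootCount_eq_of_isTrig (y := y) t1 t2 (by
      intro x
      set z : ℂ := x + y * Complex.I with hz
      have hzim : z.im = y := by simp [hz]
      have e1 : iterC A β (n + 2) z = A (z + (n + 1 : ℕ) * β) * iterC A β n (z + β) * A z := by
        rw [show n + 2 = 1 + (n + 1) by ring, iterC_add, iterC_one, iterC, Matrix.mul_assoc]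
      have e2 : iterC A β (n + 1) (z + β) = A (z + (n + 1 : ℕ) * β) * iterC A β n (z + β) := by
        rw [show n + 1 = 1 + n by ring, iterC_add, iterC_one]
        congr 2; push_cast; ring
      have e3 : iterC A β (n + 1) z = iterC A β n (z + β) * A z := rfl
      have hlow : c ^ 2 * Real.exp (2 * (n + 1) * Γ) ≤
          ‖bil ω (iterC A β (n + 1) z) * bil ω (iterC A β (n + 1) (z + β))‖ := by
        rw [norm_mul]
        have l1 := hf (n + 1) (by omega) x
        have l2 := hf (n + 1) (by omega) (x + β)
        have e4 : ((x + β : ℝ) : ℂ) + y * Complex.I = z + β := by rw [hz]; push_cast; ring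
        rw [e4] at l2
        calc c ^ 2 * Real.exp (2 * (n + 1) * Γ) =
            (c * Real.exp ((n + 1 : ℕ) * Γ)) * (c * Real.exp ((n + 1 : ℕ) * Γ)) := by
              rw [mul_mul_mul_comm, ← Real.exp_add]; push_cast; ring_nf
          _ ≤ _ := by gcongr
      refine lt_of_le_of_lt (b := 16 * S * S * (C * Real.exp (n * (2 * la + 4 * π * |y| + δ))))
        ?_ (lt_of_lt_of_le ?_ hlow)
      · simp only [e1, e2, e3]
        refine (norm_bil_dodgson_le hω _ _ _).trans ?_
        have d1 := hD n (x + β)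
        have e4 : ((x + β : ℝ) : ℂ) + y * Complex.I = z + β := by rw [hz]; push_cast; ring
        rw [e4] at d1
        gcongr
        · apply hSle; simpa using hzim
        · exact hSle z hzim
      · have hpos : 0 < 16 * S * S * C / c ^ 2 := by positivity
        have e5 : 16 * S * S * (C * Real.exp (n * (2 * la + 4 * π * |y| + δ))) =
            c ^ 2 * Real.exp (Real.log (16 * S * S * C / c ^ 2) +
              n * (2 * la + 4 * π * |y| + δ)) := by
          rw [Real.exp_add, Real.exp_log hpos]; field_simp
        rw [e5]
        have hnN : (N : ℝ) ≤ n := by exact_mod_cast hn2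
        have e6 : (N : ℝ) * δ ≤ n * δ := by gcongr
        have e7 := neg_abs_le (2 * Γ)
        have e8 : (n : ℝ) * (2 * la + 4 * π * |y| + δ) = n * (2 * Γ) - n * δ := by
          rw [hδ]; ring
        gcongr
        linarith)
    have hne1 := mul_ne_zero (hp0 (n + 2) (by omega))
      (IsTrig.comp_add_ne_zero (hp0 n (by omega)) (β : ℂ) n)
    have hne2 := mul_ne_zero (hp0 (n + 1) (by omega))
      (IsTrig.comp_add_ne_zero (hp0 (n + 1) (by omega)) (β : ℂ) (n + 1))
    rw [rootCount_mul hne1, rootCount_mul hne2, rootCount_shift (hp0 n (by omega)),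
      rootCount_shift (hp0 (n + 1) (by omega))] at hr
    zify at hr
    linarith
  obtain ⟨w0, k, hw⟩ := affine_of_second_difference
    (w := fun n => (rootCount (p n) (Real.exp (-(2 * π * y))) : ℤ)) hrec
  exact ⟨max n₁ N, le_max_left _ _, w0, k, fun n hn =>
    ⟨hp0 n ((le_max_left _ _).trans hn), hw n hn⟩⟩

lemma rate_ge_of_rootCount {ω : ℂ} (hω : ‖ω‖ = 1) {y Γ c : ℝ} {n₁ : ℕ} (hc : 0 < c)
    (hf : ∀ n ≥ n₁, ∀ x : ℝ, c * Real.exp (n * Γ) ≤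
      ‖bil ω (iterC A β n (x + y * Complex.I))‖)
    {p : ℕ → Polynomial ℂ} (hp : ∀ n, IsTrig n (fun z => bil ω (iterC A β n z)) (p n))
    {w0 k : ℤ} (hw : ∀ n ≥ n₁, p n ≠ 0 ∧
      (rootCount (p n) (Real.exp (-(2 * π * y))) : ℤ) = w0 + k * n) (Y : ℝ) :
    Γ + 2 * π * (1 - k) * (Y - y) ≤ rate A β Y := by
  have key : ∀ᶠ n : ℕ in atTop, Real.log c / n + Γ + 2 * π * (1 - k) * (Y - y)
      - (2 * π * w0 * (Y - y)) / n ≤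
      Real.log 4 / n + Real.log (supLine (iterC A β n) Y) / n := by
    filter_upwards [eventually_ge_atTop n₁, eventually_gt_atTop 0] with n hn hn0
    have hn' : (0 : ℝ) < n := by exact_mod_cast hn0
    obtain ⟨hp0, hr⟩ := hw n hn
    have h1 := (hp n).lineMean_ge hp0 Y y
    have hr' : (rootCount (p n) (Real.exp (-(2 * π * y))) : ℝ) = w0 + k * n := by
      exact_mod_cast hr
    rw [hr'] at h1
    have h2 : lineMean (fun z => bil ω (iterC A β n z)) Y ≤
        Real.log (4 * supLine (iterC A β n) Y) := by
      apply (hp n).lineMean_le hp0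
      intro x
      rw [Real.exp_log (mul_pos (by norm_num) (hA.supLine_pos n Y))]
      exact (norm_bil_le hω _).trans (by linarith [hA.norm_le_supLine n x Y])
    have h3 : Real.log (c * Real.exp (n * Γ)) ≤ lineMean (fun z => bil ω (iterC A β n z)) y := by
      unfold lineMean
      have : Real.log (c * Real.exp (n * Γ)) =
          ∫ x in (0 : ℝ)..1, Real.log (c * Real.exp (n * Γ)) := by simp
      rw [this]
      apply intervalIntegral.integral_mono_on zero_le_one (by simp)
        ((hp n).intervalIntegrable hp0 y)
      intro x _
      exact Real.log_le_log (by positivity) (hf n hn x)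
    rw [Real.log_mul (by norm_num) (hA.supLine_pos n Y).ne'] at h2
    rw [Real.log_mul hc.ne' (Real.exp_pos _).ne', Real.log_exp] at h3
    rw [← add_div]
    rw [le_div_iff₀ hn']
    have : (Real.log c / n + Γ + 2 * π * (1 - k) * (Y - y) - (2 * π * w0 * (Y - y)) / n) * n =
        Real.log c + n * Γ + 2 * π * (n - (w0 + k * n)) * (Y - y) := by
      field_simp; ring
    rw [this]
    linarith
  have t0 : ∀ a : ℝ, Tendsto (fun n : ℕ => a / n) atTop (nhds 0) := fun a =>
    tendsto_const_div_atTop_nhds_zero_nat a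
  have tl : Tendsto (fun n : ℕ => Real.log c / n + Γ + 2 * π * (1 - k) * (Y - y)
      - (2 * π * w0 * (Y - y)) / n) atTop (nhds (Γ + 2 * π * (1 - k) * (Y - y))) := by
    have := (((t0 (Real.log c)).add_const Γ).add_const (2 * π * (1 - k) * (Y - y))).sub
      (t0 (2 * π * w0 * (Y - y)))
    simpa using this
  have tr : Tendsto (fun n : ℕ => Real.log 4 / n + Real.log (supLine (iterC A β n) Y) / n) atTop
      (nhds (rate A β Y)) := by
    simpa using (t0 (Real.log 4)).add (hA.tendsto_rate Y)
  exact le_of_tendsto_of_tendsto tl tr key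

lemma rootCount_slope (has : AsympRate A β la) {ω : ℂ} (hω : ‖ω‖ = 1) {y Γ c : ℝ} {n₁ : ℕ}
    (hΓ : la + 2 * π * |y| < Γ) (hc : 0 < c)
    (hf : ∀ n ≥ n₁, ∀ x : ℝ, c * Real.exp (n * Γ) ≤
      ‖bil ω (iterC A β n (x + y * Complex.I))‖)
    {p : ℕ → Polynomial ℂ} (hp : ∀ n, IsTrig n (fun z => bil ω (iterC A β n z)) (p n)) :
    (∃ n₂ ≥ n₁, ∃ w0 : ℤ, ∀ n ≥ n₂, p n ≠ 0 ∧
      (rootCount (p n) (Real.exp (-(2 * π * y))) : ℤ) = w0 + n) ∧ ∀ Y, Γ ≤ rate A β Y := by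
  obtain ⟨n₂, hn₂, w0, k, hw⟩ := hA.rootCount_affine hω hΓ hc hf hp
  have hge := hA.rate_ge_of_rootCount hω hc (fun n hn => hf n (hn₂.trans hn)) hp hw
  obtain ⟨Y, hY, hY1, hY2⟩ := has (Γ - (la + 2 * π * |y|)) (by linarith) |y|
  have hy1 := le_abs_self y
  have hy2 := neg_abs_le y
  have hpi := Real.pi_pos
  have hk : k = 1 := by
    rcases lt_trichotomy k 1 with h | h | h
    · exfalso
      have h1 : (k : ℝ) ≤ 0 := by exact_mod_cast Int.lt_add_one_iff.1 h
      have h2 := hge Y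
      have : 2 * π * 1 * (Y - y) ≤ 2 * π * (1 - k) * (Y - y) := by
        have : 0 ≤ Y - y := by linarith
        gcongr; linarith
      nlinarith
    · exact h
    · exfalso
      have h1 : (2 : ℝ) ≤ k := by exact_mod_cast h
      have h2 := hge (-Y)
      have : 2 * π * 1 * (Y + y) ≤ 2 * π * (k - 1) * (Y + y) := by
        have : 0 ≤ Y + y := by linarith
        gcongr; linarith
      nlinarith
  subst hk
  refine ⟨⟨n₂, hn₂, w0, fun n hn => ?_⟩, fun Y => ?_⟩
  · simpa using hw n hn
  · simpa using hge Y

end TrigCocycle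

namespace TrigCocycle
variable {A : ℂ → Mat} {β la : ℝ} (hA : TrigCocycle A β la)
include hA

lemma rate_ge_of_hasDerivAt (has : AsympRate A β la) {y₀ s g : ℝ} (hg : 0 < g)
    (hgap : la + 2 * π * |y₀| + g ≤ rate A β y₀) (hd : HasDerivAt (rate A β) s y₀) (Y : ℝ) :
    rate A β y₀ ≤ rate A β Y := by
  have hpi := Real.pi_pos
  apply le_of_forall_pos_le_add
  intro ε hε
  set κ := min (g / 8 / 51) (ε / 2 / 51) with hκ
  have hκ0 : 0 < κ := by rw [hκ]; positivity
  have hκ1 : 51 * κ ≤ g / 8 := by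
    have := min_le_left (g / 8 / 51) (ε / 2 / 51)
    linarith
  have hκ2 : 51 * κ ≤ ε / 2 := by
    have := min_le_right (g / 8 / 51) (ε / 2 / 51)
    linarith
  have hlo := hd.hasFDerivAt.isLittleO
  have hev := hlo.def hκ0
  rw [Metric.eventually_nhds_iff] at hev
  obtain ⟨r, hr, hev⟩ := hev
  set η := min (min (r / 2) 1) (min (min (g / 8 / (|s| + 1)) (ε / 2 / (|s| + 1)))
    (g / 8 / (2 * π))) with hη
  have hη0 : 0 < η := by rw [hη]; positivity
  have e1 : η ≤ r / 2 := (min_le_left _ _).trans (min_le_left _ _)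
  have e2 : η ≤ 1 := (min_le_left _ _).trans (min_le_right _ _)
  have e3 : η ≤ g / 8 / (|s| + 1) :=
    (min_le_right _ _).trans ((min_le_left _ _).trans (min_le_left _ _))
  have e4 : η ≤ ε / 2 / (|s| + 1) :=
    (min_le_right _ _).trans ((min_le_left _ _).trans (min_le_right _ _))
  have e5 : η ≤ g / 8 / (2 * π) := (min_le_right _ _).trans (min_le_right _ _)
  have hs0 := abs_nonneg s
  rw [le_div_iff₀ (by positivity)] at e3 e4 e5
  have hb : ∀ u : ℝ, |u| = η → |rate A β (y₀ + u) - rate A β y₀ - u * s| ≤ κ * η := by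
    intro u hu
    have := hev (y := y₀ + u) (by rw [Real.dist_eq]; simp [hu]; linarith)
    simpa [hu, Real.norm_eq_abs] using this
  have hbp := hb η (abs_of_pos hη0)
  have hbm := hb (-η) (by rw [abs_neg, abs_of_pos hη0])
  rw [abs_le] at hbp hbm
  rw [← sub_eq_add_neg] at hbm
  obtain ⟨ω, hω, hgl⟩ := hA.good_lines hη0 e2 hκ0 hg hgap (s := s) (by nlinarith) (by linarith)
    hκ1 (by linarith [hbp.2]) (by linarith [hbm.2])
  obtain ⟨y, hy, c, hc, n₁, hf⟩ := hgl (y₀ - η / 4) le_rfl (by linarith)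
  choose p hp using fun n => hA.bil_trig n ω
  have hyy : |y - y₀| ≤ η := by rw [abs_le]; constructor <;> linarith [hy.1, hy.2]
  have hsy : |s * (y - y₀)| ≤ |s| * η := by rw [abs_mul]; gcongr
  have hsy' := (abs_le.1 hsy).1
  have hya : |y| ≤ |y₀| + η := by
    have := abs_sub_abs_le_abs_sub y y₀
    linarith
  have := (hA.rootCount_slope has hω (by nlinarith) hc hf hp).2 Y
  nlinarith

lemma rate_const (has : AsympRate A β la) (h0 : la < rate A β 0) :
    ∃ t > 0, ∀ y, |y| < t → rate A β y = rate A β 0 := by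
  have hlip := hA.convexOn_rate.locallyLipschitz
  have hcont : Continuous (rate A β) := hlip.continuous
  obtain ⟨K, u, hu, hK⟩ := hlip 0
  set g := (rate A β 0 - la) / 2 with hg
  have hg0 : 0 < g := by rw [hg]; linarith
  have hopen : {y : ℝ | la + 2 * π * |y| + g < rate A β y} ∈ nhds (0 : ℝ) := by
    apply (isOpen_lt (by fun_prop) hcont).mem_nhds
    simp only [Set.mem_ofPred_eq, abs_zero]
    rw [hg]; linarith
  obtain ⟨t, ht, hball⟩ := Metric.mem_nhds_iff.1 (inter_mem hu hopen)
  rw [Real.ball_eq_Ioo, zero_sub, zero_add] at hball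
  have hae := (hK.mono (hball.trans Set.inter_subset_left)).ae_differentiableWithinAt_of_mem_real
  have hdense := Measure.dense_of_ae hae
  have key : ∀ y ∈ Set.Ioo (-t) t, ∀ Y, rate A β y ≤ rate A β Y := by
    intro y hy Y
    by_contra! hlt
    obtain ⟨y', hy'1, hy'2⟩ := hdense.inter_open_nonempty
      (Set.Ioo (-t) t ∩ {y | rate A β Y < rate A β y})
      (isOpen_Ioo.inter (isOpen_lt continuous_const hcont)) ⟨y, hy, hlt⟩
    have hd := (hy'2 hy'1.1).differentiableAt (isOpen_Ioo.mem_nhds hy'1.1)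
    have := hA.rate_ge_of_hasDerivAt has hg0 (hball hy'1.1).2.le hd.hasDerivAt Y
    exact absurd hy'1.2 (not_lt.2 this)
  refine ⟨t, ht, fun y hy => le_antisymm (key y (abs_lt.1 hy) 0) (key 0 ⟨by linarith, ht⟩ y)⟩

/-- The exponential lower bounds on two lines around the real axis, with a number of zeros
between them that does not depend on the number of iterates. -/
lemma exists_annulus (has : AsympRate A β la) (h0 : la < rate A β 0) {ε : ℝ} (hε : 0 < ε) :
    ∃ (ω : ℂ) (ym yp c : ℝ) (n₁ m : ℕ) (p : ℕ → Polynomial ℂ), ‖ω‖ = 1 ∧ ym < 0 ∧ 0 < yp ∧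
      0 < c ∧ (∀ n, IsTrig n (fun z => bil ω (iterC A β n z)) (p n)) ∧
      ∀ n ≥ n₁, p n ≠ 0 ∧
        (∀ x : ℝ, c * Real.exp (n * (rate A β 0 - ε)) ≤
          ‖bil ω (iterC A β n (x + ym * Complex.I))‖) ∧
        (∀ x : ℝ, c * Real.exp (n * (rate A β 0 - ε)) ≤
          ‖bil ω (iterC A β n (x + yp * Complex.I))‖) ∧
        rootCount (p n) (Real.exp (-(2 * π * ym))) =
          rootCount (p n) (Real.exp (-(2 * π * yp))) + m := by
  have hpi := Real.pi_pos
  obtain ⟨t, ht, hconst⟩ := hA.rate_const has h0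
  set g := rate A β 0 - la with hg
  have hg0 : 0 < g := by linarith
  set κ := min (g / 8 / 51) (ε / 51) with hκ
  have hκ0 : 0 < κ := by rw [hκ]; positivity
  have hκ1 : 51 * κ ≤ g / 8 := by
    have := min_le_left (g / 8 / 51) (ε / 51)
    linarith
  have hκ2 : 51 * κ ≤ ε := by
    have := min_le_right (g / 8 / 51) (ε / 51)
    linarith
  set η := min (min (t / 2) 1) (g / 8 / (2 * π)) with hη
  have hη0 : 0 < η := by rw [hη]; positivity
  have e1 : η ≤ t / 2 := (min_le_left _ _).trans (min_le_left _ _)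
  have e2 : η ≤ 1 := (min_le_left _ _).trans (min_le_right _ _)
  have e5 : η ≤ g / 8 / (2 * π) := min_le_right _ _
  rw [le_div_iff₀ (by positivity)] at e5
  have hκη : 0 < κ * η := mul_pos hκ0 hη0
  obtain ⟨ω, hω, hgl⟩ := hA.good_lines (y₀ := 0) hη0 e2 hκ0 hg0 (by simp [hg]) (s := 0)
    (by simp; positivity) (by linarith) hκ1
    (by rw [hconst (0 + η) (by rw [zero_add, abs_of_pos hη0]; linarith)]; linarith)
    (by rw [hconst (0 - η) (by rw [zero_sub, abs_neg, abs_of_pos hη0]; linarith)]; linarith)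
  obtain ⟨ym, hym, c1, hc1, n1, hf1⟩ := hgl (0 - η / 4) le_rfl (by linarith)
  obtain ⟨yp, hyp, c2, hc2, n2, hf2⟩ := hgl (0 + η / 8) (by linarith) (by linarith)
  simp only [zero_mul, add_zero] at hf1 hf2
  choose p hp using fun n => hA.bil_trig n ω
  have gap : ∀ y : ℝ, |y| ≤ η → la + 2 * π * |y| < rate A β 0 - 51 * κ := by
    intro y hy
    have : 2 * π * |y| ≤ 2 * π * η := by gcongr
    linarith
  obtain ⟨⟨m1, hm1, w1, hw1⟩, -⟩ := hA.rootCount_slope has hω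
    (gap ym (by rw [abs_le]; constructor <;> linarith [hym.1, hym.2])) hc1 hf1 hp
  obtain ⟨⟨m2, hm2, w2, hw2⟩, -⟩ := hA.rootCount_slope has hω
    (gap yp (by rw [abs_le]; constructor <;> linarith [hyp.1, hyp.2])) hc2 hf2 hp
  have hle : w2 ≤ w1 := by
    have a := (hw1 (max m1 m2) (le_max_left _ _)).2
    have b := (hw2 (max m1 m2) (le_max_right _ _)).2
    have : rootCount (p (max m1 m2)) (Real.exp (-(2 * π * yp))) ≤
        rootCount (p (max m1 m2)) (Real.exp (-(2 * π * ym))) := by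
      unfold rootCount
      apply Multiset.card_le_card
      apply Multiset.monotone_filter_right
      intro ζ hζ
      refine lt_of_lt_of_le hζ (Real.exp_le_exp.2 ?_)
      nlinarith [hyp.1, hym.2]
    zify at this
    linarith
  refine ⟨ω, ym, yp, min c1 c2, max m1 m2, (w1 - w2).toNat, p, hω, by linarith [hym.2],
    by linarith [hyp.1], lt_min hc1 hc2, hp, fun n hn => ?_⟩
  have hn1 : m1 ≤ n := (le_max_left _ _).trans hn
  have hn2 : m2 ≤ n := (le_max_right _ _).trans hn
  have hexp : Real.exp (n * (rate A β 0 - ε)) ≤ Real.exp (n * (rate A β 0 - 51 * κ)) := by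
    gcongr
  refine ⟨(hw1 n hn1).1, fun x => ?_, fun x => ?_, ?_⟩
  · refine le_trans ?_ (hf1 n (hm1.trans hn1) x)
    gcongr
    exact min_le_left _ _
  · refine le_trans ?_ (hf2 n (hm2.trans hn2) x)
    gcongr
    exact min_le_right _ _
  · have a := (hw1 n hn1).2
    have b := (hw2 n hn2).2
    zify
    rw [a, b, Int.toNat_of_nonneg (by linarith)]
    ring

end TrigCocycle

lemma prod_norm_sub_le (s : Multiset ℂ) {W : ℂ} {R : ℝ} (hW : ‖W‖ ≤ R) (hs : ∀ ζ ∈ s, ‖ζ‖ ≤ R) :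
    (s.map fun ζ => ‖W - ζ‖).prod ≤ (2 * R) ^ s.card := by
  induction s using Multiset.induction with
  | empty => simp
  | cons a s ih =>
    rw [Multiset.map_cons, Multiset.prod_cons, Multiset.card_cons, pow_succ']
    have h1 : ‖W - a‖ ≤ 2 * R := (norm_sub_le _ _).trans (by
      linarith [hs a (Multiset.mem_cons_self a s)])
    have h2 := ih fun ζ hζ => hs ζ (Multiset.mem_cons_of_mem hζ)
    have h3 : 0 ≤ (s.map fun ζ => ‖W - ζ‖).prod :=
      Multiset.prod_nonneg fun x hx => by
        obtain ⟨ζ, -, rfl⟩ := Multiset.mem_map.1 hx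
        exact norm_nonneg _
    exact mul_le_mul h1 h2 h3 ((norm_nonneg _).trans h1)

lemma norm_eval_multiset_prod (s : Multiset ℂ) (W : ℂ) :
    ‖((s.map fun ζ => Polynomial.X - Polynomial.C ζ).prod).eval W‖ =
      (s.map fun ζ => ‖W - ζ‖).prod := by
  induction s using Multiset.induction with
  | empty => simp
  | cons a s ih => simp [ih]

/-- Lower bound for a polynomial on the unit circle in terms of lower bounds on two circles around
it and the zeros in between. -/
lemma exists_prod_le_norm_eval {p : Polynomial ℂ} (hp : p ≠ 0) {n m : ℕ} {R₁ R₂ a : ℝ}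
    (h1 : R₁ < 1) (h2 : 1 < R₂) (ha : 0 < a)
    (hb1 : ∀ W : ℂ, ‖W‖ = R₁ → a * ‖W‖ ^ n ≤ ‖p.eval W‖)
    (hb2 : ∀ W : ℂ, ‖W‖ = R₂ → a * ‖W‖ ^ n ≤ ‖p.eval W‖)
    (hcount : rootCount p R₂ = rootCount p R₁ + m) :
    ∃ s : Multiset ℂ, s.card = m ∧ ∀ W : ℂ, ‖W‖ = 1 →
      a * (s.map fun ζ => ‖W - ζ‖).prod ≤ (2 * R₂) ^ m * ‖p.eval W‖ := by
  classical
  set s := p.roots.filter (fun ζ => ‖ζ‖ < R₂ ∧ ¬ ‖ζ‖ < R₁) with hs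
  set u := p.roots.filter (fun ζ => ¬ (‖ζ‖ < R₂ ∧ ¬ ‖ζ‖ < R₁)) with hu
  have hsu : s + u = p.roots := Multiset.filter_add_not _ _
  have hcard : s.card = m := by
    have e1 := Multiset.filter_add_not (fun ζ : ℂ => ‖ζ‖ < R₁) (p.roots.filter fun ζ => ‖ζ‖ < R₂)
    rw [Multiset.filter_filter, Multiset.filter_filter] at e1
    have e2 := congrArg Multiset.card e1
    rw [Multiset.card_add] at e2
    have e3 : (p.roots.filter fun ζ => ‖ζ‖ < R₁ ∧ ‖ζ‖ < R₂) = p.roots.filter fun ζ => ‖ζ‖ < R₁ :=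
      Multiset.filter_congr fun ζ _ => ⟨fun h => h.1, fun h => ⟨h, by linarith⟩⟩
    have e4 : (p.roots.filter fun ζ => ¬ ‖ζ‖ < R₁ ∧ ‖ζ‖ < R₂) = s :=
      Multiset.filter_congr fun ζ _ => and_comm
    rw [e3, e4] at e2
    unfold rootCount at hcount
    omega
  set q : Polynomial ℂ := Polynomial.C p.leadingCoeff *
    (u.map fun ζ => Polynomial.X - Polynomial.C ζ).prod with hq
  have hpq : ∀ W : ℂ, ‖p.eval W‖ = ‖q.eval W‖ * (s.map fun ζ => ‖W - ζ‖).prod := by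
    intro W
    have : p = q * (s.map fun ζ => Polynomial.X - Polynomial.C ζ).prod := by
      have e := Polynomial.C_leadingCoeff_mul_prod_multiset_X_sub_C (p := p)
        IsAlgClosed.card_roots_eq_natDegree
      rw [← hsu, Multiset.map_add, Multiset.prod_add] at e
      rw [hq]
      calc p = _ := e.symm
        _ = _ := by ring
    conv_lhs => rw [this]
    rw [Polynomial.eval_mul, norm_mul, norm_eval_multiset_prod]
  have hq0 : ∀ W : ℂ, R₁ ≤ ‖W‖ → ‖W‖ ≤ R₂ → q.eval W ≠ 0 := by
    intro W w1 w2 h0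
    rw [hq, Polynomial.eval_mul, Polynomial.eval_C, mul_eq_zero] at h0
    have h3 := h0.resolve_left (Polynomial.leadingCoeff_ne_zero.2 hp)
    rw [← norm_eq_zero, norm_eval_multiset_prod, Multiset.prod_eq_zero_iff, Multiset.mem_map] at h3
    obtain ⟨ζ, hζ, hW⟩ := h3
    rw [norm_eq_zero, sub_eq_zero] at hW
    subst hW
    rw [hu, Multiset.mem_filter] at hζ
    have hr : p.eval W = 0 := (Polynomial.mem_roots hp).1 hζ.1
    have h4 : ‖W‖ = R₂ := by
      by_contra hne
      exact hζ.2 ⟨lt_of_le_of_ne w2 hne, not_lt.2 w1⟩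
    have h5 := hb2 W h4
    rw [hr, norm_zero, h4] at h5
    have : 0 < a * R₂ ^ n := by positivity
    linarith
  refine ⟨s, hcard, fun W hW => ?_⟩
  set U : Set ℂ := {W | R₁ < ‖W‖ ∧ ‖W‖ < R₂} with hU
  have hUo : IsOpen U := (isOpen_lt continuous_const continuous_norm).inter
    (isOpen_lt continuous_norm continuous_const)
  have hUc : closure U ⊆ {W | R₁ ≤ ‖W‖ ∧ ‖W‖ ≤ R₂} :=
    closure_minimal (fun W hW => ⟨hW.1.le, hW.2.le⟩)
      ((isClosed_le continuous_const continuous_norm).inter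
        (isClosed_le continuous_norm continuous_const))
  have hUb : Bornology.IsBounded U :=
    (Metric.isBounded_ball (x := (0 : ℂ)) (r := R₂)).subset fun W hW => by
      simpa using hW.2
  have hdiff : DiffContOnCl ℂ (fun W => W ^ n / q.eval W) U := by
    apply DifferentiableOn.diffContOnCl
    intro W hW
    have := hUc hW
    exact ((differentiableAt_id.pow n).div q.differentiable.differentiableAt
      (hq0 W this.1 this.2)).differentiableWithinAt
  have hfr : ∀ W ∈ frontier U, ‖W ^ n / q.eval W‖ ≤ (2 * R₂) ^ m / a := by
    intro W hW
    have hc := hUc (frontier_subset_closure hW)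
    have hnot : W ∉ U := fun h => (hUo.inter_frontier_eq ▸ (⟨h, hW⟩ : W ∈ U ∩ frontier U) : W ∈ (∅ : Set ℂ))
    have hbd : a * ‖W‖ ^ n ≤ ‖p.eval W‖ := by
      rcases hc.1.lt_or_eq with h | h
      · rcases hc.2.lt_or_eq with h' | h'
        · exact absurd ⟨h, h'⟩ hnot
        · exact hb2 W h'
      · exact hb1 W h.symm
    have hqpos := norm_pos_iff.2 (hq0 W hc.1 hc.2)
    have hpr := prod_norm_sub_le s hc.2 (fun ζ hζ => (Multiset.mem_filter.1 hζ).2.1.le)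
    rw [hcard] at hpr
    rw [norm_div, norm_pow, div_le_div_iff₀ hqpos ha]
    rw [hpq W] at hbd
    calc ‖W‖ ^ n * a = a * ‖W‖ ^ n := mul_comm _ _
      _ ≤ _ := hbd
      _ ≤ ‖q.eval W‖ * (2 * R₂) ^ m := by gcongr
      _ = _ := mul_comm _ _
  have hWU : W ∈ closure U := subset_closure ⟨by linarith, by linarith⟩
  have hmax := Complex.norm_le_of_forall_mem_frontier_norm_le hUb hdiff hfr hWU
  have hqpos := norm_pos_iff.2 (hq0 W (by linarith) (by linarith))
  rw [norm_div, norm_pow, hW, one_pow, div_le_div_iff₀ hqpos ha, one_mul] at hmax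
  have h3 : 0 ≤ (s.map fun ζ => ‖W - ζ‖).prod :=
    Multiset.prod_nonneg fun x hx => by
      obtain ⟨ζ, -, rfl⟩ := Multiset.mem_map.1 hx
      exact norm_nonneg _
  rw [hpq W]
  nlinarith [mul_le_mul_of_nonneg_right hmax h3]

lemma exists_orbit_separation {β : ℝ} (hβ : Irrational β) (m : ℕ) :
    ∃ δ > 0, ∀ i : ℕ, 1 ≤ i → i ≤ m → 2 * δ ≤ ‖ee (i * β) - 1‖ := by
  induction m with
  | zero => exact ⟨1, one_pos, fun i h1 h2 => by omega⟩
  | succ m ih =>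
    obtain ⟨δ, hδ, h⟩ := ih
    have hne : ee ((m + 1 : ℕ) * β) ≠ 1 := by
      intro h1
      rw [ee, Complex.exp_eq_one_iff] at h1
      obtain ⟨k, hk⟩ := h1
      have hpi : (2 * π * Complex.I : ℂ) ≠ 0 := by simp [Real.pi_ne_zero]
      have h2 : ((m + 1 : ℕ) : ℂ) * β = k := by
        apply mul_left_cancel₀ hpi
        rw [hk]; ring
      have h3 : ((m + 1 : ℕ) : ℝ) * β = k := by exact_mod_cast h2
      exact (hβ.natCast_mul (Nat.succ_ne_zero m)).ne_int k h3
    have hpos : 0 < ‖ee ((m + 1 : ℕ) * β) - 1‖ := norm_pos_iff.2 (sub_ne_zero.2 hne)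
    refine ⟨min δ (‖ee ((m + 1 : ℕ) * β) - 1‖ / 2), by positivity, fun i h1 h2 => ?_⟩
    rcases Nat.lt_or_ge i (m + 1) with hi | hi
    · linarith [h i h1 (by omega), min_le_left δ (‖ee ((m + 1 : ℕ) * β) - 1‖ / 2)]
    · obtain rfl : i = m + 1 := by omega
      linarith [min_le_right δ (‖ee ((m + 1 : ℕ) * β) - 1‖ / 2)]

/-- Among `m + 1` consecutive orbit points, one stays away from any `m` given points. -/
lemma exists_orbit_avoids {β : ℝ} (hβ : Irrational β) (m : ℕ) :
    ∃ δ > 0, ∀ s : Multiset ℂ, s.card = m → ∀ x : ℝ, ∃ j ≤ m, ∀ ζ ∈ s,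
      δ ≤ ‖ee (x + j * β) - ζ‖ := by
  classical
  obtain ⟨δ, hδ, h⟩ := exists_orbit_separation hβ m
  refine ⟨δ, hδ, fun s hs x => ?_⟩
  by_contra! hcon
  have hcon' : ∀ j : ℕ, ∃ ζ, j ≤ m → ζ ∈ s ∧ ‖ee (x + j * β) - ζ‖ < δ := by
    intro j
    by_cases hj : j ≤ m
    · obtain ⟨ζ, h1, h2⟩ := hcon j hj
      exact ⟨ζ, fun _ => ⟨h1, h2⟩⟩
    · exact ⟨0, fun h => absurd h hj⟩
  choose z hz using hcon'
  obtain ⟨i, hi, j, hj, hij, hzz⟩ := Finset.exists_ne_map_eq_of_card_lt_of_maps_to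
    (s := Finset.range (m + 1)) (t := s.toFinset) (f := z)
    (by rw [Finset.card_range]; exact lt_of_le_of_lt (Multiset.toFinset_card_le s) (by omega))
    (fun j hj => by
      have := (hz j (by simpa using Nat.lt_succ_iff.1 (Finset.mem_range.1 hj))).1
      simpa using this)
  wlog hlt : i < j generalizing i j
  · exact this j hj i hi hij.symm hzz.symm (by omega)
  have hi' : i ≤ m := Nat.lt_succ_iff.1 (Finset.mem_range.1 hi)
  have hj' : j ≤ m := Nat.lt_succ_iff.1 (Finset.mem_range.1 hj)
  have d1 := (hz i hi').2
  have d2 := (hz j hj').2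
  rw [hzz] at d1
  have e : ee (x + j * β) - ee (x + i * β) = ee (x + i * β) * (ee ((j - i : ℕ) * β) - 1) := by
    rw [mul_sub, mul_one, ← ee_add, Nat.cast_sub hlt.le]
    congr 2; ring
  have h3 := h (j - i) (by omega) (by omega)
  have h4 : ‖ee (x + i * β)‖ = 1 := by
    have := norm_ee_ofReal (x + i * β)
    push_cast at this
    exact this
  have h5 : ‖ee (x + j * β) - ee (x + i * β)‖ = ‖ee ((j - i : ℕ) * β) - 1‖ := by
    rw [e, norm_mul, h4, one_mul]
  have h6 : ‖ee (x + j * β) - ee (x + i * β)‖ ≤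
      ‖ee (x + j * β) - z j‖ + ‖ee (x + i * β) - z j‖ := by
    have := norm_sub_le (ee (x + j * β) - z j) (ee (x + i * β) - z j)
    rwa [sub_sub_sub_cancel_right] at this
  linarith

lemma pow_le_prod_of_le {s : Multiset ℂ} {W : ℂ} {δ : ℝ} (hδ : 0 ≤ δ)
    (h : ∀ ζ ∈ s, δ ≤ ‖W - ζ‖) : δ ^ s.card ≤ (s.map fun ζ => ‖W - ζ‖).prod := by
  induction s using Multiset.induction with
  | empty => simp
  | cons a s ih =>
    rw [Multiset.map_cons, Multiset.prod_cons, Multiset.card_cons, pow_succ']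
    exact mul_le_mul (h a (Multiset.mem_cons_self a s))
      (ih fun ζ hζ => h ζ (Multiset.mem_cons_of_mem hζ)) (by positivity) (norm_nonneg _)

namespace TrigCocycle
variable {A : ℂ → Mat} {β la : ℝ} (hA : TrigCocycle A β la)
include hA

lemma exists_good_shift (has : AsympRate A β la) (h0 : la < rate A β 0) {ε : ℝ} (hε : 0 < ε) :
    ∃ (ω : ℂ) (c : ℝ) (n₁ m : ℕ), ‖ω‖ = 1 ∧ 0 < c ∧ ∀ n ≥ n₁, ∀ x : ℝ, ∃ j ≤ m,
      c * Real.exp (n * (rate A β 0 - ε)) ≤ ‖bil ω (iterC A β n (x + j * β))‖ := by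
  obtain ⟨ω, ym, yp, c, n₁, m, p, hω, hym, hyp, hc, hp, hn⟩ := hA.exists_annulus has h0 hε
  obtain ⟨δ, hδ, hav⟩ := exists_orbit_avoids hA.irr m
  set R₂ := Real.exp (-(2 * π * ym)) with hR₂
  have hpi := Real.pi_pos
  refine ⟨ω, c * δ ^ m / (2 * R₂) ^ m, n₁, m, hω, by positivity, fun n hnn x => ?_⟩
  obtain ⟨hp0, hm, hP, hr⟩ := hn n hnn
  have hb : ∀ y : ℝ, (∀ x : ℝ, c * Real.exp (n * (rate A β 0 - ε)) ≤
      ‖bil ω (iterC A β n (x + y * Complex.I))‖) → ∀ W : ℂ, ‖W‖ = Real.exp (-(2 * π * y)) →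
      c * Real.exp (n * (rate A β 0 - ε)) * ‖W‖ ^ n ≤ ‖(p n).eval W‖ := by
    intro y hy W hW
    obtain ⟨x, rfl⟩ := exists_ee_eq hW
    rw [← hp n, norm_mul, norm_pow]
    gcongr
    exact hy x
  obtain ⟨s, hs, hle⟩ := exists_prod_le_norm_eval hp0 (n := n) (R₁ := Real.exp (-(2 * π * yp)))
    (by rw [Real.exp_lt_one_iff]; nlinarith) (by rw [Real.one_lt_exp_iff]; nlinarith)
    (by positivity) (hb yp hP) (hb ym hm) hr
  obtain ⟨j, hj, hjs⟩ := hav s hs x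
  refine ⟨j, hj, ?_⟩
  have h1 : ‖ee (x + j * β)‖ = 1 := by
    have := norm_ee_ofReal (x + j * β)
    push_cast at this
    exact this
  have h2 := hle _ h1
  have h3 := pow_le_prod_of_le hδ.le hjs
  rw [hs] at h3
  rw [← hp n, norm_mul, norm_pow, h1, one_pow, mul_one] at h2
  rw [div_mul_eq_mul_div, div_le_iff₀ (by positivity)]
  calc c * δ ^ m * Real.exp (n * (rate A β 0 - ε)) =
      c * Real.exp (n * (rate A β 0 - ε)) * δ ^ m := by ring
    _ ≤ c * Real.exp (n * (rate A β 0 - ε)) * (s.map fun ζ => ‖ee (x + j * β) - ζ‖).prod := by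
      gcongr
    _ ≤ _ := h2
    _ = _ := mul_comm _ _

end TrigCocycle

section Box

variable {A : ℂ → Mat} {β : ℝ} {α b c : ℂ → ℂ}

/-- Propagation of a solution of the inhomogeneous equation against the row `w A_{d-1} ⋯ A_0`. -/
lemma norm_row_sub_le (hAd : ∀ z, A z = !![α z, -b z; c z, 0]) {D K : ℝ} (hD : 0 ≤ D) (hK : 1 ≤ K)
    {ω : ℂ} (hc : ∀ x : ℝ, ‖c x‖ ≤ K)
    (hr : ∀ (d : ℕ) (x : ℝ), ‖pairW ω ((iterC A β d x).mulVec ![1, 0])‖ ≤ D * K ^ d)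
    (d : ℕ) : ∀ (x : ℝ) (φ g : ℕ → ℂ), (∀ n : ℕ, c (x + n * β) * φ (n + 2) =
      α (x + n * β) * φ (n + 1) - b (x + n * β) * φ n + g n) →
    ‖pairW ω ((iterC A β d x).mulVec ![φ 1, φ 0]) -
      (∏ i ∈ Finset.range d, c (x + i * β)) * pairW ω ![φ (d + 1), φ d]‖ ≤
      D * K ^ d * ∑ i ∈ Finset.range d, ‖g i‖ := by
  induction d with
  | zero => intro x φ g h; simp [iterC]
  | succ d ih =>
    intro x φ g h
    have h1 := ih (x + β) (fun n => φ (n + 1)) (fun n => g (n + 1)) (fun n => by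
      have := h (n + 1)
      push_cast at this ⊢
      rw [show (x : ℂ) + (n + 1) * β = x + β + n * β by ring] at this
      exact this)
    have h2 := hr d (x + β)
    have h0 := h 0
    simp only [Nat.cast_zero, zero_mul, add_zero, zero_add] at h0
    have e1 : (iterC A β (d + 1) x).mulVec ![φ 1, φ 0] =
        c x • (iterC A β d ((x + β : ℝ) : ℂ)).mulVec ![φ 2, φ 1] -
          g 0 • (iterC A β d ((x + β : ℝ) : ℂ)).mulVec ![1, 0] := by
      rw [iterC, ← Matrix.mulVec_mulVec, ← Matrix.mulVec_smul, ← Matrix.mulVec_smul,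
        ← Matrix.mulVec_sub]
      congr 1
      · push_cast; rfl
      · rw [hAd]
        ext i
        fin_cases i
        · simp [Matrix.mulVec, dotProduct, Fin.sum_univ_two]
          linear_combination -h0
        · simp [Matrix.mulVec, dotProduct, Fin.sum_univ_two]
    have e2 : ∏ i ∈ Finset.range (d + 1), c (x + i * β) =
        c x * ∏ i ∈ Finset.range d, c (((x + β : ℝ) : ℂ) + i * β) := by
      rw [Finset.prod_range_succ']
      simp only [Nat.cast_zero, zero_mul, add_zero]
      rw [mul_comm]
      congr 1
      refine Finset.prod_congr rfl fun i _ => ?_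
      push_cast; congr 1; ring
    have e3 : pairW ω ((iterC A β (d + 1) x).mulVec ![φ 1, φ 0]) -
      (∏ i ∈ Finset.range (d + 1), c (x + i * β)) * pairW ω ![φ (d + 1 + 1), φ (d + 1)] =
      c x * (pairW ω ((iterC A β d ((x + β : ℝ) : ℂ)).mulVec ![φ 2, φ 1]) -
        (∏ i ∈ Finset.range d, c (((x + β : ℝ) : ℂ) + i * β)) *
          pairW ω ![φ (d + 1 + 1), φ (d + 1)]) -
      g 0 * pairW ω ((iterC A β d ((x + β : ℝ) : ℂ)).mulVec ![1, 0]) := by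
      rw [e1, e2]
      simp only [pairW, Pi.sub_apply, Pi.smul_apply, smul_eq_mul]
      ring
    rw [e3, Finset.sum_range_succ']
    refine (norm_sub_le _ _).trans ?_
    rw [norm_mul, norm_mul]
    have hS : 0 ≤ ∑ i ∈ Finset.range d, ‖g (i + 1)‖ := Finset.sum_nonneg fun _ _ => norm_nonneg _
    calc _ ≤ K * (D * K ^ d * ∑ i ∈ Finset.range d, ‖g (i + 1)‖) + ‖g 0‖ * (D * K ^ d) := by
          refine add_le_add (mul_le_mul (hc x) h1 (norm_nonneg _) (by linarith)) ?_
          gcongr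
      _ ≤ K * (D * K ^ d * ∑ i ∈ Finset.range d, ‖g (i + 1)‖) + K * (‖g 0‖ * (D * K ^ d)) := by
          exact add_le_add le_rfl (le_mul_of_one_le_left (by positivity) hK)
      _ = _ := by ring

lemma iterC_succ' (A : ℂ → Mat) (β : ℝ) (n : ℕ) (z : ℂ) :
    iterC A β (n + 1) z = A (z + n * β) * iterC A β n z := by
  rw [add_comm, iterC_add, iterC_one]

/-- Propagation of the Wronskian of a solution of the homogeneous equation and one of the
inhomogeneous equation. -/
lemma norm_wronskian_sub_le (hAd : ∀ z, A z = !![α z, -b z; c z, 0]) {D K : ℝ} (hD : 0 ≤ D)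
    (hK : 1 ≤ K) {v : Fin 2 → ℂ} {x : ℝ} (hb : ∀ x : ℝ, ‖b x‖ ≤ K)
    (hr : ∀ d : ℕ, ‖(iterC A β d x).mulVec v 0‖ ≤ D * K ^ d)
    {φ g : ℕ → ℂ} (h : ∀ n : ℕ, c (x + n * β) * φ (n + 2) =
      α (x + n * β) * φ (n + 1) - b (x + n * β) * φ n + g n) (d : ℕ) :
    ‖((iterC A β d x).mulVec v 0 * φ d - (iterC A β d x).mulVec v 1 * φ (d + 1)) -
      (∏ i ∈ Finset.range d, b (x + i * β)) * (v 0 * φ 0 - v 1 * φ 1)‖ ≤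
      D * K ^ d * ∑ i ∈ Finset.range d, ‖g i‖ := by
  induction d with
  | zero => simp [iterC]
  | succ d ih =>
    have hd := h d
    set s := (iterC A β d x).mulVec v with hs
    have e0 : (iterC A β (d + 1) x).mulVec v 0 = α (x + d * β) * s 0 - b (x + d * β) * s 1 := by
      rw [iterC_succ', ← Matrix.mulVec_mulVec, hAd, ← hs]
      clear_value s
      simp [Matrix.mulVec, dotProduct, Fin.sum_univ_two]; ring
    have e1 : (iterC A β (d + 1) x).mulVec v 1 = c (x + d * β) * s 0 := by
      rw [iterC_succ', ← Matrix.mulVec_mulVec, hAd, ← hs]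
      clear_value s
      simp [Matrix.mulVec, dotProduct, Fin.sum_univ_two]
    have e3 : ((iterC A β (d + 1) x).mulVec v 0 * φ (d + 1) -
        (iterC A β (d + 1) x).mulVec v 1 * φ (d + 1 + 1)) -
        (∏ i ∈ Finset.range (d + 1), b (x + i * β)) * (v 0 * φ 0 - v 1 * φ 1) =
        b (x + d * β) * ((s 0 * φ d - s 1 * φ (d + 1)) -
          (∏ i ∈ Finset.range d, b (x + i * β)) * (v 0 * φ 0 - v 1 * φ 1)) - g d * s 0 := by
      rw [e0, e1, Finset.prod_range_succ]
      linear_combination (-s 0) * hd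
    rw [e3, Finset.sum_range_succ]
    refine (norm_sub_le _ _).trans ?_
    rw [norm_mul, norm_mul]
    have hS : 0 ≤ ∑ i ∈ Finset.range d, ‖g i‖ := Finset.sum_nonneg fun _ _ => norm_nonneg _
    have hb' : ‖b (x + d * β)‖ ≤ K := by
      have := hb (x + d * β); push_cast at this; exact this
    calc _ ≤ K * (D * K ^ d * ∑ i ∈ Finset.range d, ‖g i‖) + ‖g d‖ * (D * K ^ d) := by
          refine add_le_add (mul_le_mul hb' ih (norm_nonneg _) (by linarith)) ?_
          gcongr
          exact hr d
      _ ≤ K * (D * K ^ d * ∑ i ∈ Finset.range d, ‖g i‖) + K * (‖g d‖ * (D * K ^ d)) := by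
          exact add_le_add le_rfl (le_mul_of_one_le_left (by positivity) hK)
      _ = _ := by ring

/-- Bound for a solution inside a box by its values at the ends of the box. -/
lemma norm_bil_mul_le (hAd : ∀ z, A z = !![α z, -b z; c z, 0]) {C K' l' K : ℝ} (hC : 0 ≤ C)
    (hK : 1 ≤ K) (hKK : Real.exp K' ≤ K) {ω : ℂ} (hω : ‖ω‖ = 1)
    (hc : ∀ x : ℝ, ‖c x‖ ≤ K) (hb : ∀ x : ℝ, ‖b x‖ ≤ K)
    (hn : ∀ (n : ℕ) (x : ℝ), ‖iterC A β n x‖ ≤ C * Real.exp (n * K'))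
    (hpc : ∀ (n : ℕ) (x : ℝ), ‖∏ i ∈ Finset.range n, c (x + i * β)‖ ≤ C * Real.exp (n * l'))
    (hpb : ∀ (n : ℕ) (x : ℝ), ‖∏ i ∈ Finset.range n, b (x + i * β)‖ ≤ C * Real.exp (n * l'))
    {x : ℝ} {φ g : ℕ → ℂ} (h : ∀ n : ℕ, c (x + n * β) * φ (n + 2) =
      α (x + n * β) * φ (n + 1) - b (x + n * β) * φ n + g n) (p d : ℕ) :
    ‖bil ω (iterC A β (p + d) x)‖ * ‖φ (p + 1)‖ ≤
      4 * C ^ 2 * Real.exp (p * K' + d * l') * (‖φ (p + d + 1)‖ + ‖φ (p + d)‖) +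
      4 * C ^ 2 * Real.exp (d * K' + p * l') * (‖φ 0‖ + ‖φ 1‖) +
      8 * C ^ 2 * K ^ (p + d) * ∑ i ∈ Finset.range (p + d), ‖g i‖ := by
  have hexp : ∀ n : ℕ, Real.exp (n * K') ≤ K ^ n := fun n => by
    rw [Real.exp_nat_mul]; gcongr
  have hS : ∀ (n : ℕ) (y : ℝ) (v : Fin 2 → ℂ), ‖v‖ ≤ 1 →
      ‖(iterC A β n y).mulVec v‖ ≤ 2 * C * Real.exp (n * K') := by
    intro n y v hv
    have h1 := norm_mulVec_le (iterC A β n y) v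
    have h2 := hn n y
    have h3 : 2 * ‖iterC A β n y‖ * ‖v‖ ≤ 2 * ‖iterC A β n y‖ * 1 := by gcongr
    linarith
  have hR : ∀ (n : ℕ) (y : ℝ) (v : Fin 2 → ℂ), ‖v‖ ≤ 1 →
      ‖pairW ω ((iterC A β n y).mulVec v)‖ ≤ 4 * C * Real.exp (n * K') := fun n y v hv => by
    linarith [norm_pairW_le hω ((iterC A β n y).mulVec v), hS n y v hv]
  have hv0 : ‖(![1, 0] : Fin 2 → ℂ)‖ ≤ 1 := by
    rw [pi_norm_le_iff_of_nonneg zero_le_one]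
    intro i; fin_cases i <;> simp
  have hv1 : ‖(![0, 1] : Fin 2 → ℂ)‖ ≤ 1 := by
    rw [pi_norm_le_iff_of_nonneg zero_le_one]
    intro i; fin_cases i <;> simp
  have hxp : (((x + p * β : ℝ)) : ℂ) = x + p * β := by push_cast; ring
  have row := norm_row_sub_le hAd (D := 4 * C) (by positivity) hK hc (fun n y =>
    (hR n y _ hv0).trans (by have := hexp n; gcongr)) d (x + p * β) (fun n => φ (p + n))
    (fun n => g (p + n)) (fun n => by
      have := h (p + n)
      push_cast at this ⊢
      rw [show (x : ℂ) + (p + n) * β = x + p * β + n * β by ring] at this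
      exact this)
  have wr := norm_wronskian_sub_le hAd (D := 2 * C) (by positivity) hK (v := vecV ω) (x := x) hb
    (fun n => (norm_le_pi_norm _ 0).trans ((hS n x _ (norm_vecV hω)).trans
      (by have := hexp n; gcongr))) h p
  set S := (iterC A β p x).mulVec (vecV ω) with hSdef
  set M := iterC A β d ((x + p * β : ℝ) : ℂ) with hM
  have hS0 : ‖S 0‖ ≤ 2 * C * Real.exp (p * K') :=
    (norm_le_pi_norm _ 0).trans (hS p x _ (norm_vecV hω))
  have hR1 : ‖pairW ω (M.mulVec ![0, 1])‖ ≤ 4 * C * Real.exp (d * K') := hR d _ _ hv1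
  have hid : bil ω (iterC A β (p + d) x) * φ (p + 1) =
      pairW ω (M.mulVec ![φ (p + 1), φ (p + 0)]) * S 0 -
        pairW ω (M.mulVec ![0, 1]) * (S 0 * φ p - S 1 * φ (p + 1)) := by
    rw [bil_eq_pairW, add_comm p d, iterC_add, ← Matrix.mulVec_mulVec, ← hSdef, ← hxp, ← hM]
    clear_value S M
    simp [pairW, Matrix.mulVec, dotProduct, Fin.sum_univ_two]; ring
  have hp1 : ‖pairW ω (M.mulVec ![φ (p + 1), φ (p + 0)])‖ ≤
      C * Real.exp (d * l') * (‖φ (p + d + 1)‖ + ‖φ (p + d)‖) +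
        4 * C * K ^ d * ∑ i ∈ Finset.range d, ‖g (p + i)‖ := by
    have h1 : ‖pairW ω ![φ (p + (d + 1)), φ (p + d)]‖ ≤ ‖φ (p + d + 1)‖ + ‖φ (p + d)‖ := by
      refine (norm_add_le _ _).trans ?_
      simp [hω, add_assoc]
    have h2 := mul_le_mul (hpc d (x + p * β)) h1 (norm_nonneg _) (by positivity)
    rw [← norm_mul] at h2
    exact (norm_le_norm_add_norm_sub' _ _).trans (add_le_add h2 row)
  have hp2 : ‖S 0 * φ p - S 1 * φ (p + 1)‖ ≤
      C * Real.exp (p * l') * (‖φ 0‖ + ‖φ 1‖) + 2 * C * K ^ p * ∑ i ∈ Finset.range p, ‖g i‖ := by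
    have h1 : ‖vecV ω 0 * φ 0 - vecV ω 1 * φ 1‖ ≤ ‖φ 0‖ + ‖φ 1‖ := by
      refine (norm_sub_le _ _).trans ?_
      simp [vecV, hω]
    have h2 := mul_le_mul (hpb p x) h1 (norm_nonneg _) (by positivity)
    rw [← norm_mul] at h2
    exact (norm_le_norm_add_norm_sub' _ _).trans (add_le_add h2 wr)
  have hsum : ∑ i ∈ Finset.range (p + d), ‖g i‖ =
      ∑ i ∈ Finset.range p, ‖g i‖ + ∑ i ∈ Finset.range d, ‖g (p + i)‖ :=
    Finset.sum_range_add _ _ _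
  have hS1 : 0 ≤ ∑ i ∈ Finset.range p, ‖g i‖ := Finset.sum_nonneg fun _ _ => norm_nonneg _
  have hS2 : 0 ≤ ∑ i ∈ Finset.range d, ‖g (p + i)‖ := Finset.sum_nonneg fun _ _ => norm_nonneg _
  rw [← norm_mul, hid, hsum]
  generalize ∑ i ∈ Finset.range p, ‖g i‖ = s1 at *
  generalize ∑ i ∈ Finset.range d, ‖g (p + i)‖ = s2 at *
  refine (norm_sub_le _ _).trans ?_
  rw [norm_mul, norm_mul]
  have hep := hexp p
  have hed := hexp d
  calc _ ≤ (C * Real.exp (d * l') * (‖φ (p + d + 1)‖ + ‖φ (p + d)‖) + 4 * C * K ^ d * s2) *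
        (2 * C * Real.exp (p * K')) + (4 * C * Real.exp (d * K')) *
        (C * Real.exp (p * l') * (‖φ 0‖ + ‖φ 1‖) + 2 * C * K ^ p * s1) := by gcongr
    _ = 2 * C ^ 2 * (Real.exp (p * K') * Real.exp (d * l')) * (‖φ (p + d + 1)‖ + ‖φ (p + d)‖) +
        4 * C ^ 2 * (Real.exp (d * K') * Real.exp (p * l')) * (‖φ 0‖ + ‖φ 1‖) +
        8 * C ^ 2 * (K ^ d * Real.exp (p * K')) * s2 +
        8 * C ^ 2 * (Real.exp (d * K') * K ^ p) * s1 := by ring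
    _ ≤ 4 * C ^ 2 * (Real.exp (p * K') * Real.exp (d * l')) * (‖φ (p + d + 1)‖ + ‖φ (p + d)‖) +
        4 * C ^ 2 * (Real.exp (d * K') * Real.exp (p * l')) * (‖φ 0‖ + ‖φ 1‖) +
        8 * C ^ 2 * (K ^ d * K ^ p) * s2 +
        8 * C ^ 2 * (K ^ d * K ^ p) * s1 := by
      gcongr
      norm_num
    _ = _ := by rw [Real.exp_add, Real.exp_add, pow_add]; ring

end Box

lemma summable_shift_sum {u : ℤ → ℝ} (hu : Summable fun k => u k ^ 2) (I : Finset ℤ) :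
    (Summable fun k => ∑ s ∈ I, u (k + s) ^ 2) ∧
      ∑' k, ∑ s ∈ I, u (k + s) ^ 2 = I.card * ∑' k, u k ^ 2 := by
  have h1 : ∀ s : ℤ, Summable fun k => u (k + s) ^ 2 := fun s =>
    (Equiv.addRight s).summable_iff.2 hu
  refine ⟨summable_sum fun s _ => h1 s, ?_⟩
  rw [Summable.tsum_finsetSum fun s _ => h1 s]
  have h2 : ∀ s : ℤ, ∑' k, u (k + s) ^ 2 = ∑' k, u k ^ 2 := fun s =>
    (Equiv.addRight s).tsum_eq fun k => u k ^ 2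
  simp [h2]

/-- A pointwise bound with a small averaging term gives an `ℓ²` bound. -/
lemma tsum_sq_le_of_pointwise {u v : ℤ → ℝ} (hu0 : ∀ k, 0 ≤ u k)
    (hu : Summable fun k => u k ^ 2) (hv : Summable fun k => v k ^ 2) (I J : Finset ℤ) {q G : ℝ}
    (hq0 : 0 ≤ q) (hq : q * I.card ≤ 1 / 2)
    (h : ∀ k, u k ≤ q * ∑ s ∈ I, u (k + s) + G * ∑ s ∈ J, v (k + s)) :
    ∑' k, u k ^ 2 ≤ 4 * G ^ 2 * J.card ^ 2 * ∑' k, v k ^ 2 := by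
  obtain ⟨sI, tI⟩ := summable_shift_sum hu I
  obtain ⟨sJ, tJ⟩ := summable_shift_sum hv J
  have hpt : ∀ k, u k ^ 2 ≤ 2 * q ^ 2 * I.card * ∑ s ∈ I, u (k + s) ^ 2 +
      2 * G ^ 2 * J.card * ∑ s ∈ J, v (k + s) ^ 2 := by
    intro k
    have c1 : (∑ s ∈ I, u (k + s)) ^ 2 ≤ I.card * ∑ s ∈ I, u (k + s) ^ 2 :=
      sq_sum_le_card_mul_sum_sq
    have c2 : (∑ s ∈ J, v (k + s)) ^ 2 ≤ J.card * ∑ s ∈ J, v (k + s) ^ 2 :=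
      sq_sum_le_card_mul_sum_sq
    have h1 := pow_le_pow_left₀ (hu0 k) (h k) 2
    set a := ∑ s ∈ I, u (k + s)
    set b := ∑ s ∈ J, v (k + s)
    nlinarith [sq_nonneg (q * a - G * b), mul_le_mul_of_nonneg_left c1 (sq_nonneg q),
      mul_le_mul_of_nonneg_left c2 (sq_nonneg G)]
  have hs := (sI.mul_left (2 * q ^ 2 * I.card)).add (sJ.mul_left (2 * G ^ 2 * J.card))
  have ht := hu.tsum_le_tsum hpt hs
  rw [(sI.mul_left _).tsum_add (sJ.mul_left _), tsum_mul_left, tsum_mul_left, tI, tJ] at ht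
  have hU : 0 ≤ ∑' k, u k ^ 2 := tsum_nonneg fun k => sq_nonneg _
  have hq2 : (q * I.card) ^ 2 ≤ 1 / 4 := by
    have := pow_le_pow_left₀ (by positivity) hq 2
    linarith
  nlinarith [mul_le_mul_of_nonneg_right hq2 hU]

lemma IsTrig.exists_prod_le {f : ℂ → ℂ} {p : Polynomial ℂ} {n : ℕ} (h : IsTrig n f p)
    (hp : p ≠ 0) {β : ℝ} (hβ : Irrational β) {K : ℝ} (hK : lineMean f 0 < K) :
    ∃ C : ℝ, 1 ≤ C ∧ ∀ (n : ℕ) (x : ℝ), ‖∏ i ∈ Finset.range n, f (x + i * β)‖ ≤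
      C * Real.exp (n * K) := by
  set F : ℝ → ℝ := fun x => ‖f x‖ with hF
  have hFc : Continuous F := (h.differentiable.continuous.comp Complex.continuous_ofReal).norm
  have hFp : Function.Periodic F 1 := fun x => by
    simp only [hF]
    rw [← h.add_one x]; push_cast; rfl
  have h00 : ∀ x : ℝ, (x : ℂ) + (0 : ℝ) * Complex.I = x := fun x => by simp
  have hae := h.ae_ne_zero hp 0
  have hi := h.intervalIntegrable hp 0
  simp only [h00, lineMean] at hae hi hK
  obtain ⟨n0, hn0⟩ := prod_orbit_le hβ hFc (fun x => norm_nonneg _) hFp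
    (by filter_upwards [hae] with x hx; simpa [hF] using hx) hi hK
  obtain ⟨B, hB⟩ := bddAbove_of_periodic hFc hFp
  have hB' : ∀ x, F x ≤ B := fun x => hB ⟨x, rfl⟩
  have hB0 : 0 ≤ B := (norm_nonneg _).trans (hB' 0)
  have hdet : ∀ (n : ℕ) (x : ℝ), ‖∏ i ∈ Finset.range n, f (x + i * β)‖ =
      ∏ j ∈ Finset.range n, F (x + j * β) := by
    intro n x
    rw [norm_prod]
    apply Finset.prod_congr rfl
    intro j _
    simp only [hF]
    push_cast; rfl
  have h0 : ∀ i ∈ Finset.range n0, 0 ≤ B ^ i * Real.exp (-(i * K)) :=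
      fun i _ => by positivity
  refine ⟨1 + ∑ i ∈ Finset.range n0, B ^ i * Real.exp (-(i * K)), ?_, fun n x => ?_⟩
  · linarith [Finset.sum_nonneg h0]
  rw [hdet]
  rcases le_or_gt n0 n with hn | hn
  · refine (hn0 n hn x).trans (le_mul_of_one_le_left (Real.exp_pos _).le ?_)
    linarith [Finset.sum_nonneg h0]
  · have h3 := Finset.single_le_sum h0 (Finset.mem_range.2 hn)
    have h4 : ∏ j ∈ Finset.range n, F (x + j * β) ≤ B ^ n := by
      calc _ ≤ ∏ j ∈ Finset.range n, B :=
            Finset.prod_le_prod (fun j _ => norm_nonneg _) fun j _ => hB' _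
        _ = _ := by simp
    calc _ ≤ B ^ n := h4
      _ = B ^ n * Real.exp (-(n * K)) * Real.exp (n * K) := by
          rw [mul_assoc, ← Real.exp_add]; simp
      _ ≤ _ := by gcongr; linarith

lemma IsTrig.exists_norm_le {f : ℂ → ℂ} {p : Polynomial ℂ} {n : ℕ} (h : IsTrig n f p) :
    ∃ B : ℝ, ∀ x : ℝ, ‖f x‖ ≤ B := by
  obtain ⟨B, hB⟩ := bddAbove_of_periodic (g := fun x : ℝ => ‖f x‖)
    (h.differentiable.continuous.comp Complex.continuous_ofReal).norm (fun x => by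
      show ‖f _‖ = ‖f _‖
      rw [← h.add_one x]; push_cast; rfl)
  exact ⟨B, fun x => hB ⟨x, rfl⟩⟩

namespace TrigCocycle
variable {A : ℂ → Mat} {β la : ℝ} (hA : TrigCocycle A β la)
include hA

set_option maxHeartbeats 1000000 in
/-- In the presence of a growth rate exceeding half of the determinant rate, the inhomogeneous
Jacobi equation is coercive on `ℓ²`. -/
lemma exists_tsum_sq_le (has : AsympRate A β la) (h0 : la < rate A β 0) {α b c : ℂ → ℂ}
    (hAd : ∀ z, A z = !![α z, -b z; c z, 0]) {nb nc : ℕ} {pb pc : Polynomial ℂ}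
    (hbt : IsTrig nb b pb) (hct : IsTrig nc c pc) (hpb : pb ≠ 0) (hpc : pc ≠ 0)
    (hbm : lineMean b 0 ≤ la) (hcm : lineMean c 0 ≤ la) :
    ∃ K : ℝ, ∀ (θ : ℝ) (ψ g : ℤ → ℂ), (Summable fun k => ‖ψ k‖ ^ 2) →
      (Summable fun k => ‖g k‖ ^ 2) →
      (∀ k : ℤ, c ((θ + β * k : ℝ) : ℂ) * ψ (k + 1) = α ((θ + β * k : ℝ) : ℂ) * ψ k -
        b ((θ + β * k : ℝ) : ℂ) * ψ (k - 1) + g k) →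
      ∑' k, ‖ψ k‖ ^ 2 ≤ K * ∑' k, ‖g k‖ ^ 2 := by
  set Λ := rate A β 0 with hΛ
  set κ := (Λ - la) / 8 with hκ
  have hκ0 : 0 < κ := by rw [hκ]; linarith
  obtain ⟨ω, c₀, n₁, M, hω, hc₀, hgood⟩ := hA.exists_good_shift has h0 hκ0
  obtain ⟨C₁, hC₁, hn⟩ := hA.exists_supLine_le 0 (K := Λ + κ) (by linarith)
  obtain ⟨C₂, hC₂, hpc'⟩ := hct.exists_prod_le hpc hA.irr (K := la + κ) (by linarith)
  obtain ⟨C₃, hC₃, hpb'⟩ := hbt.exists_prod_le hpb hA.irr (K := la + κ) (by linarith)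
  obtain ⟨B₁, hB₁⟩ := hbt.exists_norm_le
  obtain ⟨B₂, hB₂⟩ := hct.exists_norm_le
  set K := max 1 (max (Real.exp (Λ + κ)) (max B₁ B₂)) with hK
  set C := max C₁ (max C₂ C₃) with hC
  have hC0 : 0 < C := lt_of_lt_of_le (by linarith) (le_max_left _ _)
  have hn' : ∀ (n : ℕ) (x : ℝ), ‖iterC A β n x‖ ≤ C * Real.exp (n * (Λ + κ)) := by
    intro n x
    have h1 := hA.norm_le_supLine n x 0
    simp only [Complex.ofReal_zero, zero_mul, add_zero] at h1
    refine (h1.trans (hn n)).trans ?_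
    gcongr
    exact le_max_left _ _
  have hpc2 : ∀ (n : ℕ) (x : ℝ), ‖∏ i ∈ Finset.range n, c (x + i * β)‖ ≤
      C * Real.exp (n * (la + κ)) := fun n x => (hpc' n x).trans (by
    gcongr; exact (le_max_left _ _).trans (le_max_right _ _))
  have hpb2 : ∀ (n : ℕ) (x : ℝ), ‖∏ i ∈ Finset.range n, b (x + i * β)‖ ≤
      C * Real.exp (n * (la + κ)) := fun n x => (hpb' n x).trans (by
    gcongr; exact (le_max_right _ _).trans (le_max_right _ _))
  set Q := 4 * C ^ 2 * Real.exp (M * (Λ - la)) / c₀ with hQ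
  have hQ0 : 0 < Q := by positivity
  obtain ⟨m, hm1, hm2, hm3⟩ : ∃ m : ℕ, M ≤ m ∧ n₁ ≤ m ∧
      4 * Q * Real.exp (-(m * (4 * κ))) * (2 * (M + 2)) ≤ 1 / 2 := by
    have ht : Tendsto (fun m : ℕ => 4 * Q * Real.exp (-(m * (4 * κ))) * (2 * (M + 2))) atTop
        (nhds (4 * Q * 0 * (2 * (M + 2)))) := by
      refine Tendsto.mul_const _ (Tendsto.const_mul _ ?_)
      refine Real.tendsto_exp_neg_atTop_nhds_zero.comp ?_
      exact tendsto_natCast_atTop_atTop.atTop_mul_const (by linarith)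
    rw [mul_zero, zero_mul] at ht
    obtain ⟨m, h1, h2, h3⟩ := ((ht.eventually (ge_mem_nhds (by norm_num : (0:ℝ) < 1 / 2))).and
      ((eventually_ge_atTop M).and (eventually_ge_atTop n₁))).exists
    exact ⟨m, h2, h3, h1⟩
  set q := 4 * Q * Real.exp (-(m * (4 * κ))) with hq
  set G := 8 * C ^ 2 * K ^ (2 * m) / (c₀ * Real.exp ((2 * m : ℕ) * (Λ - κ))) * (2 * m) with hG
  set I : Finset ℤ := Finset.Icc (-(m : ℤ) - M - 1) (-m) ∪ Finset.Icc ((m : ℤ) - M - 1) m with hI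
  set J : Finset ℤ := Finset.Icc (-(m : ℤ) - M) m with hJ
  refine ⟨4 * G ^ 2 * J.card ^ 2, fun θ ψ g hψ hg hrec => ?_⟩
  have hIcard : (I.card : ℝ) ≤ 2 * (M + 2) := by
    have h1 := Finset.card_union_le (Finset.Icc (-(m : ℤ) - M - 1) (-m))
      (Finset.Icc ((m : ℤ) - M - 1) m)
    rw [Int.card_Icc, Int.card_Icc, ← hI] at h1
    have h2 : I.card ≤ 2 * (M + 2) := by omega
    exact_mod_cast h2
  refine tsum_sq_le_of_pointwise (u := fun k => ‖ψ k‖) (v := fun k => ‖g k‖)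
    (fun k => norm_nonneg _) hψ hg I J (q := q) (G := G) (by positivity) ?_ fun k => ?_
  · exact (mul_le_mul_of_nonneg_left hIcard (by positivity)).trans hm3
  obtain ⟨j, hj, hjle⟩ := hgood (2 * m) (by omega) (θ + β * (k - m - M))
  obtain ⟨i, hi⟩ := Nat.exists_eq_add_of_le hj
  set a : ℤ := k - m - i with ha
  obtain ⟨d, hd⟩ := Nat.exists_eq_add_of_le (show i ≤ m by omega)
  have hpd : m + i + d = 2 * m := by omega
  have hx : ((θ + β * (k - m - M) : ℝ) : ℂ) + j * β = ((θ + β * a : ℝ) : ℂ) := by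
    rw [ha, hi]; push_cast; ring
  rw [hx] at hjle
  have box := norm_bil_mul_le hAd hC0.le (le_max_left _ _ : 1 ≤ K)
    ((le_max_left _ _).trans (le_max_right _ _) : Real.exp (Λ + κ) ≤ K) hω
    (fun x => (hB₂ x).trans (((le_max_right _ _).trans (le_max_right _ _)).trans (le_max_right _ _)))
    (fun x => (hB₁ x).trans (((le_max_left _ _).trans (le_max_right _ _)).trans (le_max_right _ _)))
    hn' hpc2 hpb2 (x := θ + β * a) (φ := fun n => ψ (a - 1 + n)) (g := fun n => g (a + n))
    (fun n => by
      have := hrec (a + n)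
      rw [show ((θ + β * (a + n : ℤ) : ℝ) : ℂ) = ((θ + β * a : ℝ) : ℂ) + n * β by
        push_cast; ring] at this
      rw [show a - 1 + ((n + 2 : ℕ) : ℤ) = a + n + 1 by push_cast; ring,
        show a - 1 + ((n + 1 : ℕ) : ℤ) = a + n by push_cast; ring,
        show a - 1 + (n : ℤ) = a + n - 1 by ring]
      exact this) (m + i) d
  simp only [hpd] at box
  rw [show a - 1 + ((m + i + 1 : ℕ) : ℤ) = k by rw [ha]; push_cast; ring] at box
  set SI := ∑ s ∈ I, ‖ψ (k + s)‖ with hSI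
  set SJ := ∑ s ∈ J, ‖g (k + s)‖ with hSJ
  have hleI : ∀ l : ℤ, l - k ∈ I → ‖ψ l‖ ≤ SI := by
    intro l hl
    have := Finset.single_le_sum (f := fun s => ‖ψ (k + s)‖) (fun s _ => norm_nonneg _) hl
    simpa using this
  have hleJ : ∀ l : ℤ, l - k ∈ J → ‖g l‖ ≤ SJ := by
    intro l hl
    have := Finset.single_le_sum (f := fun s => ‖g (k + s)‖) (fun s _ => norm_nonneg _) hl
    simpa using this
  have b1 : ‖ψ (a - 1 + ((2 * m + 1 : ℕ) : ℤ))‖ ≤ SI := hleI _ (by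
    simp only [hI, Finset.mem_union, Finset.mem_Icc]; right; omega)
  have b2 : ‖ψ (a - 1 + ((2 * m : ℕ) : ℤ))‖ ≤ SI := hleI _ (by
    simp only [hI, Finset.mem_union, Finset.mem_Icc]; right; omega)
  have b3 : ‖ψ (a - 1 + ((0 : ℕ) : ℤ))‖ ≤ SI := hleI _ (by
    simp only [hI, Finset.mem_union, Finset.mem_Icc]; left; omega)
  have b4 : ‖ψ (a - 1 + ((1 : ℕ) : ℤ))‖ ≤ SI := hleI _ (by
    simp only [hI, Finset.mem_union, Finset.mem_Icc]; left; omega)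
  have b5 : ∑ n ∈ Finset.range (2 * m), ‖g (a + n)‖ ≤ 2 * m * SJ := by
    have := Finset.sum_le_card_nsmul (Finset.range (2 * m)) (fun n => ‖g (a + n)‖) SJ
      (fun n hn => hleJ _ (by
        have := Finset.mem_range.1 hn
        simp only [hJ, Finset.mem_Icc]; omega))
    simpa using this
  have hSI0 : 0 ≤ SI := (norm_nonneg _).trans b1
  have hmd : (m : ℝ) = i + d := by exact_mod_cast hd
  have hMi : (i : ℝ) ≤ M := by exact_mod_cast (by omega : i ≤ M)
  have hi0 : (0 : ℝ) ≤ i := Nat.cast_nonneg i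
  have hΛκ : Λ - la = 8 * κ := by rw [hκ]; ring
  have ex1 : ((m + i : ℕ) : ℝ) * (Λ + κ) + d * (la + κ) ≤ M * (Λ - la) + m * (Λ + la + 2 * κ) := by
    push_cast; rw [hmd]; nlinarith
  have ex2 : (d : ℝ) * (Λ + κ) + ((m + i : ℕ) : ℝ) * (la + κ) ≤
      M * (Λ - la) + m * (Λ + la + 2 * κ) := by
    push_cast; rw [hmd]; nlinarith
  set D := Real.exp ((2 * m : ℕ) * (Λ - κ)) with hD
  set X := Real.exp (M * (Λ - la)) with hX
  have hexp : Real.exp (M * (Λ - la) + m * (Λ + la + 2 * κ)) =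
      X * (Real.exp (-(m * (4 * κ))) * D) := by
    rw [hX, hD, ← Real.exp_add, ← Real.exp_add]
    congr 1; push_cast
    rw [show la = Λ - 8 * κ by linarith]; ring
  have hK0 : 0 < K := lt_of_lt_of_le one_pos (le_max_left _ _)
  have hD0 : 0 < D := Real.exp_pos _
  have key : c₀ * D * ‖ψ k‖ ≤ c₀ * D * (q * SI + G * SJ) := by
    calc c₀ * D * ‖ψ k‖ ≤ _ := (mul_le_mul_of_nonneg_right hjle (norm_nonneg _)).trans box
      _ ≤ 4 * C ^ 2 * (X * (Real.exp (-(m * (4 * κ))) * D)) * (SI + SI) +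
          4 * C ^ 2 * (X * (Real.exp (-(m * (4 * κ))) * D)) * (SI + SI) +
          8 * C ^ 2 * K ^ (2 * m) * (2 * m * SJ) := by
        rw [← hexp]
        gcongr
      _ = _ := by
        have hq' : c₀ * q = 16 * C ^ 2 * X * Real.exp (-(m * (4 * κ))) := by
          rw [hq, hQ]; field_simp; ring
        have hG' : c₀ * D * G = 8 * C ^ 2 * K ^ (2 * m) * (2 * m) := by
          rw [hG]; field_simp
        clear_value q G D X SI SJ
        linear_combination (-(D * SI)) * hq' - SJ * hG'
  exact le_of_mul_le_mul_left key (by positivity)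

end TrigCocycle

/-- A bounded-below operator whose range has trivial orthogonal complement is invertible. -/
lemma isUnit_of_norm_sq_le {X : Type*} [NormedAddCommGroup X] [InnerProductSpace ℂ X]
    [CompleteSpace X] (T : X →L[ℂ] X) {K : ℝ} (hK : ∀ ψ, ‖ψ‖ ^ 2 ≤ K * ‖T ψ‖ ^ 2)
    (hperp : ∀ φ, (∀ ψ, inner ℂ (T ψ) φ = 0) → T φ = 0) : IsUnit T := by
  have hb : ∀ ψ, ‖ψ‖ ≤ (Real.toNNReal √(max K 0) : ℝ≥0) * ‖T ψ‖ := by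
    intro ψ
    refine (sq_le_sq₀ (norm_nonneg _) (by positivity)).1 ?_
    rw [mul_pow, Real.coe_toNNReal _ (Real.sqrt_nonneg _), Real.sq_sqrt (le_max_right _ _)]
    exact (hK ψ).trans (by gcongr; exact le_max_left _ _)
  have hanti : AntilipschitzWith (Real.toNNReal √(max K 0)) T :=
    T.antilipschitz_of_bound hb
  have hker : ∀ φ, T φ = 0 → φ = 0 := fun φ h => hanti.injective (by rw [h, map_zero])
  have hcl : IsClosed (T.range : Set X) := hanti.isClosed_range T.uniformContinuous
  have : CompleteSpace T.range := hcl.completeSpace_coe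
  have htop : T.range = ⊤ := by
    rw [← Submodule.orthogonal_eq_bot_iff, Submodule.eq_bot_iff]
    intro φ hφ
    refine hker φ (hperp φ fun ψ => ?_)
    exact (Submodule.mem_orthogonal _ _).1 hφ _ ⟨ψ, rfl⟩
  rw [ContinuousLinearMap.isUnit_iff_bijective]
  exact ⟨hanti.injective, LinearMap.range_eq_top.1 htop⟩

lemma lp_two_hasSum (f : lp (fun _ : ℤ => ℂ) 2) : HasSum (fun k => ‖f k‖ ^ 2) (‖f‖ ^ 2) := by
  have := lp.hasSum_norm (p := 2) (by norm_num) f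
  simpa using this

/-- A self-adjoint Jacobi operator satisfying a coercivity estimate at the energy `E` has `E` in
its resolvent set. -/
lemma notMem_spectrum_of_coercive (v : ℤ → ℝ) (c : ℤ → ℂ)
    (H : lp (fun _ : ℤ => ℂ) 2 →L[ℂ] lp (fun _ : ℤ => ℂ) 2)
    (hH : ∀ (ψ : lp (fun _ : ℤ => ℂ) 2) (k : ℤ), H ψ k = (v k : ℂ) * ψ k + c k * ψ (k + 1) +
      (starRingEnd ℂ) (c (k - 1)) * ψ (k - 1)) (E K : ℝ)
    (hK : ∀ ψ g : ℤ → ℂ, (Summable fun k => ‖ψ k‖ ^ 2) → (Summable fun k => ‖g k‖ ^ 2) →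
      (∀ k, c k * ψ (k + 1) = ((E : ℂ) - v k) * ψ k -
        (starRingEnd ℂ) (c (k - 1)) * ψ (k - 1) + g k) →
      ∑' k, ‖ψ k‖ ^ 2 ≤ K * ∑' k, ‖g k‖ ^ 2) : (E : ℂ) ∉ spectrum ℂ H := by
  rw [spectrum.notMem_iff, ← IsUnit.neg_iff, neg_sub]
  set T := H - algebraMap ℂ _ (E : ℂ) with hT
  have hTapp : ∀ ψ k, T ψ k = (v k : ℂ) * ψ k + c k * ψ (k + 1) +
      (starRingEnd ℂ) (c (k - 1)) * ψ (k - 1) - E * ψ k := by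
    intro ψ k
    rw [← hH ψ k, hT, Algebra.algebraMap_eq_smul_one]
    rfl
  refine isUnit_of_norm_sq_le T (K := K) (fun ψ => ?_) fun φ hφ => ?_
  · rw [← (lp_two_hasSum ψ).tsum_eq, ← (lp_two_hasSum (T ψ)).tsum_eq]
    refine hK _ _ (lp_two_hasSum ψ).summable (lp_two_hasSum (T ψ)).summable fun k => ?_
    rw [hTapp]; ring
  · ext k
    have hk : T (lp.single 2 k 1) = lp.single 2 k ((v k : ℂ) - E) + lp.single 2 (k - 1) (c (k - 1)) +
        lp.single 2 (k + 1) ((starRingEnd ℂ) (c k)) := by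
      ext j
      rw [hTapp]
      simp only [lp.coeFn_add, Pi.add_apply, lp.single_apply, Pi.single_apply]
      rcases eq_or_ne j k with rfl | h1
      · have e1 : j + 1 ≠ j := by omega
        have e2 : j - 1 ≠ j := by omega
        have e3 : j ≠ j - 1 := by omega
        have e4 : j ≠ j + 1 := by omega
        simp [e1, e2, e3, e4]
      rcases eq_or_ne j (k - 1) with rfl | h2
      · have e1 : k - 1 - 1 ≠ k := by omega
        have e2 : k - 1 ≠ k + 1 := by omega
        simp [e1, e2, h1]
      rcases eq_or_ne j (k + 1) with rfl | h3
      · have e1 : k + 1 + 1 ≠ k := by omega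
        simp [e1, h1, h2]
      · have e1 : j + 1 ≠ k := by omega
        have e2 : j - 1 ≠ k := by omega
        simp [e1, e2, h1, h2, h3]
    have h := hφ (lp.single 2 k 1)
    rw [hk, inner_add_left, inner_add_left, lp.inner_single_left, lp.inner_single_left,
      lp.inner_single_left] at h
    simp at h
    rw [hTapp]
    simp
    linear_combination h

lemma lineMean_one_add_mul_bounds {u : ℂ} (hu : ‖u‖ ≤ 1) (y : ℝ) :
    IsTrig 0 (fun z => 1 + u * ee z) (Polynomial.C u * Polynomial.X + Polynomial.C 1) ∧
    Polynomial.C u * Polynomial.X + Polynomial.C 1 ≠ 0 ∧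
    0 ≤ lineMean (fun z => 1 + u * ee z) y ∧
    lineMean (fun z => 1 + u * ee z) y ≤ max 0 (-(2 * π * y)) := by
  have ht : IsTrig 0 (fun z => 1 + u * ee z) (Polynomial.C u * Polynomial.X + Polynomial.C 1) :=
    fun z => by simp [add_comm]
  have hp : Polynomial.C u * Polynomial.X + Polynomial.C 1 ≠ 0 := by
    intro h
    simpa using congrArg (Polynomial.eval 0) h
  refine ⟨ht, hp, ?_⟩
  rcases eq_or_ne u 0 with rfl | h0
  · simp [lineMean]
  have hn : 0 < ‖u‖ := norm_pos_iff.2 h0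
  have hr : (0 : ℝ) < Real.exp (-(2 * π * y)) := Real.exp_pos _
  have hroots : (Polynomial.C u * Polynomial.X + Polynomial.C (1 : ℂ)).roots = {-u⁻¹} := by
    rw [Polynomial.roots_C_mul_X_add_C _ h0]; simp
  rw [ht.lineMean_eq hp, hroots, Polynomial.leadingCoeff_linear h0]
  simp only [Nat.cast_zero, mul_zero, zero_mul, zero_add, Multiset.map_singleton,
    Multiset.sum_singleton, norm_neg, norm_inv]
  have hm : 0 < max (Real.exp (-(2 * π * y))) ‖u‖⁻¹ := lt_max_of_lt_left hr
  rw [← Real.log_mul hn.ne' hm.ne', mul_max_of_nonneg _ _ hn.le, mul_inv_cancel₀ hn.ne']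
  refine ⟨Real.log_nonneg (le_max_right _ _), ?_⟩
  rw [Real.log_le_iff_le_exp (lt_max_of_lt_right one_pos)]
  apply max_le
  · calc ‖u‖ * Real.exp (-(2 * π * y)) ≤ 1 * Real.exp (-(2 * π * y)) := by gcongr
      _ ≤ _ := by rw [one_mul]; exact Real.exp_le_exp.2 (le_max_right _ _)
  · exact Real.one_le_exp (le_max_left _ _)

lemma lineMean_one_add_div_bounds {v : ℂ} (hv : ‖v‖ ≤ 1) (y : ℝ) :
    IsTrig 1 (fun z => 1 + v / ee z) (Polynomial.X + Polynomial.C v) ∧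
    Polynomial.X + Polynomial.C v ≠ 0 ∧
    0 ≤ lineMean (fun z => 1 + v / ee z) y ∧
    lineMean (fun z => 1 + v / ee z) y ≤ max 0 (2 * π * y) := by
  have ht : IsTrig 1 (fun z => 1 + v / ee z) (Polynomial.X + Polynomial.C v) := fun z => by
    have := ee_ne_zero z
    simp only [pow_one, Polynomial.eval_add, Polynomial.eval_X, Polynomial.eval_C]
    field_simp
  have hp : Polynomial.X + Polynomial.C v ≠ 0 := Polynomial.X_add_C_ne_zero v
  refine ⟨ht, hp, ?_⟩
  have hr : (0 : ℝ) < Real.exp (-(2 * π * y)) := Real.exp_pos _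
  rw [ht.lineMean_eq hp, Polynomial.roots_X_add_C, Polynomial.leadingCoeff_X_add_C]
  simp only [Nat.cast_one, mul_one, norm_one, Real.log_one, add_zero, Multiset.map_singleton,
    Multiset.sum_singleton, norm_neg]
  have hm : 0 < max (Real.exp (-(2 * π * y))) ‖v‖ := lt_max_of_lt_left hr
  constructor
  · have := Real.log_le_log hr (le_max_left _ ‖v‖)
    rw [Real.log_exp] at this
    linarith
  · have : Real.log (max (Real.exp (-(2 * π * y))) ‖v‖) ≤ max (-(2 * π * y)) 0 := by
      rw [Real.log_le_iff_le_exp hm]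
      exact max_le (Real.exp_le_exp.2 (le_max_left _ _)) (hv.trans (Real.one_le_exp (le_max_right _ _)))
    rcases le_total 0 (2 * π * y) with h | h
    · rw [max_eq_right (a := -(2 * π * y)) (by linarith)] at this
      rw [max_eq_right h]; linarith
    · rw [max_eq_left (b := (0 : ℝ)) (by linarith)] at this
      rw [max_eq_left h]; linarith

/-- The larger root of `t² - λ₂ t + λ₁ λ₃`. -/
def harperRoot (l1 l2 l3 : ℝ) : ℝ := (l2 + √(l2 ^ 2 - 4 * l1 * l3)) / 2

lemma harperRoot_spec {l1 l2 l3 : ℝ} (h1 : 0 ≤ l1) (h3 : 0 ≤ l3) (h : l1 + l3 ≤ l2) (h2 : 0 < l2) :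
    0 < harperRoot l1 l2 l3 ∧ l2 * harperRoot l1 l2 l3 = harperRoot l1 l2 l3 ^ 2 + l1 * l3 ∧
      l1 ≤ harperRoot l1 l2 l3 ∧ l3 ≤ harperRoot l1 l2 l3 := by
  have hd : 0 ≤ l2 ^ 2 - 4 * l1 * l3 := by nlinarith [sq_nonneg (l1 - l3)]
  have hs := Real.sqrt_nonneg (l2 ^ 2 - 4 * l1 * l3)
  have hq := Real.sq_sqrt hd
  have key : ∀ s t : ℝ, 0 ≤ s → s + t ≤ l2 → s * t = l1 * l3 → s ≤ harperRoot l1 l2 l3 := by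
    intro s t hs' hst e
    have : 2 * s - l2 ≤ √(l2 ^ 2 - 4 * l1 * l3) := by
      rcases le_total (2 * s - l2) 0 with h0 | h0
      · linarith
      apply Real.le_sqrt_of_sq_le
      nlinarith
    unfold harperRoot; linarith
  refine ⟨by unfold harperRoot; linarith, by unfold harperRoot; nlinarith, key l1 l3 h1 h rfl,
    key l3 l1 h3 (by linarith) (by ring)⟩

/-- Jensen's formula for the off-diagonal entries of the transfer matrix. -/
lemma lineMean_quadratic {s t l2 : ℝ} (hs : 0 ≤ s) (ht : 0 ≤ t) (h : s + t ≤ l2) (h2 : 0 < l2)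
    {ω : ℂ} (hω : ‖ω‖ = 1) {f : ℂ → ℂ}
    (hf : ∀ z, f z * ee z = s * ω⁻¹ + l2 * ee z + t * ω * ee z ^ 2) :
    ∃ p, p ≠ 0 ∧ IsTrig 1 f p ∧ ∀ y, Real.log (harperRoot s l2 t) ≤ lineMean f y ∧
      lineMean f y ≤ Real.log (harperRoot s l2 t) + 2 * π * |y| := by
  obtain ⟨ha, hq, has, hat⟩ := harperRoot_spec hs ht h h2
  set a := harperRoot s l2 t with hadef
  have hω0 : ω ≠ 0 := norm_ne_zero_iff.1 (by rw [hω]; exact one_ne_zero)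
  set u : ℂ := (t / a : ℝ) * ω with hudef
  set v : ℂ := (s / a : ℝ) * ω⁻¹ with hvdef
  have hu : ‖u‖ ≤ 1 := by
    rw [hudef, norm_mul, hω, mul_one, Complex.norm_of_nonneg (by positivity)]
    exact (div_le_one ha).2 hat
  have hv : ‖v‖ ≤ 1 := by
    rw [hvdef, norm_mul, norm_inv, hω, inv_one, mul_one, Complex.norm_of_nonneg (by positivity)]
    exact (div_le_one ha).2 has
  have haC : (a : ℂ) ≠ 0 := by exact_mod_cast ha.ne'
  have hqC : (l2 : ℂ) * a = a ^ 2 + s * t := by exact_mod_cast hq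
  have hfe : f = fun z => ((a : ℂ) * (1 + u * ee z)) * (1 + v / ee z) := by
    funext z
    have h0 := ee_ne_zero z
    apply mul_right_cancel₀ h0
    rw [hf z, hudef, hvdef]
    push_cast
    field_simp
    linear_combination (ω * ee z) * hqC
  obtain ⟨t1, p1, -⟩ := lineMean_one_add_mul_bounds hu 0
  obtain ⟨t2, p2, -⟩ := lineMean_one_add_div_bounds hv 0
  have t0 : IsTrig 0 (fun _ => (a : ℂ)) (Polynomial.C (a : ℂ)) := fun z => by simp
  have p0 : Polynomial.C (a : ℂ) ≠ 0 := by simpa using haC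
  have t01 := t0.mul t1
  have hT : IsTrig 1 f (Polynomial.C (a : ℂ) * (Polynomial.C u * Polynomial.X + Polynomial.C 1) *
      (Polynomial.X + Polynomial.C v)) := by
    rw [hfe]; simpa using t01.mul t2
  refine ⟨_, mul_ne_zero (mul_ne_zero p0 p1) p2, hT, fun y => ?_⟩
  obtain ⟨-, -, l1, u1⟩ := lineMean_one_add_mul_bounds hu y
  obtain ⟨-, -, l2', u2⟩ := lineMean_one_add_div_bounds hv y
  have e : lineMean f y = Real.log a + lineMean (fun z => 1 + u * ee z) y +
      lineMean (fun z => 1 + v / ee z) y := by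
    rw [hfe, t01.lineMean_mul t2 (mul_ne_zero p0 p1) p2, t0.lineMean_mul t1 p0 p1]
    congr 2
    simp [lineMean, abs_of_pos ha]
  rw [e]
  refine ⟨by linarith, ?_⟩
  have : max 0 (-(2 * π * y)) + max 0 (2 * π * y) = 2 * π * |y| := by
    rw [show 2 * π * |y| = |2 * π * y| by rw [abs_mul, abs_of_pos (by positivity : 0 < 2 * π)]]
    rcases le_total 0 (2 * π * y) with h | h
    · rw [max_eq_left (by linarith), max_eq_right h, abs_of_nonneg h, zero_add]
    · rw [max_eq_right (by linarith), max_eq_left h, abs_of_nonpos h, add_zero]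
  linarith

section harper
variable (l1 l2 l3 β : ℝ)

lemma harperC_mul_ee (z : ℂ) : harperC l1 l2 l3 β z * ee z =
    l3 * (ee (β / 2))⁻¹ + l2 * ee z + l1 * ee (β / 2) * ee z ^ 2 := by
  have h1 : Complex.exp ((2 * (π : ℂ) * Complex.I) * (z + (β : ℂ) / 2)) = ee z * ee (β / 2) := by
    rw [← ee_add]; rfl
  have h2 : Complex.exp (-(2 * (π : ℂ) * Complex.I) * (z + (β : ℂ) / 2)) =
      (ee z * ee (β / 2))⁻¹ := by
    rw [← h1, ← Complex.exp_neg]; congr 1; ring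
  have := ee_ne_zero z
  have := ee_ne_zero (β / 2)
  rw [harperC, h1, h2]
  field_simp

lemma harperCt_sub_mul_ee (z : ℂ) : harperCt l1 l2 l3 β (z - β) * ee z =
    l1 * ee (β / 2) + l2 * ee z + l3 * (ee (β / 2))⁻¹ * ee z ^ 2 := by
  have h1 : Complex.exp ((2 * (π : ℂ) * Complex.I) * (z - β + (β : ℂ) / 2)) =
      ee z * (ee (β / 2))⁻¹ := by
    have h0 : ee (z - β + (β : ℂ) / 2) * ee (β / 2) = ee z := by
      rw [← ee_add]; congr 1; ring
    rw [← h0, mul_inv_cancel_right₀ (ee_ne_zero _)]; rfl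
  have h2 : Complex.exp (-(2 * (π : ℂ) * Complex.I) * (z - β + (β : ℂ) / 2)) =
      (ee z * (ee (β / 2))⁻¹)⁻¹ := by
    rw [← h1, ← Complex.exp_neg]; congr 1; ring
  have := ee_ne_zero z
  have := ee_ne_zero (β / 2)
  rw [harperCt, h1, h2]
  field_simp
  ring

lemma two_cos_eq (z : ℂ) : 2 * Complex.cos (2 * (π : ℂ) * z) = ee z + (ee z)⁻¹ := by
  rw [Complex.two_cos, ee, ← Complex.exp_neg]
  congr 2 <;> ring

lemma norm_ee_half : ‖ee ((β : ℂ) / 2)‖ = 1 := by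
  have := norm_ee_ofReal (β / 2)
  push_cast at this
  exact this

lemma conj_harperC (x : ℝ) :
    (starRingEnd ℂ) (harperC l1 l2 l3 β (x : ℂ)) = harperCt l1 l2 l3 β (x : ℂ) := by
  simp only [harperC, harperCt, map_add, map_mul, Complex.conj_ofReal, ← Complex.exp_conj, map_neg,
    Complex.conj_I, map_div₀, map_ofNat]
  congr 3 <;> congr 1 <;> ring

variable {l1 l2 l3 β}

lemma lineMean_harperC (h1 : 0 ≤ l1) (h3 : 0 ≤ l3) (h : l1 + l3 ≤ l2) (h2 : 0 < l2) :
    ∃ p, p ≠ 0 ∧ IsTrig 1 (harperC l1 l2 l3 β) p ∧ ∀ y,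
      Real.log (harperRoot l1 l2 l3) ≤ lineMean (harperC l1 l2 l3 β) y ∧
      lineMean (harperC l1 l2 l3 β) y ≤ Real.log (harperRoot l1 l2 l3) + 2 * π * |y| := by
  have := lineMean_quadratic h3 h1 (by linarith) h2 (norm_ee_half β) (harperC_mul_ee l1 l2 l3 β)
  rwa [show harperRoot l3 l2 l1 = harperRoot l1 l2 l3 by unfold harperRoot; ring_nf] at this

lemma lineMean_harperCt (h1 : 0 ≤ l1) (h3 : 0 ≤ l3) (h : l1 + l3 ≤ l2) (h2 : 0 < l2) :
    ∃ p, p ≠ 0 ∧ IsTrig 1 (fun z => harperCt l1 l2 l3 β (z - β)) p ∧ ∀ y,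
      Real.log (harperRoot l1 l2 l3) ≤ lineMean (fun z => harperCt l1 l2 l3 β (z - β)) y ∧
      lineMean (fun z => harperCt l1 l2 l3 β (z - β)) y ≤
        Real.log (harperRoot l1 l2 l3) + 2 * π * |y| := by
  have hω : ‖(ee ((β : ℂ) / 2))⁻¹‖ = 1 := by rw [norm_inv, norm_ee_half, inv_one]
  exact lineMean_quadratic h1 h3 h h2 hω fun z => by
    rw [harperCt_sub_mul_ee, inv_inv]

lemma trigCocycle_harperA (hβ : Irrational β) (h1 : 0 ≤ l1) (h3 : 0 ≤ l3) (h : l1 + l3 ≤ l2)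
    (h2 : 0 < l2) (E : ℂ) :
    TrigCocycle (harperA l1 l2 l3 β E) β (Real.log (harperRoot l1 l2 l3)) := by
  obtain ⟨p, hp, hpt, hpm⟩ := lineMean_harperC (β := β) h1 h3 h h2
  obtain ⟨q, hq, hqt, hqm⟩ := lineMean_harperCt (β := β) h1 h3 h h2
  have hdet : (fun z => (harperA l1 l2 l3 β E z).det) =
      fun z => harperCt l1 l2 l3 β (z - β) * harperC l1 l2 l3 β z := by
    funext z; simp [harperA, Matrix.det_fin_two]
  refine ⟨hβ, ?_, ⟨q * p, mul_ne_zero hq hp, ?_⟩, fun y => ?_, fun y => ?_⟩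
  · intro i j
    fin_cases i <;> fin_cases j
    · refine ⟨Polynomial.C E * Polynomial.X - Polynomial.X ^ 2 - Polynomial.C 1, fun z => ?_⟩
      have := ee_ne_zero z
      simp only [harperA, two_cos_eq]
      simp
      field_simp
      ring
    · refine ⟨-q, fun z => ?_⟩
      have := hqt z
      simpa [harperA] using this
    · refine ⟨p, fun z => ?_⟩
      have := hpt z
      simpa [harperA] using this
    · exact ⟨0, fun z => by simp [harperA]⟩
  · rw [hdet]; exact hqt.mul hpt
  · rw [hdet, hqt.lineMean_mul hpt hq hp]
    linarith [(hqm y).1, (hpm y).1]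
  · rw [hdet, hqt.lineMean_mul hpt hq hp]
    linarith [(hqm y).2, (hpm y).2]

end harper

lemma norm_smul_mat (s : ℂ) (M : Mat) : ‖s • M‖ = ‖s‖ * ‖M‖ := by
  rw [← sq_eq_sq₀ (norm_nonneg _) (by positivity), mul_pow, norm_sq_mat, norm_sq_mat]
  simp only [Matrix.smul_apply, smul_eq_mul, norm_mul]
  ring

/-- A rescaled iterate extends continuously to the point `w = 0`. -/
lemma exists_continuous_iter {A : ℂ → Mat} {β : ℝ} {e : ℂ → ℂ} {ρ : ℂ} (hρ : ‖ρ‖ = 1)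
    (he : ∀ z, e (z + β) = ρ * e z) {P : ℂ → Mat} (hP : ∀ i j, Continuous fun w => P w i j)
    (hAP : ∀ z, e z • A z = P (e z)) (m : ℕ) :
    ∃ F : ℂ → Mat, (∀ i j, Continuous fun w => F w i j) ∧ F 0 = P 0 ^ m ∧
      ∀ z, ∃ s : ℂ, ‖s‖ = ‖e z‖ ^ m ∧ s • iterC A β m z = F (e z) := by
  induction m with
  | zero => exact ⟨fun _ => 1, fun _ _ => continuous_const, by simp, fun z => ⟨1, by simp, by simp [iterC]⟩⟩
  | succ m ih =>
    obtain ⟨F, hF, hF0, hFs⟩ := ih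
    refine ⟨fun w => F (ρ * w) * P w, fun i j => ?_, by simp [hF0, pow_succ], fun z => ?_⟩
    · simp only [Matrix.mul_apply, Fin.sum_univ_two]
      have h (k : Fin 2) : Continuous fun w => F (ρ * w) i k :=
        (hF i k).comp (continuous_const.mul continuous_id)
      exact ((h 0).mul (hP 0 j)).add ((h 1).mul (hP 1 j))
    · obtain ⟨s, hs, hsi⟩ := hFs (z + β)
      refine ⟨s * e z, ?_, ?_⟩
      · rw [norm_mul, hs, he, norm_mul, hρ, one_mul, pow_succ]
      · simp only
        rw [← he, ← hsi, ← hAP, iterC, Matrix.smul_mul, Matrix.mul_smul, smul_smul]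

/-- Powers of a matrix with spectral radius at most `a` grow at most like `m * a ^ m`. -/
lemma norm_pow_entry_le {T : Mat} {μ ν : ℂ} {a : ℝ} (ha : 0 < a) (htr : T.trace = μ + ν)
    (hdet : T.det = μ * ν) (hμ : ‖μ‖ ≤ a) (hν : ‖ν‖ ≤ a) (m : ℕ) (i j : Fin 2) :
    a * ‖(T ^ m) i j‖ ≤ a ^ m * (a + m * ‖T - μ • (1 : Mat)‖) := by
  have hCH : T * (T - μ • (1 : Mat)) = ν • (T - μ • (1 : Mat)) := by
    rw [Matrix.trace_fin_two] at htr
    rw [Matrix.det_fin_two] at hdet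
    ext i j
    fin_cases i <;> fin_cases j <;> simp [Matrix.mul_apply, Fin.sum_univ_two]
    · linear_combination T 0 0 * htr - hdet
    · linear_combination T 0 1 * htr
    · linear_combination T 1 0 * htr
    · linear_combination T 1 1 * htr - hdet
  have hpow (m : ℕ) : T ^ m * (T - μ • (1 : Mat)) = ν ^ m • (T - μ • (1 : Mat)) := by
    induction m with
    | zero => simp
    | succ m ih => rw [pow_succ, mul_assoc, hCH, Matrix.mul_smul, ih, smul_smul, pow_succ, mul_comm]
  induction m with
  | zero =>
    simp only [pow_zero, Nat.cast_zero, zero_mul, add_zero, one_mul]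
    have : ‖(1 : Mat) i j‖ ≤ 1 := by fin_cases i <;> fin_cases j <;> simp
    nlinarith
  | succ m ih =>
    have h : T ^ (m + 1) = μ • T ^ m + ν ^ m • (T - μ • (1 : Mat)) := by
      rw [← hpow, mul_sub, Matrix.mul_smul, mul_one, pow_succ]; abel
    have h1 : ‖(T ^ (m + 1)) i j‖ ≤ a * ‖(T ^ m) i j‖ + a ^ m * ‖T - μ • (1 : Mat)‖ := by
      rw [h, Matrix.add_apply, Matrix.smul_apply, Matrix.smul_apply, smul_eq_mul, smul_eq_mul]
      refine (norm_add_le _ _).trans ?_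
      rw [norm_mul, norm_mul, norm_pow]
      gcongr
      exact norm_entry_le _ i j
    calc a * ‖(T ^ (m + 1)) i j‖ ≤ a * (a * ‖(T ^ m) i j‖ + a ^ m * ‖T - μ • (1 : Mat)‖) := by gcongr
      _ ≤ a * (a ^ m * (a + m * ‖T - μ • (1 : Mat)‖) + a ^ m * ‖T - μ • (1 : Mat)‖) := by gcongr
      _ = _ := by push_cast; ring

lemma exists_norm_pow_lt {T : Mat} {μ ν : ℂ} {a : ℝ} (ha : 0 < a) (htr : T.trace = μ + ν)
    (hdet : T.det = μ * ν) (hμ : ‖μ‖ ≤ a) (hν : ‖ν‖ ≤ a) {ε : ℝ} (hε : 0 < ε) :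
    ∃ m : ℕ, m ≠ 0 ∧ ‖T ^ m‖ < Real.exp (m * (Real.log a + ε)) := by
  set B := ‖T - μ • (1 : Mat)‖ / a with hB
  have hB0 : 0 ≤ B := by positivity
  obtain ⟨m, hm⟩ := exists_nat_gt ((2 * B + 2) * 2 / ε ^ 2)
  have hm0 : (0 : ℝ) < m := lt_of_le_of_lt (by positivity) hm
  have hm1 : (1 : ℝ) ≤ m := by exact_mod_cast hm0
  refine ⟨m, by exact_mod_cast hm0.ne', ?_⟩
  rw [div_lt_iff₀ (by positivity)] at hm
  have h1 : ‖T ^ m‖ ≤ 2 * (a ^ m * (1 + m * B)) := by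
    apply norm_mat_le
    intro i j
    have := norm_pow_entry_le ha htr hdet hμ hν m i j
    rw [← mul_le_mul_iff_right₀ ha]
    refine this.trans (le_of_eq ?_)
    rw [hB]; field_simp
  have h2 := Real.quadratic_le_exp_of_nonneg (x := m * ε) (by positivity)
  have h3 : 2 * (1 + m * B) < Real.exp (m * ε) := by
    have : (m * ε) ^ 2 / 2 ≥ m * (2 * B + 2) := by nlinarith
    nlinarith [mul_pos hm0 hε]
  have h4 : Real.exp (m * (Real.log a + ε)) = a ^ m * Real.exp (m * ε) := by
    rw [mul_add, Real.exp_add, mul_comm (m : ℝ) (Real.log a), Real.exp_mul, Real.exp_log ha,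
      Real.rpow_natCast]
  rw [h4]
  have : 0 < a ^ m := by positivity
  nlinarith

namespace TrigCocycle

lemma eventually_rate_le {A : ℂ → Mat} {β la : ℝ} (hA : TrigCocycle A β la) {e : ℂ → ℂ} {ρ : ℂ}
    (hρ : ‖ρ‖ = 1) (he : ∀ z, e (z + β) = ρ * e z) {σ : ℝ}
    (hn : ∀ x Y : ℝ, ‖e (x + (σ * Y : ℝ) * Complex.I)‖ = Real.exp (-(2 * π * Y)))
    {P : ℂ → Mat} (hP : ∀ i j, Continuous fun w => P w i j)
    (hAP : ∀ z, e z • A z = P (e z)) {μ ν : ℂ} {a : ℝ} (ha : 0 < a)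
    (htr : (P 0).trace = μ + ν) (hdet : (P 0).det = μ * ν) (hμ : ‖μ‖ ≤ a) (hν : ‖ν‖ ≤ a)
    {ε : ℝ} (hε : 0 < ε) :
    ∀ᶠ Y in atTop, rate A β (σ * Y) < Real.log a + ε + 2 * π * Y := by
  obtain ⟨m, hm0, hm⟩ := exists_norm_pow_lt ha htr hdet hμ hν (half_pos hε)
  obtain ⟨F, hF, hF0, hFs⟩ := exists_continuous_iter hρ he hP hAP m
  have hc := continuous_norm_mat hF
  rw [← hF0] at hm
  obtain ⟨δ, hδ, hball⟩ := Metric.eventually_nhds_iff.1 (hc.tendsto 0 |>.eventually_lt_const hm)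
  have ht : Tendsto (fun Y : ℝ => Real.exp (-(2 * π * Y))) atTop (nhds 0) :=
    Real.tendsto_exp_neg_atTop_nhds_zero.comp (tendsto_id.const_mul_atTop (by positivity))
  have hmpos : (0 : ℝ) < m := by exact_mod_cast Nat.pos_of_ne_zero hm0
  filter_upwards [ht.eventually_lt_const hδ] with Y hY
  have hsup : supLine (iterC A β m) (σ * Y) ≤
      Real.exp (m * (Real.log a + ε / 2 + 2 * π * Y)) := by
    apply ciSup_le
    intro x
    obtain ⟨s, hs, hsi⟩ := hFs (x + (σ * Y : ℝ) * Complex.I)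
    have h1 := hball (y := e (x + (σ * Y : ℝ) * Complex.I)) (by rwa [dist_zero_right, hn])
    rw [← hsi, norm_smul_mat, hs, hn, ← Real.exp_nat_mul] at h1
    have h2 : Real.exp (m * (Real.log a + ε / 2 + 2 * π * Y)) =
        Real.exp (m * (2 * π * Y)) * Real.exp (m * (Real.log a + ε / 2)) := by
      rw [← Real.exp_add]; ring_nf
    rw [h2]
    have h3 : Real.exp (m * (2 * π * Y)) * Real.exp (m * -(2 * π * Y)) = 1 := by
      rw [← Real.exp_add, ← Real.exp_zero]; ring_nf
    calc ‖iterC A β m (x + (σ * Y : ℝ) * Complex.I)‖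
        = Real.exp (m * (2 * π * Y)) * (Real.exp (m * -(2 * π * Y)) *
          ‖iterC A β m (x + (σ * Y : ℝ) * Complex.I)‖) := by rw [← mul_assoc, h3, one_mul]
      _ ≤ _ := by gcongr
  have h4 := hA.rate_le_div hm0 (σ * Y)
  have h5 := (Real.log_le_iff_le_exp (hA.supLine_pos m (σ * Y))).2 hsup
  calc rate A β (σ * Y) ≤ _ := h4
    _ ≤ (m * (Real.log a + ε / 2 + 2 * π * Y)) / m := by gcongr
    _ = Real.log a + ε / 2 + 2 * π * Y := by field_simp
    _ < _ := by linarith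

end TrigCocycle

lemma exists_roots_norm_le {l1 l2 l3 : ℝ} (h1 : 0 ≤ l1) (h3 : 0 ≤ l3) (h : l1 + l3 ≤ l2)
    (h2 : 1 ≤ l2) : ∃ μ ν : ℂ, -1 = μ + ν ∧ (l1 * l3 : ℂ) = μ * ν ∧
      ‖μ‖ ≤ harperRoot l1 l2 l3 ∧ ‖ν‖ ≤ harperRoot l1 l2 l3 := by
  obtain ⟨ha, -, ha1, ha3⟩ := harperRoot_spec h1 h3 h (by linarith)
  rcases le_total 0 (1 - 4 * (l1 * l3)) with hd | hd
  · have hq := Real.sq_sqrt hd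
    have hs := Real.sqrt_nonneg (1 - 4 * (l1 * l3))
    have hle : √(1 - 4 * (l1 * l3)) ≤ √(l2 ^ 2 - 4 * l1 * l3) :=
      Real.sqrt_le_sqrt (by nlinarith)
    have hqC : ((√(1 - 4 * (l1 * l3)) : ℝ) : ℂ) ^ 2 = 1 - 4 * (l1 * l3) := by exact_mod_cast hq
    refine ⟨(((-1 + √(1 - 4 * (l1 * l3))) / 2 : ℝ) : ℂ), (((-1 - √(1 - 4 * (l1 * l3))) / 2 : ℝ) : ℂ),
      ?_, ?_, ?_, ?_⟩
    · push_cast; ring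
    · push_cast; linear_combination (-1 / 4 : ℂ) * -hqC
    · rw [Complex.norm_real, Real.norm_eq_abs, abs_le]
      unfold harperRoot
      constructor <;> linarith
    · rw [Complex.norm_real, Real.norm_eq_abs, abs_le]
      unfold harperRoot
      constructor <;> linarith
  · have hq := Real.sq_sqrt (show 0 ≤ 4 * (l1 * l3) - 1 by linarith)
    set s := √(4 * (l1 * l3) - 1)
    have hqC : (s : ℂ) ^ 2 = 4 * (l1 * l3) - 1 := by exact_mod_cast hq
    have hnorm (t : ℝ) (ht : t ^ 2 = s ^ 2) : ‖((-1 / 2 : ℝ) + (t / 2 : ℝ) * Complex.I : ℂ)‖ ≤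
        harperRoot l1 l2 l3 := by
      rw [Complex.norm_add_mul_I]
      apply Real.sqrt_le_iff.2 ⟨ha.le, _⟩
      nlinarith
    refine ⟨(-1 / 2 : ℝ) + (s / 2 : ℝ) * Complex.I, (-1 / 2 : ℝ) + (-s / 2 : ℝ) * Complex.I,
      ?_, ?_, hnorm s rfl, hnorm (-s) (by ring)⟩
    · push_cast; ring
    · push_cast
      linear_combination (-1 / 4 : ℂ) * hqC + (s ^ 2 / 4 : ℂ) * Complex.I_sq

lemma asympRate_harperA {l1 l2 l3 β : ℝ} (hβ : Irrational β) (h1 : 0 ≤ l1) (h3 : 0 ≤ l3)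
    (h : l1 + l3 ≤ l2) (h2 : 1 ≤ l2) (E : ℂ) :
    AsympRate (harperA l1 l2 l3 β E) β (Real.log (harperRoot l1 l2 l3)) := by
  have hA := trigCocycle_harperA hβ h1 h3 h (by linarith) E
  obtain ⟨ha, -⟩ := harperRoot_spec h1 h3 h (by linarith)
  obtain ⟨μ, ν, hs, hp, hμ, hν⟩ := exists_roots_norm_le h1 h3 h h2
  have hω := ee_ne_zero ((β : ℂ) / 2)
  intro ε hε R
  have up := hA.eventually_rate_le (e := ee) (ρ := ee β) (σ := 1) (norm_ee_ofReal β)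
    (fun z => by rw [ee_add, mul_comm]) (fun x Y => by rw [one_mul, norm_ee_line])
    (P := fun w => !![E * w - w ^ 2 - 1,
        -(l1 * ee (β / 2) + l2 * w + l3 * (ee (β / 2))⁻¹ * w ^ 2);
      l3 * (ee (β / 2))⁻¹ + l2 * w + l1 * ee (β / 2) * w ^ 2, 0])
    (fun i j => by fin_cases i <;> fin_cases j <;> simp <;> fun_prop)
    (fun z => by
      have h0 := ee_ne_zero z
      rw [← harperC_mul_ee, ← harperCt_sub_mul_ee]
      ext i j
      fin_cases i <;> fin_cases j <;> simp [harperA, two_cos_eq]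
      · field_simp
        ring
      · ring
      · ring)
    ha (by simpa [Matrix.trace_fin_two] using hs)
    (by rw [← hp]; simp [Matrix.det_fin_two]; field_simp) hμ hν hε
  have down := hA.eventually_rate_le (e := fun z => (ee z)⁻¹) (ρ := (ee β)⁻¹) (σ := -1)
    (by rw [norm_inv, norm_ee_ofReal, inv_one])
    (fun z => by rw [ee_add, mul_inv, mul_comm]) (fun x Y => by
      rw [norm_inv, norm_ee_line, ← Real.exp_neg]; ring_nf)
    (P := fun w => !![E * w - w ^ 2 - 1,
        -(l1 * ee (β / 2) * w ^ 2 + l2 * w + l3 * (ee (β / 2))⁻¹);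
      l3 * (ee (β / 2))⁻¹ * w ^ 2 + l2 * w + l1 * ee (β / 2), 0])
    (fun i j => by fin_cases i <;> fin_cases j <;> simp <;> fun_prop)
    (fun z => by
      have h0 := ee_ne_zero z
      have hc := harperC_mul_ee l1 l2 l3 β z
      have hct := harperCt_sub_mul_ee l1 l2 l3 β z
      rw [← eq_div_iff h0] at hc hct
      ext i j
      fin_cases i <;> fin_cases j <;> simp [harperA, two_cos_eq, hc, hct] <;> field_simp <;> ring)
    ha (by simpa [Matrix.trace_fin_two] using hs)
    (by rw [← hp]; simp [Matrix.det_fin_two]; field_simp) hμ hν hε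
  obtain ⟨Y, ⟨hY1, hY2⟩, hYR⟩ := ((up.and down).and (eventually_ge_atTop R)).exists
  exact ⟨Y, hYR, by simpa using hY1, by simpa using hY2⟩

lemma cocycleIter_eq_iterC (A : ℂ → Mat) (β : ℝ) (n : ℕ) (x : ℝ) :
    cocycleIter (fun t : ℝ => A t) β n x = iterC A β n x := by
  induction n generalizing x with
  | zero => rfl
  | succ n ih => rw [cocycleIter, iterC, ih]; push_cast; rfl

lemma logIntegral_eq_coe {g : ℝ → ℝ}
    (hi : IntervalIntegrable (fun x => Real.log (g x)) volume 0 1)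
    (h0 : ∀ᵐ x ∂(volume.restrict (Set.Ioc (0 : ℝ) 1)), g x ≠ 0) :
    logIntegral g = ((∫ x in (0 : ℝ)..1, Real.log (g x) : ℝ) : EReal) := by
  rw [intervalIntegrable_iff_integrableOn_Ioc_of_le zero_le_one] at hi
  have hneg : ∫⁻ x in Set.Ioc (0 : ℝ) 1,
      (if g x = 0 then (⊤ : ℝ≥0∞) else ENNReal.ofReal (-Real.log (g x))) =
      ∫⁻ x in Set.Ioc (0 : ℝ) 1, ENNReal.ofReal (-Real.log (g x)) := by
    apply lintegral_congr_ae
    filter_upwards [h0] with x hx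
    rw [if_neg hx]
  rw [logIntegral, hneg, intervalIntegral.integral_of_le zero_le_one,
    integral_eq_lintegral_pos_part_sub_lintegral_neg_part hi, EReal.coe_sub,
    EReal.coe_ennreal_toReal hi.lintegral_lt_top.ne,
    EReal.coe_ennreal_toReal (show ∫⁻ x in Set.Ioc (0 : ℝ) 1, ENNReal.ofReal (-Real.log (g x)) ≠ ⊤
      from hi.neg.lintegral_lt_top.ne)]

/-- On the real line the uniform growth rate is the Lyapunov exponent. -/
lemma TrigCocycle.lyapunov_eq_rate {A : ℂ → Mat} {β la : ℝ} (hA : TrigCocycle A β la) :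
    lyapunov β (fun x : ℝ => A x) = (rate A β 0 : EReal) := by
  have hterm (n : ℕ) : ((((n : ℝ) + 1)⁻¹ : ℝ) : EReal) *
      logIntegral (fun x => ‖cocycleIter (fun t : ℝ => A t) β (n + 1) x‖) =
      ((((n : ℝ) + 1)⁻¹ * ∫ x in (0 : ℝ)..1, Real.log ‖iterC A β (n + 1) x‖ : ℝ) : EReal) := by
    have h1 := hA.intervalIntegrable_log_norm (n + 1) 0
    have h2 := hA.ae_norm_ne_zero (n + 1) 0
    simp only [Complex.ofReal_zero, zero_mul, add_zero] at h1 h2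
    simp only [cocycleIter_eq_iterC]
    rw [logIntegral_eq_coe h1 h2, EReal.coe_mul]
  simp only [lyapunov, hterm]
  apply le_antisymm
  · refine EReal.le_of_forall_lt_iff_le.1 fun K hK => ?_
    obtain ⟨n, hn, hn1⟩ := ((hA.eventually_supLine_le 0 (EReal.coe_lt_coe_iff.1 hK)).and
      (eventually_ge_atTop 1)).exists
    obtain ⟨m, rfl⟩ := Nat.exists_eq_add_of_le' hn1
    refine (iInf_le _ m).trans (EReal.coe_le_coe_iff.2 ?_)
    rw [inv_mul_le_iff₀ (by positivity)]
    have h1 := hA.intervalIntegrable_log_norm (m + 1) 0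
    have h2 := hA.ae_norm_ne_zero (m + 1) 0
    have h3 := hA.norm_le_supLine (m + 1)
    have h4 : ∫ x in (0 : ℝ)..1, Real.log ‖iterC A β (m + 1) (x + (0 : ℝ) * Complex.I)‖ ≤
        ∫ x in (0 : ℝ)..1, (((m + 1 : ℕ) : ℝ) * K) := by
      rw [intervalIntegral.integral_of_le zero_le_one, intervalIntegral.integral_of_le zero_le_one]
      apply integral_mono_ae
        ((intervalIntegrable_iff_integrableOn_Ioc_of_le zero_le_one).1 h1) (integrable_const _)
      filter_upwards [h2] with x hx
      rw [Real.log_le_iff_le_exp ((norm_nonneg _).lt_of_ne' hx)]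
      exact (h3 x 0).trans hn
    simpa using h4
  · refine le_iInf fun n => EReal.coe_le_coe_iff.2 ?_
    rw [le_inv_mul_iff₀ (by positivity)]
    simpa using hA.rate_le_integral (n + 1) 0

/-- For irrational `β` and coupling `λ` in region II
(`1 ≤ λ₂` and `λ₁ + λ₃ ≤ λ₂`), for every real energy `E` in the spectrum of the extended
Harper operator, the Lyapunov exponent of the transfer-matrix cocycle equals
`log ((λ₂ + √(λ₂² - 4λ₁λ₃))/2)` (equivalently, `L(β, B^E) = 0` on the spectrum in region II). -/
theorem extendedHarper_lyapunov_regionII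
    (β lam1 lam2 lam3 θ : ℝ) (hβ : Irrational β)
    (h1 : 0 ≤ lam1) (h2 : 0 ≤ lam2) (h3 : 0 ≤ lam3)
    (hpos : 0 < lam1 ∨ 0 < lam2 ∨ 0 < lam3)
    (hII : 1 ≤ lam2 ∧ lam1 + lam3 ≤ lam2)
    (H : lp (fun _ : ℤ => ℂ) 2 →L[ℂ] lp (fun _ : ℤ => ℂ) 2)
    (hH : ∀ (ψ : lp (fun _ : ℤ => ℂ) 2) (k : ℤ),
      H ψ k = ((2 * Real.cos (2 * π * (θ + β * k)) : ℝ) : ℂ) * ψ k +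
        harperC lam1 lam2 lam3 β ((θ + β * k : ℝ) : ℂ) * ψ (k + 1) +
        (starRingEnd ℂ) (harperC lam1 lam2 lam3 β ((θ + β * (k - 1) : ℝ) : ℂ)) * ψ (k - 1))
    (E : ℝ) (hE : (E : ℂ) ∈ spectrum ℂ H) :
    lyapunov β (fun x : ℝ => harperA lam1 lam2 lam3 β (E : ℂ) (x : ℂ)) =
      ((Real.log ((lam2 + Real.sqrt (lam2 ^ 2 - 4 * lam1 * lam3)) / 2) : ℝ) : EReal) := by
  obtain ⟨h21, h123⟩ := hII
  have hl2 : 0 < lam2 := by linarith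
  have hA := trigCocycle_harperA hβ h1 h3 h123 hl2 (E : ℂ)
  obtain ⟨p, hp, hpt, hpm⟩ := lineMean_harperC (β := β) h1 h3 h123 hl2
  obtain ⟨q, hq, hqt, hqm⟩ := lineMean_harperCt (β := β) h1 h3 h123 hl2
  rw [hA.lyapunov_eq_rate]
  suffices h : rate (harperA lam1 lam2 lam3 β E) β 0 ≤
      Real.log (harperRoot lam1 lam2 lam3) from
    congrArg _ (le_antisymm h (hA.la_le_rate 0))
  by_contra! hlt
  obtain ⟨K, hK⟩ := hA.exists_tsum_sq_le (asympRate_harperA hβ h1 h3 h123 h21 E) hlt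
    (fun z => rfl) hqt hpt hq hp (by simpa using (hqm 0).2) (by simpa using (hpm 0).2)
  refine notMem_spectrum_of_coercive (fun k => 2 * Real.cos (2 * π * (θ + β * k)))
    (fun k => harperC lam1 lam2 lam3 β ((θ + β * k : ℝ) : ℂ)) H (fun ψ k => ?_) E K
    (fun ψ g hψ hg hrec => hK θ ψ g hψ hg fun k => ?_) hE
  · rw [hH ψ k]; push_cast; rfl
  · rw [hrec k, conj_harperC]
    push_cast
    congr 4
    ring_nf
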